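/- arXiv:2304.10388 — 10 statements merged into one kernel-verified Lean document; each statement's English description precedes it below -/
import Mathlib

section
/- Let J be a nonempty finite index set and c : J → ℂ. If the function (0,∞) → ℂ given by q ↦ ∑_{j∈J} q^{c(j)} is constant, then c(j) = 0 for every j ∈ J; that is, a sum of several terms of the form q^{a+bi} can be constant as a function of q ∈ (0,∞) only if each term in the sum is identically q⁰ = 1. -/
/-- The exponential character `t ↦ exp (t * a)` of the additive group of real numbers. -/
noncomputable def realExpChar (a : ℂ) : Multiplicative ℝ →* ℂ where
  toFun t := Complex.exp ((t.toAdd : ℂ) * a)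
  map_one' := by simp
  map_mul' s t := by simp [add_mul, Complex.exp_add]

lemma realExpChar_injective : Function.Injective realExpChar := by
  intro a b hab
  have hderiv (z : ℂ) : HasDerivAt (fun t : ℝ => Complex.exp ((t : ℂ) * z)) z 0 := by
    simpa using (((hasDerivAt_id (0 : ℝ)).ofReal_comp).mul_const z).cexp
  have hfun : (fun t : ℝ => Complex.exp ((t : ℂ) * a)) = fun t : ℝ => Complex.exp ((t : ℂ) * b) :=
    funext fun t => DFunLike.congr_fun hab (Multiplicative.ofAdd t)
  exact (hderiv a).unique (hfun ▸ hderiv b)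

lemma linearIndependent_realExpChar :
    LinearIndependent ℂ (fun a : ℂ => (realExpChar a : Multiplicative ℝ → ℂ)) :=
  (linearIndependent_monoidHom (Multiplicative ℝ) ℂ).comp realExpChar realExpChar_injective

/-- If a finite (nonempty) sum of complex powers
`q ↦ ∑_{j ∈ J} q ^ (c j)` is constant on `(0,∞)`, then every exponent
`c j` vanishes (i.e., each term is identically `q ^ 0 = 1`). -/
theorem sum_cpow_const_iff_exponents_zero {J : Type*} [Fintype J] [Nonempty J]
    (c : J → ℂ)
    (h : ∃ k : ℂ, ∀ q : ℝ, 0 < q → ∑ j, (q : ℂ) ^ (c j) = k) :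
    ∀ j, c j = 0 := by
  classical
  obtain ⟨k, hk⟩ := h
  intro i
  by_contra hi
  have hcoeff : (∑ j, Finsupp.single (c j) (1 : ℂ)) - Finsupp.single 0 k = 0 := by
    refine linearIndependent_iff.mp linearIndependent_realExpChar _ ?_
    ext t
    have ht := hk (Real.exp t.toAdd) (Real.exp_pos _)
    have hpow (z : ℂ) : ((Real.exp t.toAdd : ℝ) : ℂ) ^ z = realExpChar z t := by
      rw [Complex.cpow_def_of_ne_zero (by exact_mod_cast (Real.exp_pos _).ne'),
        ← Complex.ofReal_log (Real.exp_pos _).le, Real.log_exp]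
      rfl
    simp only [hpow] at ht
    have hzero : realExpChar 0 t = 1 := by simp [realExpChar]
    simp [map_sub, map_sum, Finsupp.linearCombination_single, ht, hzero]
  have hcard := DFunLike.congr_fun hcoeff (c i)
  simp [Finsupp.single_apply, Ne.symm hi, Finset.sum_boole] at hcard
  exact hcard (x := i) rfl
end

section
/- Let G be a group and H a subgroup of G. The pair (G,H) has the transitive-commutation property if and only if there exists a family 𝒦 of abelian subgroups of G such that the sets K∖H, for K ∈ 𝒦, are nonempty, pairwise disjoint, and have union G∖H (i.e., {K∖H}_{K∈𝒦} is a partition of G∖H), and any two elements of G∖H which commute lie in the same member K of 𝒦. -/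
/-- A group-subgroup pair `(G, H)` has the *transitive-commutation property*
if the commutation relation on `G ∖ H` is transitive. -/
def TransitiveCommutation {G : Type*} [Group G] (H : Subgroup G) : Prop :=
  ∀ x y z : G, x ∉ H → y ∉ H → z ∉ H → x * y = y * x → y * z = z * y → x * z = z * x

/-- Outside `H`, centralizers of elements are abelian when `(G, H)` has the
transitive-commutation property. -/
theorem TransitiveCommutation.commute_of_commute {G : Type*} [Group G] {H : Subgroup G}
    (h : TransitiveCommutation H) {x a b : G} (hx : x ∉ H) (ha : Commute a x)
    (hb : Commute b x) : Commute a b := by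
  have left : ∀ {c d : G}, Commute c x → Commute d x → d ∉ H → Commute c d := by
    intro c d hc hd hdH
    by_cases hcH : c ∈ H
    · have hcx : c * x ∉ H := fun hm => hx ((H.mul_mem_cancel_left hcH).1 hm)
      have key : Commute (c * x) d :=
        h (c * x) x d hcx hx hdH (hc.mul_left (Commute.refl x)) hd.symm
      simpa using key.mul_left hd.symm.inv_left
    · exact h c x d hcH hx hdH hc hd.symm
  by_cases hbH : b ∈ H
  · have hbx : b * x ∉ H := fun hm => hx ((H.mul_mem_cancel_left hbH).1 hm)
    have key : Commute a (b * x) := left ha (hb.mul_left (Commute.refl x)) hbx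
    simpa using key.mul_right ha.inv_right
  · exact left ha hb hbH

/-- Commuting elements outside `H` have the same centralizer when `(G, H)` has the
transitive-commutation property. -/
theorem TransitiveCommutation.centralizer_eq {G : Type*} [Group G] {H : Subgroup G}
    (h : TransitiveCommutation H) {x y : G} (hx : x ∉ H) (hy : y ∉ H) (hxy : Commute x y) :
    Subgroup.centralizer {x} = Subgroup.centralizer {y} := by
  ext a
  simp only [Subgroup.mem_centralizer_singleton_iff]
  exact ⟨fun ha => h.commute_of_commute hx ha hxy.symm,
    fun ha => h.commute_of_commute hy ha hxy⟩

/-- `(G, H)` has the transitive-commutation property iff there is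
a family `𝒦` of abelian subgroups of `G` such that the sets `K ∖ H`, `K ∈ 𝒦`,
are nonempty, pairwise disjoint with union `G ∖ H` (a partition of `G ∖ H`),
and any two commuting elements of `G ∖ H` lie in the same member of `𝒦`. -/
theorem transitiveCommutation_iff_partition {G : Type*} [Group G] (H : Subgroup G) :
    TransitiveCommutation H ↔
      ∃ 𝒦 : Set (Subgroup G),
        (∀ K ∈ 𝒦, ∀ a ∈ K, ∀ b ∈ K, a * b = b * a) ∧
        (∀ K ∈ 𝒦, ((K : Set G) \ (H : Set G)).Nonempty) ∧
        (∀ K ∈ 𝒦, ∀ K' ∈ 𝒦, K ≠ K' →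
          Disjoint ((K : Set G) \ (H : Set G)) ((K' : Set G) \ (H : Set G))) ∧
        (⋃ K ∈ 𝒦, ((K : Set G) \ (H : Set G))) = Set.univ \ (H : Set G) ∧
        (∀ x y : G, x ∉ H → y ∉ H → x * y = y * x → ∃ K ∈ 𝒦, x ∈ K ∧ y ∈ K) := by
  constructor
  · intro h
    refine ⟨{K | ∃ x, x ∉ H ∧ K = Subgroup.centralizer {x}}, ?_, ?_, ?_, ?_, ?_⟩
    · rintro _ ⟨x, hx, rfl⟩ a ha b hb
      rw [Subgroup.mem_centralizer_singleton_iff] at ha hb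
      exact h.commute_of_commute hx ha hb
    · rintro _ ⟨x, hx, rfl⟩
      exact ⟨x, Subgroup.mem_centralizer_singleton_iff.2 rfl, hx⟩
    · rintro _ ⟨x, hx, rfl⟩ _ ⟨y, hy, rfl⟩ hne
      refine Set.disjoint_left.2 ?_
      rintro z ⟨hzx, hz⟩ ⟨hzy, -⟩
      rw [SetLike.mem_coe, Subgroup.mem_centralizer_singleton_iff] at hzx hzy
      exact hne ((h.centralizer_eq hz hx hzx).symm.trans (h.centralizer_eq hz hy hzy))
    · ext z
      simp only [Set.mem_iUnion, Set.mem_sdiff, Set.mem_univ, true_and, SetLike.mem_coe]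
      exact ⟨fun ⟨_, _, _, hz⟩ => hz, fun hz =>
        ⟨_, ⟨z, hz, rfl⟩, Subgroup.mem_centralizer_singleton_iff.2 rfl, hz⟩⟩
    · intro x y hx _ hxy
      exact ⟨_, ⟨x, hx, rfl⟩, Subgroup.mem_centralizer_singleton_iff.2 rfl,
        Subgroup.mem_centralizer_singleton_iff.2 hxy.symm⟩
  · rintro ⟨𝒦, hab, -, hdisj, -, hcomm⟩ x y z hx hy hz hxy hyz
    obtain ⟨K, hK, hxK, hyK⟩ := hcomm x y hx hy hxy
    obtain ⟨K', hK', hyK', hzK'⟩ := hcomm y z hy hz hyz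
    obtain rfl : K = K' := by
      by_contra hne
      exact Set.disjoint_left.1 (hdisj K hK K' hK' hne) ⟨hyK, hy⟩ ⟨hyK', hy⟩
    exact hab K hK x hxK z hzK'
end

section
/- Let G be a group and H a subgroup of G such that the pair (G,H) has the transitive-commutation property, and let 𝒦 be a family of abelian subgroups of G such that {K∖H}_{K∈𝒦} is a partition of G∖H and any two commuting elements of G∖H lie in the same member of 𝒦. Then every abelian subgroup N of G is either contained in H, or contained in a unique member K of 𝒦. -/
/-- If `(G,H)` has the transitive-commutation property and `𝒦` is a
family of abelian subgroups of `G` such that `{K ∖ H}_{K ∈ 𝒦}` is a partition of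
`G ∖ H` and any two commuting elements of `G ∖ H` lie in the same member of `𝒦`,
then every abelian subgroup `N` of `G` is contained in `H`, or contained in a
unique member `K` of `𝒦`. -/
theorem abelian_subgroup_in_H_or_unique_member {G : Type*} [Group G] (H : Subgroup G)
    (htc : TransitiveCommutation H)
    (𝒦 : Set (Subgroup G))
    (habel : ∀ K ∈ 𝒦, ∀ a ∈ K, ∀ b ∈ K, a * b = b * a)
    (hne : ∀ K ∈ 𝒦, ((K : Set G) \ (H : Set G)).Nonempty)
    (hdisj : ∀ K ∈ 𝒦, ∀ K' ∈ 𝒦, K ≠ K' →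
      Disjoint ((K : Set G) \ (H : Set G)) ((K' : Set G) \ (H : Set G)))
    (hunion : (⋃ K ∈ 𝒦, ((K : Set G) \ (H : Set G))) = Set.univ \ (H : Set G))
    (hcomm : ∀ x y : G, x ∉ H → y ∉ H → x * y = y * x → ∃ K ∈ 𝒦, x ∈ K ∧ y ∈ K)
    (N : Subgroup G) (hN : ∀ a ∈ N, ∀ b ∈ N, a * b = b * a) :
    N ≤ H ∨ (∃! K : Subgroup G, K ∈ 𝒦 ∧ N ≤ K) := by
  refine or_iff_not_imp_left.mpr fun hNH ↦ ?_
  obtain ⟨x, hxN, hxH⟩ := SetLike.not_le_iff_exists.mp hNH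
  have eq_of_mem : ∀ K ∈ 𝒦, ∀ K' ∈ 𝒦, x ∈ K → x ∈ K' → K = K' := by
    intro K hK K' hK' hxK hxK'
    by_contra hKK'
    exact Set.disjoint_left.mp (hdisj K hK K' hK' hKK') ⟨hxK, hxH⟩ ⟨hxK', hxH⟩
  obtain ⟨K, hK, hxK, -⟩ := hcomm x x hxH hxH rfl
  have mem_of_notMem : ∀ y ∈ N, y ∉ H → y ∈ K := by
    intro y hyN hyH
    obtain ⟨K', hK', hxK', hyK'⟩ := hcomm x y hxH hyH (hN x hxN y hyN)
    rwa [eq_of_mem K hK K' hK' hxK hxK']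
  refine ⟨K, ⟨hK, fun y hyN ↦ ?_⟩, fun K' ⟨hK', hNK'⟩ ↦ eq_of_mem K' hK' K hK (hNK' hxN) hxK⟩
  by_cases hyH : y ∈ H
  · have hxyH : x * y ∉ H := fun h ↦ hxH ((H.mul_mem_cancel_right hyH).mp h)
    exact (K.mul_mem_cancel_left hxK).mp (mem_of_notMem (x * y) (N.mul_mem hxN hyN) hxyH)
  · exact mem_of_notMem y hyN hyH
end

section
/- Let G be a group and H a subgroup of G such that the pair (G,H) has the transitive-commutation property, so that commutation is an equivalence relation on G∖H. Let E ⊆ G∖H be an equivalence class of this relation and K the subgroup of G generated by E. Then: K is abelian; K∖H = E; K equals the centralizer of E in G (the set of all g ∈ G commuting with every element of E); and K is the unique abelian subgroup of G containing E, i.e., every abelian subgroup of G containing E equals K. -/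
/-- Assume `(G,H)` has the transitive-commutation property, and let
`E ⊆ G ∖ H` be an equivalence class of the commutation relation on `G ∖ H`
(the class of some `x ∉ H`). Let `K` be the subgroup generated by `E`. Then `K`
is abelian, `K ∖ H = E`, `K` is the centralizer of `E` in `G`, and `K` is the
unique abelian subgroup of `G` containing `E`. -/
theorem closure_of_commutation_class {G : Type*} [Group G] (H : Subgroup G)
    (htc : TransitiveCommutation H)
    (x : G) (hx : x ∉ H)
    (E : Set G) (hE : E = {y : G | y ∉ H ∧ x * y = y * x}) :
    (∀ a ∈ Subgroup.closure E, ∀ b ∈ Subgroup.closure E, a * b = b * a) ∧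
    ((Subgroup.closure E : Set G) \ (H : Set G) = E) ∧
    ((Subgroup.closure E : Set G) = {g : G | ∀ y ∈ E, g * y = y * g}) ∧
    (∀ N : Subgroup G, (∀ a ∈ N, ∀ b ∈ N, a * b = b * a) → E ⊆ (N : Set G) →
      N = Subgroup.closure E) := by
  have hxE : x ∈ E := by simp [hE, hx]
  have mem_E {y : G} (hy : y ∉ H) (hxy : x * y = y * x) : y ∈ E := by
    rw [hE]; exact ⟨hy, hxy⟩
  have comm_E : ∀ y ∈ E, ∀ z ∈ E, y * z = z * y := by
    rw [hE]
    rintro y ⟨hy, hxy⟩ z ⟨hz, hxz⟩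
    exact htc y x z hy hx hz hxy.symm hxz
  have closure_le : Subgroup.closure E ≤ Subgroup.centralizer E :=
    (Subgroup.closure_le _).2 fun y hy ↦
      Subgroup.mem_centralizer_iff.2 fun z hz ↦ comm_E z hz y hy
  have le_closure : Subgroup.centralizer E ≤ Subgroup.closure E := by
    intro g hg
    have hgx : x * g = g * x := Subgroup.mem_centralizer_iff.1 hg x hxE
    by_cases hgH : g ∈ H
    · refine (Subgroup.mul_mem_cancel_right _ (Subgroup.subset_closure hxE)).1
        (Subgroup.subset_closure (mem_E ?_ ?_))
      · rwa [Subgroup.mul_mem_cancel_left _ hgH]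
      · rw [← mul_assoc, hgx]
    · exact Subgroup.subset_closure (mem_E hgH hgx)
  refine ⟨fun a ha b hb ↦ ?_, ?_, ?_, fun N hN hEN ↦ le_antisymm (fun n hn ↦ ?_) ?_⟩
  · exact Subgroup.mem_centralizer_iff.1
      (Subgroup.closure_le_centralizer_centralizer E hb) a (closure_le ha)
  · refine Set.Subset.antisymm (fun k hk ↦ mem_E hk.2 ?_) fun y hy ↦
      ⟨Subgroup.subset_closure hy, ?_⟩
    · exact Subgroup.mem_centralizer_iff.1 (closure_le hk.1) x hxE
    · rw [hE] at hy
      exact hy.1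
  · rw [le_antisymm closure_le le_closure]
    ext g
    simp only [SetLike.mem_coe, Subgroup.mem_centralizer_iff, Set.mem_ofPred_eq, eq_comm]
  · exact le_closure (Subgroup.mem_centralizer_iff.2 fun y hy ↦ hN y (hEN hy) n hn)
  · exact (Subgroup.closure_le N).2 hEN
end

section
/- Let E be a real vector space, Ω an alternating bilinear form on E, and H(E,Ω) = ℝ × E the associated Heisenberg group. If Σ is an abelian subgroup of H(E,Ω) and Λ ⊆ E is the image of Σ under the projection (r,u) ↦ u, then the linear span L of Λ in E is an isotropic subspace (Ω vanishes identically on L × L), the subset ℝ × L is a subgroup of H(E,Ω) containing Σ, and the group operation of H(E,Ω) restricted to ℝ × L coincides with the addition of the vector space ℝ × L. -/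
/-- A bilinear form vanishing on a set vanishes on the span of that set. -/
theorem LinearMap.apply_eq_zero_of_mem_span {R M : Type*} [CommSemiring R] [AddCommMonoid M]
    [Module R M] (B : M →ₗ[R] M →ₗ[R] R) {s : Set M} (h : ∀ u ∈ s, ∀ v ∈ s, B u v = 0)
    {u v : M} (hu : u ∈ Submodule.span R s) (hv : v ∈ Submodule.span R s) : B u v = 0 := by
  induction hu, hv using Submodule.span_induction₂ with
  | mem_mem x y hx hy => exact h x hx y hy
  | zero_left y hy => simp
  | zero_right x hx => simp
  | add_left x y z hx hy hz h₁ h₂ => simp [h₁, h₂]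
  | add_right x y z hx hy hz h₁ h₂ => simp [h₁, h₂]
  | smul_left r x y hx hy h₁ => simp [h₁]
  | smul_right r x y hx hy h₁ => simp [h₁]

/-- Let `H(E,Ω) = ℝ × E` be the Heisenberg group of an alternating
bilinear form `Ω` on a real vector space `E`. If `S` is an abelian subgroup of
`H(E,Ω)` and `Λ ⊆ E` is the image of `S` under `(r,u) ↦ u`, then the span `L`
of `Λ` is isotropic for `Ω`, the subset `ℝ × L` is a subgroup of `H(E,Ω)`
containing `S`, and the group operation restricted to `ℝ × L` coincides with
the vector-space addition. -/
theorem heisenberg_abelian_subgroup_span {E : Type*} [AddCommGroup E] [Module ℝ E]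
    (Ω : E →ₗ[ℝ] E →ₗ[ℝ] ℝ) (hΩ : ∀ u : E, Ω u u = 0)
    (mul : (ℝ × E) → (ℝ × E) → (ℝ × E))
    (hmul : ∀ a b : ℝ × E, mul a b = (a.1 + b.1 - Ω a.2 b.2, a.2 + b.2))
    (S : Set (ℝ × E))
    (hone : ((0 : ℝ), (0 : E)) ∈ S)
    (hclosed : ∀ a ∈ S, ∀ b ∈ S, mul a b ∈ S)
    (hinv : ∀ a ∈ S, ((-a.1, -a.2) : ℝ × E) ∈ S)
    (habel : ∀ a ∈ S, ∀ b ∈ S, mul a b = mul b a) :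
    (∀ u ∈ Submodule.span ℝ (Prod.snd '' S), ∀ v ∈ Submodule.span ℝ (Prod.snd '' S),
      Ω u v = 0) ∧
    (((0 : ℝ), (0 : E)) ∈ {p : ℝ × E | p.2 ∈ Submodule.span ℝ (Prod.snd '' S)}) ∧
    (∀ a ∈ {p : ℝ × E | p.2 ∈ Submodule.span ℝ (Prod.snd '' S)},
      ∀ b ∈ {p : ℝ × E | p.2 ∈ Submodule.span ℝ (Prod.snd '' S)},
        mul a b ∈ {p : ℝ × E | p.2 ∈ Submodule.span ℝ (Prod.snd '' S)}) ∧
    (∀ a ∈ {p : ℝ × E | p.2 ∈ Submodule.span ℝ (Prod.snd '' S)},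
      ((-a.1, -a.2) : ℝ × E) ∈ {p : ℝ × E | p.2 ∈ Submodule.span ℝ (Prod.snd '' S)}) ∧
    (S ⊆ {p : ℝ × E | p.2 ∈ Submodule.span ℝ (Prod.snd '' S)}) ∧
    (∀ a ∈ {p : ℝ × E | p.2 ∈ Submodule.span ℝ (Prod.snd '' S)},
      ∀ b ∈ {p : ℝ × E | p.2 ∈ Submodule.span ℝ (Prod.snd '' S)},
        mul a b = a + b) := by
  have halt : Ω.IsAlt := hΩ
  have hiso : ∀ u ∈ Submodule.span ℝ (Prod.snd '' S),
      ∀ v ∈ Submodule.span ℝ (Prod.snd '' S), Ω u v = 0 := by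
    intro u hu v hv
    refine LinearMap.apply_eq_zero_of_mem_span Ω ?_ hu hv
    rintro _ ⟨a, ha, rfl⟩ _ ⟨b, hb, rfl⟩
    have hcomm := congrArg Prod.fst (habel a ha b hb)
    simp only [hmul] at hcomm
    have hskew := halt.neg a.2 b.2
    linarith
  simp only [Set.mem_ofPred_eq]
  refine ⟨hiso, Submodule.zero_mem _, ?_, fun a ha => Submodule.neg_mem _ ha,
    fun a ha => Submodule.subset_span ⟨a, ha, rfl⟩, ?_⟩
  · intro a ha b hb
    rw [hmul]
    exact Submodule.add_mem _ ha hb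
  · intro a ha b hb
    rw [hmul, hiso a.2 ha b.2 hb, sub_zero]
    rfl
end

section
/- Let M be a nonempty compact topological n-manifold (a Hausdorff, second-countable topological space in which every point has a neighborhood homeomorphic to an open subset of ℝⁿ). If M is contractible, then M consists of a single point; in particular n = 0. -/
namespace VietorisChain

open Finset

variable {V W : Type*} [DecidableEq V] [DecidableEq W]

/-- Chains with coefficients in `ℤ/2` on the full (augmented) simplex with vertex set `V`:
formal sums of finite subsets of `V`. -/
abbrev Chain (V : Type*) := Finset V →₀ ZMod 2

/-- The basis chain given by a finite set. -/
noncomputable abbrev simplex (s : Finset V) : Chain V := Finsupp.single s 1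

/-- The boundary operator. -/
noncomputable def bd : Chain V →ₗ[ZMod 2] Chain V :=
  Finsupp.linearCombination (ZMod 2) fun s => ∑ a ∈ s, simplex (s.erase a)

/-- The cone with apex `x`. -/
noncomputable def cone (x : V) : Chain V →ₗ[ZMod 2] Chain V :=
  Finsupp.linearCombination (ZMod 2) fun s => if x ∈ s then 0 else simplex (insert x s)

/-- The chain map induced by a map of vertices; simplices that are collapsed are sent to `0`. -/
noncomputable def push (f : V → W) : Chain V →ₗ[ZMod 2] Chain W :=
  Finsupp.linearCombination (ZMod 2)
    fun s => if (s.image f).card = s.card then simplex (s.image f) else 0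

lemma bd_simplex (s : Finset V) : bd (simplex s) = ∑ a ∈ s, simplex (s.erase a) := by
  simp [bd]

lemma cone_simplex (x : V) (s : Finset V) :
    cone x (simplex s) = if x ∈ s then 0 else simplex (insert x s) := by
  simp [cone]

omit [DecidableEq V] in
lemma push_simplex (f : V → W) (s : Finset V) :
    push f (simplex s) = if (s.image f).card = s.card then simplex (s.image f) else 0 := by
  simp [push]

lemma cone_simplex_of_notMem {x : V} {s : Finset V} (h : x ∉ s) :
    cone x (simplex s) = simplex (insert x s) := by
  rw [cone_simplex, if_neg h]

omit [DecidableEq V] in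
lemma hom_ext {N : Type*} [AddCommMonoid N] [Module (ZMod 2) N] {f g : Chain V →ₗ[ZMod 2] N}
    (h : ∀ s, f (simplex s) = g (simplex s)) (c : Chain V) : f c = g c := by
  have : f = g := by
    apply Finsupp.lhom_ext'
    intro s
    apply LinearMap.ext_ring
    exact h s
  rw [this]

lemma bd_cone (x : V) (c : Chain V) : bd (cone x c) = c + cone x (bd c) := by
  refine hom_ext (f := bd ∘ₗ cone x) (g := LinearMap.id + cone x ∘ₗ bd) (fun s => ?_) c
  simp only [LinearMap.comp_apply, LinearMap.add_apply, LinearMap.id_apply]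
  by_cases hx : x ∈ s
  · rw [cone_simplex, if_pos hx, map_zero, bd_simplex, map_sum,
      Finset.sum_eq_single_of_mem x hx, cone_simplex_of_notMem (Finset.notMem_erase x s),
      Finset.insert_erase hx, ZModModule.add_self]
    intro b _ hb
    rw [cone_simplex, if_pos (by simp [hx, hb.symm])]
  · rw [cone_simplex_of_notMem hx, bd_simplex, Finset.sum_insert hx, Finset.erase_insert hx,
      bd_simplex, map_sum]
    congr 1
    refine Finset.sum_congr rfl fun a ha => ?_
    have hxa : x ≠ a := fun h => hx (h ▸ ha)
    rw [cone_simplex_of_notMem (by simp [hx]), Finset.erase_insert_of_ne hxa]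

lemma bd_bd (c : Chain V) : bd (bd c) = 0 := by
  have key (s : Finset V) : bd (bd (simplex s)) = 0 := by
    induction s using Finset.induction_on with
    | empty => simp [bd_simplex]
    | insert x s hx ih =>
      rw [← cone_simplex_of_notMem hx, bd_cone, map_add, bd_cone, ih, map_zero, add_zero,
        ZModModule.add_self]
  have := hom_ext (f := bd ∘ₗ bd) (g := (0 : Chain V →ₗ[ZMod 2] Chain V))
    (fun s => by rw [LinearMap.comp_apply, LinearMap.zero_apply, key]) c
  rwa [LinearMap.comp_apply, LinearMap.zero_apply] at this

lemma push_cone (f : V → W) (x : V) (c : Chain V) :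
    push f (cone x c) = cone (f x) (push f c) := by
  refine hom_ext (f := push f ∘ₗ cone x) (g := cone (f x) ∘ₗ push f) (fun s => ?_) c
  simp only [LinearMap.comp_apply]
  by_cases hx : x ∈ s
  · rw [cone_simplex, if_pos hx, map_zero, push_simplex]
    split_ifs
    · rw [cone_simplex, if_pos (Finset.mem_image_of_mem f hx)]
    · simp
  · rw [cone_simplex_of_notMem hx, push_simplex, push_simplex, Finset.image_insert,
      Finset.card_insert_of_notMem hx]
    by_cases hf : f x ∈ s.image f
    · have h1 := Finset.card_image_le (s := s) (f := f)
      rw [Finset.insert_eq_of_mem hf, if_neg (by omega)]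
      split_ifs
      · rw [cone_simplex, if_pos hf]
      · simp
    · rw [Finset.card_insert_of_notMem hf]
      simp only [add_left_inj]
      split_ifs
      · rw [cone_simplex_of_notMem hf]
      · simp

lemma bd_push (f : V → W) (c : Chain V) : bd (push f c) = push f (bd c) := by
  refine hom_ext (f := bd ∘ₗ push f) (g := push f ∘ₗ bd) (fun s => ?_) c
  simp only [LinearMap.comp_apply]
  induction s using Finset.induction_on with
  | empty => simp [bd_simplex, push_simplex]
  | insert x s hx ih =>
    rw [← cone_simplex_of_notMem hx, push_cone, bd_cone, ih, bd_cone, map_add, push_cone]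

/-- The chains all of whose simplices satisfy `p`. -/
abbrev chainsOf (p : Finset V → Prop) : Submodule (ZMod 2) (Chain V) :=
  Finsupp.supported (ZMod 2) (ZMod 2) {s | p s}

omit [DecidableEq V] in
lemma simplex_mem_chainsOf {p : Finset V → Prop} {s : Finset V} (h : p s) :
    simplex s ∈ chainsOf p :=
  Finsupp.single_mem_supported _ _ h

omit [DecidableEq V] in
lemma chainsOf_mono {p q : Finset V → Prop} (h : ∀ s, p s → q s) : chainsOf p ≤ chainsOf q :=
  Finsupp.supported_mono h

omit [DecidableEq V] in
lemma mem_chainsOf_iff {p : Finset V → Prop} {c : Chain V} :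
    c ∈ chainsOf p ↔ ∀ s, c s ≠ 0 → p s := by
  simp [Finsupp.mem_supported, Set.subset_def]

omit [DecidableEq V] in
lemma apply_eq_zero {p : Finset V → Prop} {c : Chain V} (hc : c ∈ chainsOf p) {s : Finset V}
    (hs : ¬ p s) : c s = 0 := by
  by_contra h
  exact hs (mem_chainsOf_iff.1 hc s h)

omit [DecidableEq V] in
lemma map_mem {N : Type*} [AddCommMonoid N] [Module (ZMod 2) N] {p : Finset V → Prop}
    {c : Chain V} (hc : c ∈ chainsOf p) (L : Chain V →ₗ[ZMod 2] N) (T : Submodule (ZMod 2) N)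
    (h : ∀ s, p s → L (simplex s) ∈ T) : L c ∈ T := by
  have : chainsOf p ≤ T.comap L := by
    rw [chainsOf, Finsupp.supported_eq_span_single, Submodule.span_le]
    rintro _ ⟨s, hs, rfl⟩
    exact h s hs
  exact this hc

lemma bd_mem {p q : Finset V → Prop} {c : Chain V} (hc : c ∈ chainsOf p)
    (h : ∀ s, p s → ∀ a ∈ s, q (s.erase a)) : bd c ∈ chainsOf q := by
  refine map_mem hc _ _ fun s hs => ?_
  rw [bd_simplex]
  exact Submodule.sum_mem _ fun a ha => simplex_mem_chainsOf (h s hs a ha)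

lemma cone_mem {p q : Finset V → Prop} {c : Chain V} (x : V) (hc : c ∈ chainsOf p)
    (h : ∀ s, p s → x ∉ s → q (insert x s)) : cone x c ∈ chainsOf q := by
  refine map_mem hc _ _ fun s hs => ?_
  rw [cone_simplex]
  split_ifs with hx
  · exact Submodule.zero_mem _
  · exact simplex_mem_chainsOf (h s hs hx)

omit [DecidableEq V] in
lemma push_mem {p : Finset V → Prop} {q : Finset W → Prop} {c : Chain V} (f : V → W)
    (hc : c ∈ chainsOf p)
    (h : ∀ s, p s → (s.image f).card = s.card → q (s.image f)) : push f c ∈ chainsOf q := by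
  refine map_mem hc _ _ fun s hs => ?_
  rw [push_simplex]
  split_ifs with hx
  · exact simplex_mem_chainsOf (h s hs hx)
  · exact Submodule.zero_mem _

omit [DecidableEq V] in
lemma push_congr {f g : V → W} {p : Finset V → Prop} {c : Chain V} (hc : c ∈ chainsOf p)
    (h : ∀ s, p s → ∀ a ∈ s, f a = g a) : push f c = push g c := by
  have := map_mem hc (push f - push g) ⊥ fun s hs => by
    have : s.image f = s.image g := Finset.image_congr fun a ha => h s hs a ha
    simp [push_simplex, this]
  simpa [sub_eq_zero] using this

lemma push_id (c : Chain V) : push id c = c := by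
  refine hom_ext (f := push id) (g := LinearMap.id) (fun s => ?_) c
  simp [push_simplex]

omit [DecidableEq V] in
lemma push_of_collapse {f : V → W} {p : Finset V → Prop} {c : Chain V} (hc : c ∈ chainsOf p)
    (h : ∀ s, p s → (s.image f).card ≠ s.card) : push f c = 0 := by
  have := map_mem hc (push f) ⊥ fun s hs => by
    rw [push_simplex, if_neg (h s hs)]
    exact Submodule.zero_mem _
  simpa using this

/-- `t` is a simplex of the prism over `s` spanned by the two maps `f` and `g`. -/
def IsPrism (f g : V → W) (s : Finset V) (t : Finset W) : Prop :=
  t.card = s.card + 1 ∧ t ⊆ s.image f ∪ s.image g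

lemma exists_homotopy_of_eq_of_ne (f g : V → W) (a : V) (h : ∀ x, x ≠ a → f x = g x) :
    ∃ P : Chain V →ₗ[ZMod 2] Chain W, (∀ c, bd (P c) + P (bd c) = push f c + push g c) ∧
      ∀ s, P (simplex s) ∈ chainsOf (IsPrism f g s) := by
  let P : Chain V →ₗ[ZMod 2] Chain W := Finsupp.linearCombination (ZMod 2) fun s =>
    if a ∈ s then cone (f a) (cone (g a) (push f (simplex (s.erase a)))) else 0
  have hP (s : Finset V) : P (simplex s) =
      if a ∈ s then cone (f a) (cone (g a) (push f (simplex (s.erase a)))) else 0 := by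
    simp [P]
  refine ⟨P, fun c => ?_, fun s => ?_⟩
  · refine hom_ext (f := bd ∘ₗ P + P ∘ₗ bd) (g := push f + push g) (fun s => ?_) c
    simp only [LinearMap.comp_apply, LinearMap.add_apply]
    by_cases ha : a ∈ s
    · obtain ⟨u, hu, rfl⟩ : ∃ u, a ∉ u ∧ insert a u = s :=
        ⟨s.erase a, Finset.notMem_erase a s, Finset.insert_erase ha⟩
      have hfg : push g (simplex u) = push f (simplex u) :=
        push_congr (p := fun s => s = u) (simplex_mem_chainsOf rfl) (by
          rintro s rfl b hb
          exact (h b fun e => hu (e ▸ hb)).symm)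
      have hPu : P (bd (cone a (simplex u))) =
          cone (f a) (cone (g a) (push f (bd (simplex u)))) := by
        have h0 : P (simplex u) = 0 := by rw [hP, if_neg hu]
        rw [bd_cone, map_add, h0, zero_add, bd_simplex]
        simp only [map_sum]
        refine Finset.sum_congr rfl fun b hb => ?_
        have hb' : a ∉ u.erase b := by simp [hu]
        rw [cone_simplex_of_notMem hb', hP, if_pos (Finset.mem_insert_self _ _),
          Finset.erase_insert hb']
      rw [← cone_simplex_of_notMem hu, hPu, push_cone, push_cone, hfg, cone_simplex_of_notMem hu,
        hP, if_pos (Finset.mem_insert_self _ _), Finset.erase_insert hu, bd_cone, bd_cone, map_add,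
        bd_push]
      rw [show ∀ x y z : Chain W, x + (y + z) + z = y + x + (z + z) by intros; abel,
        ZModModule.add_self, add_zero]
    · have h0 : P (bd (simplex s)) = 0 := by
        rw [bd_simplex, map_sum]
        refine Finset.sum_eq_zero fun b _ => ?_
        rw [hP, if_neg (by simp [ha])]
      have hfg : push g (simplex s) = push f (simplex s) :=
        push_congr (p := fun u => u = s) (simplex_mem_chainsOf rfl) (by
          rintro s rfl b hb
          exact (h b fun e => ha (e ▸ hb)).symm)
      rw [h0, hP, if_neg ha, hfg, ZModModule.add_self, map_zero, add_zero]
  · rw [hP]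
    split_ifs with ha
    · refine cone_mem (p := fun t => t.card = s.card ∧ t ⊆ s.image f ∪ s.image g) _
        (cone_mem (p := fun t => t.card + 1 = s.card ∧ t ⊆ s.image f) _
          (push_mem (p := fun t => t.card + 1 = s.card ∧ t ⊆ s) f (simplex_mem_chainsOf ?_) ?_)
          ?_) ?_
      · exact ⟨Finset.card_erase_add_one ha, Finset.erase_subset _ _⟩
      · rintro t ⟨h1, h2⟩ h3
        exact ⟨by omega, Finset.image_subset_image h2⟩
      · rintro t ⟨h1, h2⟩ h3
        refine ⟨by rw [Finset.card_insert_of_notMem h3, h1], Finset.insert_subset ?_ ?_⟩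
        · exact Finset.mem_union_right _ (Finset.mem_image_of_mem _ ha)
        · exact h2.trans Finset.subset_union_left
      · rintro t ⟨h1, h2⟩ h3
        refine ⟨by rw [Finset.card_insert_of_notMem h3, h1], Finset.insert_subset ?_ h2⟩
        exact Finset.mem_union_left _ (Finset.mem_image_of_mem _ ha)
    · exact Submodule.zero_mem _

lemma exists_homotopy_of_eqOn_compl (U : Finset V) : ∀ f g : V → W, (∀ x, x ∉ U → f x = g x) →
    ∃ P : Chain V →ₗ[ZMod 2] Chain W, (∀ c, bd (P c) + P (bd c) = push f c + push g c) ∧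
      ∀ s, P (simplex s) ∈ chainsOf (IsPrism f g s) := by
  induction U using Finset.induction_on with
  | empty =>
    intro f g h
    obtain rfl : f = g := funext fun x => h x (Finset.notMem_empty x)
    exact ⟨0, fun c => by simp [ZModModule.add_self], fun s => Submodule.zero_mem _⟩
  | insert a U ha ih =>
    intro f g h
    let k : V → W := Function.update f a (g a)
    obtain ⟨P, hP, hP'⟩ := exists_homotopy_of_eq_of_ne f k a fun x hx => by simp [k, hx]
    obtain ⟨Q, hQ, hQ'⟩ := ih k g fun x hx => by
      by_cases hxa : x = a
      · simp [k, hxa]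
      · simpa [k, hxa] using h x (by simp [hx, hxa])
    have hk (s : Finset V) : s.image k ⊆ s.image f ∪ s.image g := by
      intro y hy
      obtain ⟨x, hx, rfl⟩ := Finset.mem_image.1 hy
      by_cases hxa : x = a
      · subst hxa
        simpa [k] using Or.inr ⟨x, hx, rfl⟩
      · simpa [k, hxa] using Or.inl ⟨x, hx, rfl⟩
    refine ⟨P + Q, fun c => ?_, fun s => Submodule.add_mem _ ?_ ?_⟩
    · have h1 := hP c
      have h2 := hQ c
      simp only [LinearMap.add_apply, map_add]
      rw [show ∀ x y z w : Chain W, x + y + (z + w) = (x + z) + (y + w) by intros; abel, h1, h2,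
        show ∀ x y z : Chain W, x + y + (y + z) = x + z + (y + y) by intros; abel,
        ZModModule.add_self, add_zero]
    · refine chainsOf_mono ?_ (hP' s)
      rintro t ⟨h1, h2⟩
      exact ⟨h1, h2.trans (Finset.union_subset Finset.subset_union_left (hk s))⟩
    · refine chainsOf_mono ?_ (hQ' s)
      rintro t ⟨h1, h2⟩
      exact ⟨h1, h2.trans (Finset.union_subset (hk s) Finset.subset_union_right)⟩

/-- Any two vertex maps are chain homotopic on a given chain, through simplices of prisms. -/
lemma exists_homotopy (f g : V → W) (c : Chain V) :
    ∃ P : Chain V →ₗ[ZMod 2] Chain W, bd (P c) + P (bd c) = push f c + push g c ∧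
      ∀ s, P (simplex s) ∈ chainsOf (IsPrism f g s) := by
  let U : Finset V := c.support.biUnion id
  let g' : V → W := fun x => if x ∈ U then g x else f x
  obtain ⟨P, hP, hP'⟩ := exists_homotopy_of_eqOn_compl U f g' fun x hx => by simp [g', hx]
  refine ⟨P, ?_, fun s => chainsOf_mono ?_ (hP' s)⟩
  · rw [hP c]
    congr 1
    refine push_congr (p := fun s => s ∈ c.support) (mem_chainsOf_iff.2 fun s hs => ?_) ?_
    · exact Finsupp.mem_support_iff.2 hs
    · intro s hs a ha
      simp only [g']
      rw [if_pos (Finset.mem_biUnion.2 ⟨s, hs, ha⟩)]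
  · rintro t ⟨h1, h2⟩
    refine ⟨h1, h2.trans (Finset.union_subset Finset.subset_union_left ?_)⟩
    intro y hy
    obtain ⟨x, hx, rfl⟩ := Finset.mem_image.1 hy
    simp only [g', Finset.mem_union, Finset.mem_image]
    split_ifs
    · exact Or.inr ⟨x, hx, rfl⟩
    · exact Or.inl ⟨x, hx, rfl⟩

/-- The coefficient of the boundary at a face `f` is a sum over the simplices having `f` as a
facet. -/
lemma bd_apply_eq_sum (c : Chain V) (f : Finset V) (A : Finset (Finset V))
    (hA : ∀ s ∈ A, f ⊆ s ∧ s.card = f.card + 1)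
    (hc : ∀ s, f ⊆ s → s.card = f.card + 1 → c s ≠ 0 → s ∈ A) : bd c f = ∑ s ∈ A, c s := by
  have key (s : Finset V) : bd (simplex s) f = if f ⊆ s ∧ s.card = f.card + 1 then 1 else 0 := by
    rw [bd_simplex, Finsupp.finsetSum_apply]
    split_ifs with h
    · obtain ⟨a, ha, rfl⟩ : ∃ a, a ∉ f ∧ insert a f = s := by
        obtain ⟨a, ha⟩ := Finset.card_eq_one.1
          (show (s \ f).card = 1 by rw [Finset.card_sdiff_of_subset h.1]; omega)
        refine ⟨a, ?_, ?_⟩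
        · have : a ∈ s \ f := by simp [ha]
          exact (Finset.mem_sdiff.1 this).2
        · rw [Finset.insert_eq, ← ha, Finset.sdiff_union_of_subset h.1]
      rw [Finset.sum_eq_single_of_mem a (Finset.mem_insert_self _ _)]
      · rw [Finset.erase_insert ha, Finsupp.single_eq_same]
      · intro b hb hba
        refine Finsupp.single_eq_of_ne fun e => ha ?_
        rw [e]
        exact Finset.mem_erase.2 ⟨hba.symm, Finset.mem_insert_self _ _⟩
    · refine Finset.sum_eq_zero fun b hb => Finsupp.single_eq_of_ne fun e => h ?_
      rw [e]
      exact ⟨Finset.erase_subset _ _, (Finset.card_erase_add_one hb).symm⟩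
  have h1 : bd c f = ∑ s ∈ c.support, c s * if f ⊆ s ∧ s.card = f.card + 1 then 1 else 0 := by
    have := hom_ext (f := Finsupp.lapply f ∘ₗ bd) (g := Finsupp.linearCombination (ZMod 2)
      fun s => if f ⊆ s ∧ s.card = f.card + 1 then (1 : ZMod 2) else 0)
      (fun s => by simpa using key s) c
    simpa [Finsupp.linearCombination_apply, Finsupp.sum] using this
  rw [h1]
  simp only [mul_ite, mul_one, mul_zero, ← Finset.sum_filter]
  refine Finset.sum_subset_zero_on_sdiff ?_ ?_ (fun _ _ => rfl)
  · intro s hs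
    obtain ⟨h1, h2, h3⟩ := Finset.mem_filter.1 hs
    exact hc s h2 h3 (Finsupp.mem_support_iff.1 h1)
  · intro s hs
    obtain ⟨h1, h2⟩ := Finset.mem_sdiff.1 hs
    by_contra h
    exact h2 (Finset.mem_filter.2 ⟨Finsupp.mem_support_iff.2 h, hA s h1⟩)

end VietorisChain

namespace Kuhn

variable {n : ℕ}

/-- Adjacency of lattice points in the Kuhn (Freudenthal) triangulation of `ℝⁿ`. -/
def Adj (u v : Fin n → ℤ) : Prop := (u ≤ v ∧ v ≤ u + 1) ∨ (v ≤ u ∧ u ≤ v + 1)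

/-- A finite set of pairwise adjacent lattice points, i.e. a simplex of the Kuhn triangulation. -/
def IsClique (s : Finset (Fin n → ℤ)) : Prop := ∀ u ∈ s, ∀ v ∈ s, Adj u v

/-- A top-dimensional simplex of the Kuhn triangulation. -/
def IsKuhn (s : Finset (Fin n → ℤ)) : Prop := s.card = n + 1 ∧ IsClique s

/-- The sum of the coordinates. -/
def level (v : Fin n → ℤ) : ℤ := ∑ i, v i

lemma Adj.symm {u v : Fin n → ℤ} (h : Adj u v) : Adj v u := Or.symm h

lemma adj_self (u : Fin n → ℤ) : Adj u u := Or.inl ⟨le_rfl, by simp⟩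

lemma level_mono {u v : Fin n → ℤ} (h : u ≤ v) : level u ≤ level v :=
  Finset.sum_le_sum fun i _ => h i

lemma level_add (u v : Fin n → ℤ) : level (u + v) = level u + level v :=
  Finset.sum_add_distrib

lemma level_one : level (1 : Fin n → ℤ) = n := by simp [level]

lemma level_add_one (u : Fin n → ℤ) : level (u + 1) = level u + n := by
  rw [level_add, level_one]

lemma level_single (a : Fin n) : level (Pi.single a 1) = 1 := by simp [level]

lemma eq_of_le_of_level_le {u v : Fin n → ℤ} (h : u ≤ v) (hl : level v ≤ level u) : u = v := by
  have := (Finset.sum_eq_sum_iff_of_le fun i (_ : i ∈ Finset.univ) => h i).1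
    (le_antisymm (level_mono h) hl)
  exact funext fun i => this i (Finset.mem_univ i)

lemma Adj.le_of_level_le {u v : Fin n → ℤ} (h : Adj u v) (hl : level u ≤ level v) :
    u ≤ v ∧ v ≤ u + 1 := by
  rcases h with h | h
  · exact h
  · obtain rfl := eq_of_le_of_level_le h.1 hl
    exact ⟨le_rfl, by simp⟩

lemma Adj.eq_of_level_eq {u v : Fin n → ℤ} (h : Adj u v) (hl : level u = level v) : u = v :=
  eq_of_le_of_level_le (h.le_of_level_le hl.le).1 hl.ge

lemma exists_eq_add_single {u v : Fin n → ℤ} (h : u ≤ v) (hl : level v = level u + 1) :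
    ∃ a, v = u + Pi.single a 1 := by
  have : ∃ a, u a < v a := by
    by_contra! hc
    have := level_mono (show v ≤ u from hc)
    omega
  obtain ⟨a, ha⟩ := this
  refine ⟨a, (eq_of_le_of_level_le (fun i => ?_) ?_).symm⟩
  · by_cases hi : i = a
    · subst hi
      simp
      omega
    · simpa [hi] using h i
  · rw [level_add, level_single, hl]

lemma IsClique.mono {s t : Finset (Fin n → ℤ)} (ht : IsClique t) (h : s ⊆ t) : IsClique s :=
  fun u hu v hv => ht u (h hu) v (h hv)

lemma IsClique.insert {s : Finset (Fin n → ℤ)} (hs : IsClique s) {w : Fin n → ℤ}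
    (h : ∀ v ∈ s, Adj w v) : IsClique (insert w s) := by
  intro u hu v hv
  rcases Finset.mem_insert.1 hu with hu' | hu' <;> rcases Finset.mem_insert.1 hv with hv' | hv'
  · rw [hu', hv']
    exact adj_self _
  · rw [hu']
    exact h v hv'
  · rw [hv']
    exact (h u hu').symm
  · exact hs u hu' v hv'

lemma IsClique.exists_min {s : Finset (Fin n → ℤ)} (hs : IsClique s) (hne : s.Nonempty) :
    ∃ k ∈ s, ∀ v ∈ s, k ≤ v ∧ v ≤ k + 1 := by
  obtain ⟨k, hk, hmin⟩ := s.exists_min_image level hne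
  exact ⟨k, hk, fun v hv => (hs k hk v hv).le_of_level_le (hmin v hv)⟩

lemma IsClique.injOn_level {s : Finset (Fin n → ℤ)} (hs : IsClique s) :
    Set.InjOn level (↑s : Set (Fin n → ℤ)) :=
  fun u hu v hv h => (hs u hu v hv).eq_of_level_eq h

lemma IsClique.image_level_subset {s : Finset (Fin n → ℤ)} {k : Fin n → ℤ}
    (h : ∀ v ∈ s, k ≤ v ∧ v ≤ k + 1) :
    s.image level ⊆ Finset.Icc (level k) (level k + n) := by
  intro x hx
  obtain ⟨v, hv, rfl⟩ := Finset.mem_image.1 hx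
  rw [Finset.mem_Icc, ← level_add_one]
  exact ⟨level_mono (h v hv).1, level_mono (h v hv).2⟩

lemma IsClique.card_le {s : Finset (Fin n → ℤ)} (hs : IsClique s) : s.card ≤ n + 1 := by
  rcases s.eq_empty_or_nonempty with rfl | hne
  · simp
  obtain ⟨k, hk, hmin⟩ := hs.exists_min hne
  rw [← Finset.card_image_of_injOn hs.injOn_level]
  refine (Finset.card_le_card (IsClique.image_level_subset hmin)).trans ?_
  rw [Int.card_Icc]
  omega

lemma IsKuhn.nonempty {s : Finset (Fin n → ℤ)} (hs : IsKuhn s) : s.Nonempty := by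
  rw [← Finset.card_pos, hs.1]
  omega

lemma IsKuhn.exists_level_eq {s : Finset (Fin n → ℤ)} (hs : IsKuhn s) {k : Fin n → ℤ}
    (hk : ∀ v ∈ s, k ≤ v ∧ v ≤ k + 1) {j : ℤ} (h0 : level k ≤ j) (h1 : j ≤ level k + n) :
    ∃ v ∈ s, level v = j := by
  have : s.image level = Finset.Icc (level k) (level k + n) := by
    refine Finset.eq_of_subset_of_card_le (IsClique.image_level_subset hk) ?_
    rw [Finset.card_image_of_injOn hs.2.injOn_level, hs.1, Int.card_Icc]
    omega
  have hj : j ∈ s.image level := by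
    rw [this, Finset.mem_Icc]
    exact ⟨h0, h1⟩
  exact Finset.mem_image.1 hj

lemma IsKuhn.add_one_mem {s : Finset (Fin n → ℤ)} (hs : IsKuhn s) {k : Fin n → ℤ}
    (hk : ∀ v ∈ s, k ≤ v ∧ v ≤ k + 1) : k + 1 ∈ s := by
  obtain ⟨v, hv, hl⟩ := hs.exists_level_eq hk (j := level k + n) (by omega) le_rfl
  rwa [← eq_of_le_of_level_le (hk v hv).2 (by rw [level_add_one, hl])]

/-- The position of the vertex `w` opposite to a facet `f` of a Kuhn simplex: it is the top
vertex, the bottom vertex, or it lies strictly between two consecutive vertices of `f`. -/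
lemma IsKuhn.facet_cases (hn : 0 < n) {f : Finset (Fin n → ℤ)} {w : Fin n → ℤ} (hw : w ∉ f)
    (h : IsKuhn (insert w f)) :
    (∃ B ∈ f, (∀ v ∈ f, B ≤ v ∧ v ≤ B + 1) ∧ w = B + 1) ∨
    (∃ T ∈ f, (∀ v ∈ f, v ≤ T ∧ T ≤ v + 1) ∧ w + 1 = T) ∨
    (∃ B ∈ f, B + 1 ∈ f ∧ (∀ v ∈ insert w f, B ≤ v ∧ v ≤ B + 1) ∧ ∃ p ∈ f, ∃ q ∈ f,
      level p + 1 = level w ∧ level q = level w + 1) := by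
  obtain ⟨k, hk, hmin⟩ := h.2.exists_min h.nonempty
  have htop := h.add_one_mem hmin
  have hk1 : k + 1 ≠ k := fun e => by
    have := congrFun e ⟨0, hn⟩
    simp at this
  by_cases hwk : w = k
  · subst hwk
    refine Or.inr (Or.inl ⟨w + 1, Finset.mem_of_mem_insert_of_ne htop hk1, fun v hv => ?_, rfl⟩)
    have := hmin v (Finset.mem_insert_of_mem hv)
    exact ⟨this.2, add_le_add_left this.1 1⟩
  have hkf : k ∈ f := Finset.mem_of_mem_insert_of_ne hk (Ne.symm hwk)
  by_cases hwt : w = k + 1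
  · exact Or.inl ⟨k, hkf, fun v hv => hmin v (Finset.mem_insert_of_mem hv), hwt⟩
  have htf : k + 1 ∈ f := Finset.mem_of_mem_insert_of_ne htop (Ne.symm hwt)
  refine Or.inr (Or.inr ⟨k, hkf, htf, hmin, ?_⟩)
  have hww := hmin w (Finset.mem_insert_self _ _)
  have h1 : level k < level w := by
    by_contra! hc
    exact hwk (eq_of_le_of_level_le hww.1 hc).symm
  have h2 : level w < level k + n := by
    by_contra! hc
    exact hwt (eq_of_le_of_level_le hww.2 (by rwa [level_add_one]))
  obtain ⟨p, hp, hlp⟩ := h.exists_level_eq hmin (j := level w - 1) (by omega) (by omega)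
  obtain ⟨q, hq, hlq⟩ := h.exists_level_eq hmin (j := level w + 1) (by omega) (by omega)
  refine ⟨p, Finset.mem_of_mem_insert_of_ne hp ?_, q, Finset.mem_of_mem_insert_of_ne hq ?_,
    by omega, hlq⟩
  · rintro rfl
    omega
  · rintro rfl
    omega

/-- A facet lies in at most two Kuhn simplices. -/
lemma facet_at_most_two (hn : 0 < n) {f : Finset (Fin n → ℤ)} {w₁ w₂ w₃ : Fin n → ℤ}
    (h₁ : w₁ ∉ f) (h₂ : w₂ ∉ f) (h₃ : w₃ ∉ f) (k₁ : IsKuhn (insert w₁ f))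
    (k₂ : IsKuhn (insert w₂ f)) (k₃ : IsKuhn (insert w₃ f)) :
    w₁ = w₂ ∨ w₁ = w₃ ∨ w₂ = w₃ := by
  have inner : ∀ {u v x : Fin n → ℤ}, u ∉ f → v ∉ f → x ∉ f → IsKuhn (insert u f) →
      IsKuhn (insert v f) → IsKuhn (insert x f) → (∃ B ∈ f, B + 1 ∈ f ∧
      (∀ v ∈ insert u f, B ≤ v ∧ v ≤ B + 1) ∧ ∃ p ∈ f, ∃ q ∈ f,
        level p + 1 = level u ∧ level q = level u + 1) → u = v ∨ u = x ∨ v = x := by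
    rintro u v x hu hv hx ku kv kx ⟨B, hB, hB1, hmin, p, hp, q, hq, hlp, hlq⟩
    have same : ∀ y, y ∉ f → IsKuhn (insert y f) → level y = level u := by
      intro y hy ky
      have hmy : ∀ v ∈ insert y f, B ≤ v ∧ v ≤ B + 1 := by
        have hf := fun v hv => hmin v (Finset.mem_insert_of_mem hv)
        intro v hv
        rcases Finset.mem_insert.1 hv with rfl | hv
        · have a1 := ky.2 v (Finset.mem_insert_self _ _) B (Finset.mem_insert_of_mem hB)
          have a2 := ky.2 v (Finset.mem_insert_self _ _) _ (Finset.mem_insert_of_mem hB1)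
          refine ⟨?_, ?_⟩
          · rcases a2 with a2 | a2
            · exact le_of_add_le_add_right a2.2
            · exact le_trans (by simp) a2.1
          · rcases a1 with a1 | a1
            · exact a1.1.trans (by simp)
            · exact a1.2
        · exact hf v hv
      have hub := hmin u (Finset.mem_insert_self _ _)
      obtain ⟨z, hz, hlz⟩ := ky.exists_level_eq hmy (j := level u) (level_mono hub.1)
        (by rw [← level_add_one]; exact level_mono hub.2)
      rcases Finset.mem_insert.1 hz with rfl | hz
      · exact hlz
      · exact absurd ((ku.2.injOn_level (by simp) (by simp [hz]) hlz.symm) ▸ hz) hu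
    have btw : ∀ y, y ∉ f → IsKuhn (insert y f) → p ≤ y ∧ y ≤ q := by
      intro y hy ky
      have hl := same y hy ky
      exact ⟨((ky.2 p (by simp [hp]) y (by simp)).le_of_level_le (by omega)).1,
        ((ky.2 y (by simp) q (by simp [hq])).le_of_level_le (by omega)).1⟩
    by_cases huv : u = v
    · exact Or.inl huv
    by_cases hux : u = x
    · exact Or.inr (Or.inl hux)
    have sup_inf : ∀ y, y ∉ f → IsKuhn (insert y f) → u ≠ y → u ⊓ y = p ∧ u ⊔ y = q := by
      intro y hy ky huy
      have hl := same y hy ky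
      have hbu := btw u hu ku
      have hby := btw y hy ky
      refine ⟨(eq_of_le_of_level_le (le_inf hbu.1 hby.1) ?_).symm,
        eq_of_le_of_level_le (sup_le hbu.2 hby.2) ?_⟩
      · by_contra! hc
        refine huy ?_
        have e1 := eq_of_le_of_level_le (inf_le_left : u ⊓ y ≤ u) (by omega)
        have e2 := eq_of_le_of_level_le (inf_le_right : u ⊓ y ≤ y) (by omega)
        rw [← e1, e2]
      · by_contra! hc
        refine huy ?_
        have e1 := eq_of_le_of_level_le (le_sup_left : u ≤ u ⊔ y) (by omega)
        have e2 := eq_of_le_of_level_le (le_sup_right : y ≤ u ⊔ y) (by omega)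
        rw [e1, ← e2]
    obtain ⟨i1, s1⟩ := sup_inf v hv kv huv
    obtain ⟨i2, s2⟩ := sup_inf x hx kx hux
    exact Or.inr (Or.inr (eq_of_inf_eq_sup_eq (b := v) (a := u) (c := x)
      (by rw [inf_comm, i1, inf_comm, i2]) (by rw [sup_comm, s1, sup_comm, s2])))
  have top : ∀ {u v : Fin n → ℤ}, (∃ B ∈ f, (∀ v ∈ f, B ≤ v ∧ v ≤ B + 1) ∧ u = B + 1) →
      (∃ B ∈ f, (∀ v ∈ f, B ≤ v ∧ v ≤ B + 1) ∧ v = B + 1) → u = v := by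
    rintro u v ⟨B, hB, hmin, rfl⟩ ⟨B', hB', hmin', rfl⟩
    rw [le_antisymm (hmin B' hB').1 (hmin' B hB).1]
  have bot : ∀ {u v : Fin n → ℤ}, (∃ T ∈ f, (∀ v ∈ f, v ≤ T ∧ T ≤ v + 1) ∧ u + 1 = T) →
      (∃ T ∈ f, (∀ v ∈ f, v ≤ T ∧ T ≤ v + 1) ∧ v + 1 = T) → u = v := by
    rintro u v ⟨B, hB, hmin, h⟩ ⟨B', hB', hmin', h'⟩
    have := le_antisymm (hmin' B hB).1 (hmin B' hB').1
    rw [← h, ← h'] at this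
    exact add_right_cancel this
  rcases k₁.facet_cases hn h₁ with c₁ | c₁ | c₁
  · rcases k₂.facet_cases hn h₂ with c₂ | c₂ | c₂
    · exact Or.inl (top c₁ c₂)
    · rcases k₃.facet_cases hn h₃ with c₃ | c₃ | c₃
      · exact Or.inr (Or.inl (top c₁ c₃))
      · exact Or.inr (Or.inr (bot c₂ c₃))
      · have := inner h₃ h₁ h₂ k₃ k₁ k₂ c₃
        tauto
    · have := inner h₂ h₁ h₃ k₂ k₁ k₃ c₂
      tauto
  · rcases k₂.facet_cases hn h₂ with c₂ | c₂ | c₂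
    · rcases k₃.facet_cases hn h₃ with c₃ | c₃ | c₃
      · exact Or.inr (Or.inr (top c₂ c₃))
      · exact Or.inr (Or.inl (bot c₁ c₃))
      · have := inner h₃ h₁ h₂ k₃ k₁ k₂ c₃
        tauto
    · exact Or.inl (bot c₁ c₂)
    · have := inner h₂ h₁ h₃ k₂ k₁ k₃ c₂
      tauto
  · exact inner h₁ h₂ h₃ k₁ k₂ k₃ c₁

/-- A facet of a Kuhn simplex lies in a second Kuhn simplex. -/
lemma IsKuhn.exists_other (hn : 0 < n) {f : Finset (Fin n → ℤ)} {w : Fin n → ℤ} (hw : w ∉ f)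
    (h : IsKuhn (insert w f)) : ∃ w', w' ∉ f ∧ w' ≠ w ∧ IsKuhn (insert w' f) := by
  have hf : IsClique f := h.2.mono (Finset.subset_insert _ _)
  have hcard : f.card = n := by
    have := h.1
    rw [Finset.card_insert_of_notMem hw] at this
    omega
  have ne_add : ∀ x : Fin n → ℤ, x + 1 ≠ x := fun x e => by
    have := congrFun e ⟨0, hn⟩
    simp at this
  have fin : ∀ w', w' ∉ f → w' ≠ w → (∀ v ∈ f, Adj w' v) →
      ∃ w', w' ∉ f ∧ w' ≠ w ∧ IsKuhn (insert w' f) := fun w' h1 h2 h3 =>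
    ⟨w', h1, h2, by rw [Finset.card_insert_of_notMem h1, hcard], hf.insert h3⟩
  rcases h.facet_cases hn hw with ⟨B, hB, hmin, rfl⟩ | ⟨T, hT, hmax, hwT⟩ |
    ⟨B, hB, hB1, hmin, p, hp, q, hq, hlp, hlq⟩
  · have hfne : f.Nonempty := ⟨B, hB⟩
    obtain ⟨T, hT, hTm⟩ := f.exists_max_image level hfne
    have hTT : ∀ v ∈ f, v ≤ T ∧ T ≤ v + 1 := fun v hv =>
      (hf v hv T hT).le_of_level_le (hTm v hv)
    have hBT : T ≤ B + 1 := (hmin T hT).2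
    refine fin (T - 1) (fun hc => hw ?_) (fun e => ?_) (fun v hv => ?_)
    · have : B ≤ T - 1 := (hmin _ hc).1
      have : T = B + 1 := le_antisymm hBT (le_sub_iff_add_le.1 this)
      rwa [← this]
    · have h1 : T = B + 1 + 1 := sub_eq_iff_eq_add.1 e
      rw [h1] at hBT
      exact ne_add (B + 1) (le_antisymm hBT (by simp))
    · exact Or.inl ⟨sub_le_iff_le_add.2 (hTT v hv).2, by simpa using (hTT v hv).1⟩
  · have hfne : f.Nonempty := ⟨T, hT⟩
    obtain ⟨B, hB, hBm⟩ := hf.exists_min hfne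
    have hBT : T ≤ B + 1 := (hBm T hT).2
    have hwB : w ≤ B := le_of_add_le_add_right (a := 1) (hwT ▸ (hmax B hB).2)
    refine fin (B + 1) (fun hc => hw ?_) (fun e => ?_) (fun v hv => ?_)
    · have h1 : B + 1 ≤ T := (hmax _ hc).1
      rw [← hwT] at h1
      rwa [le_antisymm hwB (le_of_add_le_add_right h1)]
    · rw [← e] at hwB
      exact ne_add B (le_antisymm hwB (by simp))
    · exact Or.inr ⟨(hBm v hv).2, add_le_add_left (hBm v hv).1 1⟩
  · have hw' : level (p + q - w) = level w := by
      have := level_add (p + q - w) w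
      rw [sub_add_cancel, level_add] at this
      omega
    have hpw := (h.2 p (by simp [hp]) w (by simp)).le_of_level_le (by omega)
    have hwq := (h.2 w (by simp) q (by simp [hq])).le_of_level_le (by omega)
    refine fin (p + q - w) (fun hc => hw ?_) (fun e => ?_) (fun v hv => ?_)
    · rwa [← h.2.injOn_level (by simp [hc]) (by simp) hw']
    · have h1 : p + q = w + w := sub_eq_iff_eq_add.1 e
      have hpq := (h.2 p (by simp [hp]) q (by simp [hq])).le_of_level_le (by omega)
      have : p = w := by
        refine le_antisymm hpw.1 fun i => ?_
        have e1 : p i + q i = w i + w i := congrFun h1 i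
        have e2 : q i ≤ p i + 1 := hpq.2 i
        show w i ≤ p i
        omega
      rw [this] at hlp
      omega
    · by_cases hl : level v < level w
      · have h1 := (hf v hv p hp).le_of_level_le (by omega)
        have h2 := (hf v hv q hq).le_of_level_le (by omega)
        refine Or.inr ⟨fun i => ?_, fun i => ?_⟩
        · have e1 : v i ≤ p i := h1.1 i
          have e2 : w i ≤ q i := hwq.1 i
          simp only [Pi.add_apply, Pi.sub_apply]
          omega
        · have e1 : q i ≤ v i + 1 := h2.2 i
          have e2 : p i ≤ w i := hpw.1 i
          simp only [Pi.add_apply, Pi.sub_apply, Pi.one_apply]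
          omega
      · have hne : level v ≠ level w := fun e => hw
          (h.2.injOn_level (by simp [hv]) (by simp) e ▸ hv)
        have h1 := (hf q hq v hv).le_of_level_le (by omega)
        have h2 := (hf p hp v hv).le_of_level_le (by omega)
        refine Or.inl ⟨fun i => ?_, fun i => ?_⟩
        · have e1 : q i ≤ v i := h1.1 i
          have e2 : p i ≤ w i := hpw.1 i
          simp only [Pi.add_apply, Pi.sub_apply]
          omega
        · have e1 : v i ≤ p i + 1 := h2.2 i
          have e2 : w i ≤ q i := hwq.1 i
          simp only [Pi.add_apply, Pi.sub_apply, Pi.one_apply]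
          omega

end Kuhn

namespace Kuhn

variable {n : ℕ}

/-- The vertices of the lattice path that starts at `k` and follows the directions in `l`. -/
def path : (Fin n → ℤ) → List (Fin n) → Finset (Fin n → ℤ)
  | k, [] => {k}
  | k, a :: l => insert k (path (k + Pi.single a 1) l)

/-- The total displacement along a list of directions. -/
def disp : List (Fin n) → Fin n → ℤ
  | [] => 0
  | a :: l => Pi.single a 1 + disp l

lemma disp_apply (l : List (Fin n)) (i : Fin n) : disp l i = l.count i := by
  induction l with
  | nil => simp [disp]
  | cons a l ih =>
    by_cases h : i = a
    · subst h
      simp [disp, ih, add_comm]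
    · simp [disp, ih, h, List.count_cons_of_ne (Ne.symm h)]

lemma disp_nonneg (l : List (Fin n)) : 0 ≤ disp l := fun i => by
  rw [disp_apply]
  positivity

lemma end_mem_path (k : Fin n → ℤ) (l : List (Fin n)) : k + disp l ∈ path k l := by
  induction l generalizing k with
  | nil => simp [path, disp]
  | cons a l ih =>
    rw [path, disp, ← add_assoc]
    exact Finset.mem_insert_of_mem (ih _)

lemma le_add_single (k : Fin n → ℤ) (a : Fin n) : k ≤ k + Pi.single a 1 :=
  le_add_of_nonneg_right (Pi.single_nonneg.2 zero_le_one)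

lemma bounds_of_mem_path {k v : Fin n → ℤ} {l : List (Fin n)} (hv : v ∈ path k l) :
    k ≤ v ∧ v ≤ k + disp l := by
  induction l generalizing k with
  | nil =>
    obtain rfl := Finset.mem_singleton.1 hv
    simp [disp]
  | cons a l ih =>
    rcases Finset.mem_insert.1 hv with rfl | hv
    · exact ⟨le_rfl, le_add_of_nonneg_right (disp_nonneg _)⟩
    · have := ih hv
      rw [disp, ← add_assoc]
      exact ⟨(le_add_single k a).trans this.1, this.2⟩

lemma comparable_of_mem_path {k u v : Fin n → ℤ} {l : List (Fin n)} (hu : u ∈ path k l)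
    (hv : v ∈ path k l) : u ≤ v ∨ v ≤ u := by
  induction l generalizing k with
  | nil =>
    rw [Finset.mem_singleton.1 hv, Finset.mem_singleton.1 hu]
    exact Or.inl le_rfl
  | cons a l ih =>
    rcases Finset.mem_insert.1 hu with rfl | hu'
    · exact Or.inl (bounds_of_mem_path hv).1
    rcases Finset.mem_insert.1 hv with rfl | hv'
    · exact Or.inr (bounds_of_mem_path hu).1
    exact ih hu' hv'

lemma card_path (k : Fin n → ℤ) (l : List (Fin n)) : (path k l).card = l.length + 1 := by
  induction l generalizing k with
  | nil => simp [path]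
  | cons a l ih =>
    rw [path, Finset.card_insert_of_notMem, ih, List.length_cons]
    intro hk
    have := level_mono (bounds_of_mem_path hk).1
    rw [level_add, level_single] at this
    omega

lemma path_append_singleton (k : Fin n → ℤ) (l : List (Fin n)) (a : Fin n) :
    path k (l ++ [a]) = insert (k + disp (l ++ [a])) (path k l) := by
  induction l generalizing k with
  | nil => simp [path, disp, Finset.pair_comm]
  | cons b l ih =>
    rw [List.cons_append, path, ih, path, Finset.insert_comm, disp, add_assoc]

lemma isClique_path {k : Fin n → ℤ} {l : List (Fin n)} (h : disp l ≤ 1) : IsClique (path k l) := by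
  intro u hu v hv
  have h1 := bounds_of_mem_path hu
  have h2 := bounds_of_mem_path hv
  have key : ∀ {x y : Fin n → ℤ}, k ≤ x → y ≤ k + disp l → y ≤ x + 1 := fun hx hy =>
    hy.trans (add_le_add hx h)
  rcases comparable_of_mem_path hu hv with huv | huv
  · exact Or.inl ⟨huv, key h1.1 h2.2⟩
  · exact Or.inr ⟨huv, key h2.1 h1.2⟩

lemma disp_of_perm {l : List (Fin n)} (h : l.Perm (List.finRange n)) : disp l = 1 := by
  funext i
  rw [disp_apply, h.count_eq, List.count_eq_one_of_mem (List.nodup_finRange n) (by simp)]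
  rfl

lemma isKuhn_path {k : Fin n → ℤ} {l : List (Fin n)} (h : l.Perm (List.finRange n)) :
    IsKuhn (path k l) :=
  ⟨by rw [card_path, h.length_eq, List.length_finRange], isClique_path (disp_of_perm h).le⟩

lemma exists_eq_path (m : ℕ) : ∀ {t : Finset (Fin n → ℤ)} {k : Fin n → ℤ}, IsClique t → k ∈ t →
    (∀ v ∈ t, level k ≤ level v ∧ level v ≤ level k + m) → t.card = m + 1 →
    ∃ l, t = path k l ∧ l.length = m := by
  induction m with
  | zero =>
    intro t k ht hk _ hc
    obtain ⟨x, rfl⟩ := Finset.card_eq_one.1 hc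
    obtain rfl := Finset.mem_singleton.1 hk
    exact ⟨[], rfl, rfl⟩
  | succ m ih =>
    intro t k ht hk hl hc
    have hc' : (t.erase k).card = m + 1 := by rw [Finset.card_erase_of_mem hk, hc]; rfl
    have hl' : ∀ v ∈ t.erase k, level k + 1 ≤ level v ∧ level v ≤ level k + 1 + m := by
      intro v hv
      have h1 := hl v (Finset.mem_of_mem_erase hv)
      have h2 : level k ≠ level v := fun e => Finset.ne_of_mem_erase hv
        (ht.injOn_level (by simpa using Finset.mem_of_mem_erase hv) (by simpa using hk) e.symm)
      push_cast at h1
      omega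
    have himg : (t.erase k).image level = Finset.Icc (level k + 1) (level k + 1 + m) := by
      refine Finset.eq_of_subset_of_card_le (fun x hx => ?_) ?_
      · obtain ⟨v, hv, rfl⟩ := Finset.mem_image.1 hx
        exact Finset.mem_Icc.2 (hl' v hv)
      · rw [Finset.card_image_of_injOn (ht.mono (Finset.erase_subset _ _)).injOn_level, hc',
          Int.card_Icc]
        omega
    have : level k + 1 ∈ (t.erase k).image level := by
      rw [himg, Finset.mem_Icc]
      omega
    obtain ⟨v, hv, hlv⟩ := Finset.mem_image.1 this
    obtain ⟨a, rfl⟩ := exists_eq_add_single ((ht k hk v (Finset.mem_of_mem_erase hv)).le_of_level_le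
      (by omega)).1 hlv
    obtain ⟨l, hl, hlen⟩ := ih (ht.mono (Finset.erase_subset k t)) hv
      (fun u hu => by rw [hlv]; exact hl' u hu) hc'
    exact ⟨a :: l, by rw [path, ← hl, Finset.insert_erase hk], by simp [hlen]⟩

lemma IsKuhn.exists_eq_path {t : Finset (Fin n → ℤ)} (ht : IsKuhn t) {k : Fin n → ℤ} (hk : k ∈ t)
    (hmin : ∀ v ∈ t, k ≤ v ∧ v ≤ k + 1) :
    ∃ l : List (Fin n), t = path k l ∧ l.Perm (List.finRange n) := by
  obtain ⟨l, rfl, hlen⟩ := Kuhn.exists_eq_path n ht.2 hk (fun v hv =>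
    ⟨level_mono (hmin v hv).1, by rw [← level_add_one]; exact level_mono (hmin v hv).2⟩) ht.1
  refine ⟨l, rfl, ?_⟩
  have hd : disp l ≤ 1 := le_of_add_le_add_left (hmin _ (end_mem_path k l)).2
  have hnd : l.Nodup := List.nodup_iff_count_le_one.2 fun i => by
    have : disp l i ≤ 1 := hd i
    rw [disp_apply] at this
    exact_mod_cast this
  refine List.perm_of_nodup_nodup_toFinset_eq hnd (List.nodup_finRange n) ?_
  have h1 : l.toFinset = Finset.univ := by
    rw [← Finset.card_eq_iff_eq_univ, List.toFinset_card_of_nodup hnd, hlen, Fintype.card_fin]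
  rw [h1]
  ext i
  simp

section Connected

variable {α : Type*} {A : Finset (Fin n → ℤ) → α} {G : Finset (Fin n → ℤ) → Prop}

lemma eq_of_insert (hG : ∀ t, G t → IsKuhn t)
    (hA : ∀ f w₁ w₂, w₁ ∉ f → w₂ ∉ f → G (insert w₁ f) → G (insert w₂ f) →
      A (insert w₁ f) = A (insert w₂ f)) {f : Finset (Fin n → ℤ)} {w₁ w₂ : Fin n → ℤ}
    (h₁ : G (insert w₁ f)) (h₂ : G (insert w₂ f)) : A (insert w₁ f) = A (insert w₂ f) := by
  have c₁ := (hG _ h₁).1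
  have c₂ := (hG _ h₂).1
  by_cases m₁ : w₁ ∈ f <;> by_cases m₂ : w₂ ∈ f
  · rw [Finset.insert_eq_of_mem m₁, Finset.insert_eq_of_mem m₂]
  · rw [Finset.insert_eq_of_mem m₁] at c₁
    rw [Finset.card_insert_of_notMem m₂] at c₂
    omega
  · rw [Finset.insert_eq_of_mem m₂] at c₂
    rw [Finset.card_insert_of_notMem m₁] at c₁
    omega
  · exact hA f w₁ w₂ m₁ m₂ h₁ h₂

lemma eq_of_perm (hG : ∀ t, G t → IsKuhn t)
    (hA : ∀ f w₁ w₂, w₁ ∉ f → w₂ ∉ f → G (insert w₁ f) → G (insert w₂ f) →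
      A (insert w₁ f) = A (insert w₂ f)) {l l' : List (Fin n)} (h : l.Perm l') :
    ∀ (p : Finset (Fin n → ℤ)) (k : Fin n → ℤ), (∀ l'' : List (Fin n), l''.Perm l →
      G (p ∪ path k l'')) → A (p ∪ path k l) = A (p ∪ path k l') := by
  induction h with
  | nil => exact fun _ _ _ => rfl
  | cons a h ih =>
    intro p k hp
    simp only [path, Finset.union_insert, ← Finset.insert_union]
    refine ih _ _ fun l'' hl'' => ?_
    have := hp (a :: l'') (hl''.cons a)
    rwa [path, Finset.union_insert, ← Finset.insert_union] at this
  | swap a b l =>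
    intro p k hp
    have e (a b : Fin n) : p ∪ path k (a :: b :: l) = insert (k + Pi.single a 1)
        (p ∪ insert k (path (k + Pi.single a 1 + Pi.single b 1) l)) := by
      rw [path, path, Finset.insert_comm, Finset.union_insert]
    have h₁ := hp _ (List.Perm.refl _)
    have h₂ := hp _ (List.Perm.swap b a l)
    rw [e] at h₁ h₂ ⊢
    rw [e, add_right_comm k (Pi.single a 1)]
    rw [add_right_comm k (Pi.single a 1)] at h₂
    exact eq_of_insert hG hA h₁ h₂
  | trans h₁ h₂ ih₁ ih₂ =>
    intro p k hp
    rw [ih₁ p k hp]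
    exact ih₂ p k fun l'' hl'' => hp l'' (hl''.trans h₁.symm)

/-- The Kuhn simplices in a box are connected through common facets. -/
theorem eq_of_mem_box {lo hi : Fin n → ℤ}
    (hA : ∀ f w₁ w₂, w₁ ∉ f → w₂ ∉ f → IsKuhn (insert w₁ f) → IsKuhn (insert w₂ f) →
      (∀ v ∈ insert w₁ f, lo ≤ v ∧ v ≤ hi) → (∀ v ∈ insert w₂ f, lo ≤ v ∧ v ≤ hi) →
      A (insert w₁ f) = A (insert w₂ f))
    {s t : Finset (Fin n → ℤ)} (hs : IsKuhn s) (ht : IsKuhn t) (hsb : ∀ v ∈ s, lo ≤ v ∧ v ≤ hi)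
    (htb : ∀ v ∈ t, lo ≤ v ∧ v ≤ hi) : A s = A t := by
  let G : Finset (Fin n → ℤ) → Prop := fun t => IsKuhn t ∧ ∀ v ∈ t, lo ≤ v ∧ v ≤ hi
  have hG : ∀ t, G t → IsKuhn t := fun t h => h.1
  have hA' : ∀ f w₁ w₂, w₁ ∉ f → w₂ ∉ f → G (insert w₁ f) → G (insert w₂ f) →
      A (insert w₁ f) = A (insert w₂ f) := fun f w₁ w₂ m₁ m₂ h₁ h₂ =>
    hA f w₁ w₂ m₁ m₂ h₁.1 h₂.1 h₁.2 h₂.2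
  have good : ∀ {k : Fin n → ℤ} {l : List (Fin n)}, l.Perm (List.finRange n) → lo ≤ k →
      k + 1 ≤ hi → G (path k l) := fun hl h0 h1 => ⟨isKuhn_path hl, fun v hv => by
    have := bounds_of_mem_path hv
    rw [disp_of_perm hl] at this
    exact ⟨h0.trans this.1, this.2.trans h1⟩⟩
  have perm : ∀ {k : Fin n → ℤ} {l l' : List (Fin n)}, l.Perm (List.finRange n) →
      l'.Perm (List.finRange n) → lo ≤ k → k + 1 ≤ hi → A (path k l) = A (path k l') :=
    fun {k l l'} hl hl' h0 h1 => by
      have := eq_of_perm hG hA' (hl.trans hl'.symm) ∅ k fun l'' h => by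
        rw [Finset.empty_union]
        exact good (h.trans hl) h0 h1
      rwa [Finset.empty_union, Finset.empty_union] at this
  have down : ∀ (m : ℕ) (k : Fin n → ℤ), lo ≤ k → k + 1 ≤ hi → level k = level lo + m →
      A (path k (List.finRange n)) = A (path lo (List.finRange n)) := by
    intro m
    induction m with
    | zero =>
      intro k h0 h1 hl
      rw [eq_of_le_of_level_le h0 (by simp [hl])]
    | succ m ih =>
      intro k h0 h1 hl
      have : ∃ a, lo a < k a := by
        by_contra! hc
        have := level_mono (show k ≤ lo from hc)
        omega
      obtain ⟨a, ha⟩ := this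
      have hp : ((List.finRange n).erase a ++ [a]).Perm (List.finRange n) :=
        (List.perm_append_comm).trans (List.perm_cons_erase (List.mem_finRange a)).symm
      have hp' : (a :: (List.finRange n).erase a).Perm (List.finRange n) :=
        (List.perm_cons_erase (List.mem_finRange a)).symm
      have hk : k - Pi.single a 1 + Pi.single a 1 = k := sub_add_cancel _ _
      have h0' : lo ≤ k - Pi.single a 1 := fun i => by
        by_cases hi : i = a
        · subst hi
          simp
          omega
        · simpa [hi] using h0 i
      have h1' : k - Pi.single a 1 + 1 ≤ hi :=
        (add_le_add_left ((le_add_single _ a).trans hk.le) 1).trans h1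
      have hl' : level (k - Pi.single a 1) = level lo + m := by
        have := level_add (k - Pi.single a 1) (Pi.single a 1)
        rw [hk, level_single] at this
        push_cast at hl
        omega
      rw [← ih _ h0' h1' hl', perm (List.Perm.refl _) hp h0 h1, ← perm hp' (List.Perm.refl _) h0' h1']
      have g1 := good hp h0 h1
      have g2 := good hp' h0' h1'
      rw [path_append_singleton] at g1 ⊢
      rw [path, hk] at g2 ⊢
      exact eq_of_insert hG hA' g1 g2
  have main : ∀ {t : Finset (Fin n → ℤ)}, IsKuhn t → (∀ v ∈ t, lo ≤ v ∧ v ≤ hi) →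
      A t = A (path lo (List.finRange n)) := by
    intro t ht htb
    obtain ⟨k, hk, hmin⟩ := ht.2.exists_min ht.nonempty
    obtain ⟨l, rfl, hl⟩ := ht.exists_eq_path hk hmin
    have h0 := (htb k hk).1
    have h1 := (htb _ (ht.add_one_mem hmin)).2
    rw [perm hl (List.Perm.refl _) h0 h1]
    have := level_mono h0
    exact down (level k - level lo).toNat k h0 h1 (by omega)
  rw [main hs hsb, main ht htb]

end Connected

/-- Coordinatewise floor division by `m`. -/
def coarsen (m : ℤ) (v : Fin n → ℤ) : Fin n → ℤ := fun i => v i / m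

lemma coarsen_mono {m : ℤ} (hm : 0 < m) {u v : Fin n → ℤ} (h : u ≤ v) :
    coarsen m u ≤ coarsen m v := fun i => Int.ediv_le_ediv hm (h i)

lemma coarsen_add_one_le {m : ℤ} (hm : 0 < m) (u : Fin n → ℤ) :
    coarsen m (u + 1) ≤ coarsen m u + 1 := fun i => by
  have : (u i + 1) / m ≤ (u i + m) / m := Int.ediv_le_ediv hm (by omega)
  rwa [Int.add_ediv_of_dvd_right (dvd_refl m), Int.ediv_self hm.ne'] at this

lemma Adj.coarsen {m : ℤ} (hm : 0 < m) {u v : Fin n → ℤ} (h : Adj u v) :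
    Adj (coarsen m u) (coarsen m v) := by
  rcases h with h | h
  · exact Or.inl ⟨coarsen_mono hm h.1, (coarsen_mono hm h.2).trans (coarsen_add_one_le hm u)⟩
  · exact Or.inr ⟨coarsen_mono hm h.1, (coarsen_mono hm h.2).trans (coarsen_add_one_le hm v)⟩

/-- The lift of the unit cell with lower corner `κ` to the fine lattice. -/
def refineAt (m : ℤ) (κ v : Fin n → ℤ) : Fin n → ℤ := fun i => v i + (m - 1) * (κ i + 1)

lemma isKuhn_image_refineAt {m : ℤ} {σ : Finset (Fin n → ℤ)} (hσ : IsKuhn σ) (κ : Fin n → ℤ) :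
    IsKuhn (σ.image (refineAt m κ)) := by
  have hinj : Function.Injective (refineAt m κ) := fun u v h => funext fun i => by
    have := congrFun h i
    simpa [refineAt] using this
  refine ⟨by rw [Finset.card_image_of_injective _ hinj, hσ.1], ?_⟩
  intro u hu v hv
  obtain ⟨x, hx, rfl⟩ := Finset.mem_image.1 hu
  obtain ⟨y, hy, rfl⟩ := Finset.mem_image.1 hv
  have key : ∀ {x y : Fin n → ℤ}, x ≤ y ∧ y ≤ x + 1 →
      refineAt m κ x ≤ refineAt m κ y ∧ refineAt m κ y ≤ refineAt m κ x + 1 := by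
    refine fun {x y} h => ⟨fun i => ?_, fun i => ?_⟩
    · have : x i ≤ y i := h.1 i
      simpa [refineAt] using this
    · have : y i ≤ x i + 1 := h.2 i
      simp only [refineAt, Pi.add_apply, Pi.one_apply]
      omega
  exact (hσ.2 x hx y hy).imp key key

lemma coarsen_refineAt {m : ℤ} (hm : 0 < m) {κ v : Fin n → ℤ} (h : κ ≤ v ∧ v ≤ κ + 1) :
    coarsen m (refineAt m κ v) = v := by
  funext i
  have h0 : κ i ≤ v i := h.1 i
  have h1 : v i ≤ κ i + 1 := h.2 i
  simp only [coarsen, refineAt]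
  have e : v i + (m - 1) * (κ i + 1) = (v i - κ i - 1 + m) + κ i * m := by ring
  rw [e, Int.add_mul_ediv_right _ _ hm.ne']
  rcases (by omega : v i = κ i ∨ v i = κ i + 1) with h | h
  · rw [h, Int.ediv_eq_zero_of_lt (by omega) (by omega)]
    omega
  · rw [h, show κ i + 1 - κ i - 1 + m = m by ring, Int.ediv_self hm.ne']
    omega

lemma image_coarsen_refineAt {m : ℤ} (hm : 0 < m) {σ : Finset (Fin n → ℤ)} {κ : Fin n → ℤ}
    (h : ∀ v ∈ σ, κ ≤ v ∧ v ≤ κ + 1) : (σ.image (refineAt m κ)).image (coarsen m) = σ := by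
  rw [Finset.image_image]
  conv_rhs => rw [← Finset.image_id (s := σ)]
  exact Finset.image_congr fun v hv => coarsen_refineAt hm (h v hv)

lemma eq_image_refineAt {m : ℤ} (hm : 0 < m) {σ t : Finset (Fin n → ℤ)} (hσ : IsKuhn σ)
    (ht : IsKuhn t) {κ : Fin n → ℤ} (hκ : κ ∈ σ) (h : ∀ v ∈ σ, κ ≤ v ∧ v ≤ κ + 1)
    (hi : t.image (coarsen m) = σ) : t = σ.image (refineAt m κ) := by
  obtain ⟨k, hk, hmin⟩ := ht.2.exists_min ht.nonempty
  have e0 : coarsen m k = κ := by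
    refine le_antisymm ?_ (h _ (hi ▸ Finset.mem_image_of_mem _ hk)).1
    rw [← hi] at hκ
    obtain ⟨v, hv, rfl⟩ := Finset.mem_image.1 hκ
    exact coarsen_mono hm (hmin v hv).1
  have e1 : coarsen m (k + 1) = κ + 1 := by
    refine le_antisymm (h _ (hi ▸ Finset.mem_image_of_mem _ (ht.add_one_mem hmin))).2 ?_
    have := hσ.add_one_mem h
    rw [← hi] at this
    obtain ⟨v, hv, h⟩ := Finset.mem_image.1 this
    rw [← h]
    exact coarsen_mono hm (hmin v hv).2
  have e2 : ∀ i, k i = κ i * m + (m - 1) := fun i => by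
    have h0 : k i / m = κ i := congrFun e0 i
    have h1 : (k i + 1) / m = κ i + 1 := congrFun e1 i
    have a1 := Int.mul_ediv_add_emod (k i) m
    have a2 := Int.emod_lt_of_pos (k i) hm
    have a3 := Int.mul_ediv_add_emod (k i + 1) m
    have a4 := Int.emod_nonneg (k i + 1) hm.ne'
    rw [h0] at a1
    rw [h1, mul_add] at a3
    linarith [mul_comm m (κ i)]
  have e3 : ∀ v ∈ t, refineAt m κ (coarsen m v) = v := fun v hv => funext fun i => by
    have h0 : k i ≤ v i := (hmin v hv).1 i
    have h1 : v i ≤ k i + 1 := (hmin v hv).2 i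
    simp only [refineAt, coarsen]
    have e := e2 i
    rcases (by omega : v i = k i ∨ v i = k i + 1) with h | h
    · have h0 : k i / m = κ i := congrFun e0 i
      rw [h, h0, e]
      ring
    · have h1 : (k i + 1) / m = κ i + 1 := congrFun e1 i
      rw [h, h1, e]
      ring
  rw [← hi, Finset.image_image]
  conv_lhs => rw [← Finset.image_id (s := t)]
  exact Finset.image_congr fun v hv => (e3 v hv).symm

end Kuhn

namespace Kuhn

variable {n : ℕ}

/-- Coordinatewise floor after a diagonal shift. -/
noncomputable def shiftFloor (θ : ℝ) (y : Fin n → ℝ) : Fin n → ℤ := fun i => ⌊y i - θ⌋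

/-- The distance below which snapping is insensitive to perturbations. -/
noncomputable def gap (n : ℕ) : ℝ := 1 / (2 * (n + 1))

lemma gap_pos : 0 < gap n := by
  unfold gap
  positivity

lemma exists_shift (y : Fin n → ℝ) :
    ∃ θ : ℝ, 0 ≤ θ ∧ θ < 1 ∧ ∀ i, ∀ z : ℤ, gap n ≤ |y i - θ - z| := by
  by_contra! hc
  have hn : (0 : ℝ) < n + 1 := by positivity
  have bad : ∀ j : Fin (n + 1), ∃ i, ∃ z : ℤ, |y i - j / (n + 1) - z| < gap n := fun j => by
    refine hc _ (by positivity) ?_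
    rw [div_lt_one hn]
    exact_mod_cast j.2
  choose i z h using bad
  obtain ⟨j, j', hne, hij⟩ := Fintype.exists_ne_map_eq_of_card_lt i (by simp)
  have h1 := h j
  have h2 := h j'
  rw [← hij] at h2
  refine hne (Fin.ext ?_)
  have h3 : |(((j : ℤ) - j' + (n + 1) * (z j - z j') : ℤ) : ℝ)| < 1 := by
    have e : (((j : ℤ) - j' + (n + 1) * (z j - z j') : ℤ) : ℝ) = (n + 1) *
        ((y (i j) - j' / (n + 1) - z j') - (y (i j) - j / (n + 1) - z j)) := by
      push_cast
      field_simp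
      ring
    rw [e, abs_mul, abs_of_pos hn]
    have := (abs_sub _ _).trans_lt (add_lt_add h2 h1)
    calc _ < (n + 1) * (gap n + gap n) := by gcongr
      _ = 1 := by unfold gap; field_simp; norm_num
  have h4 : ((j : ℤ) - j' + (n + 1) * (z j - z j') : ℤ) = 0 := by
    rw [← Int.abs_lt_one_iff]
    exact_mod_cast h3
  have hj := j.2
  have hj' := j'.2
  have h5 : z j - z j' = 0 := by
    rw [← Int.abs_lt_one_iff, abs_lt]
    constructor <;> nlinarith
  rw [h5] at h4
  omega

/-- A diagonal shift that keeps all coordinates of `y` away from the integers. -/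
noncomputable def shift (y : Fin n → ℝ) : ℝ := (exists_shift y).choose

lemma shift_nonneg (y : Fin n → ℝ) : 0 ≤ shift y := (exists_shift y).choose_spec.1

lemma shift_lt_one (y : Fin n → ℝ) : shift y < 1 := (exists_shift y).choose_spec.2.1

lemma gap_le_shift (y : Fin n → ℝ) (i : Fin n) (z : ℤ) : gap n ≤ |y i - shift y - z| :=
  (exists_shift y).choose_spec.2.2 i z

/-- A lattice point near `y`, chosen so that nearby points are sent to adjacent lattice points. -/
noncomputable def snap (y : Fin n → ℝ) : Fin n → ℤ := shiftFloor (shift y) y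

lemma snap_eq {y y' : Fin n → ℝ} (h : dist y y' < gap n) : snap y = shiftFloor (shift y) y' := by
  funext i
  have h1 := gap_le_shift y i ⌊y i - shift y⌋
  have h2 := gap_le_shift y i (⌊y i - shift y⌋ + 1)
  have h3 := Int.floor_le (y i - shift y)
  have h4 := Int.lt_floor_add_one (y i - shift y)
  have h5 := abs_lt.1 ((dist_le_pi_dist y y' i).trans_lt h)
  rw [abs_of_nonneg (by linarith)] at h1
  push_cast at h2
  rw [abs_of_neg (by linarith)] at h2
  symm
  simp only [snap, shiftFloor]
  rw [Int.floor_eq_iff]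
  constructor <;> linarith

lemma adj_shiftFloor (y : Fin n → ℝ) {θ θ' : ℝ} (h : 0 ≤ θ ∧ θ < 1) (h' : 0 ≤ θ' ∧ θ' < 1) :
    Adj (shiftFloor θ y) (shiftFloor θ' y) := by
  have key : ∀ {a b : ℝ}, 0 ≤ a → b < 1 → a ≤ b →
      shiftFloor b y ≤ shiftFloor a y ∧ shiftFloor a y ≤ shiftFloor b y + 1 := by
    refine fun {a b} ha hb hab => ⟨fun i => Int.floor_mono (by linarith), fun i => ?_⟩
    simp only [shiftFloor, Pi.add_apply, Pi.one_apply]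
    rw [← Int.floor_add_one]
    exact Int.floor_mono (by linarith)
  rcases le_total θ θ' with hh | hh
  · exact Or.inr (key h.1 h'.2 hh)
  · exact Or.inl (key h'.1 h.2 hh)

lemma adj_snap {y y' : Fin n → ℝ} (h : dist y y' < gap n) : Adj (snap y) (snap y') := by
  rw [snap_eq h]
  exact adj_shiftFloor y' ⟨shift_nonneg y, shift_lt_one y⟩ ⟨shift_nonneg y', shift_lt_one y'⟩

lemma adj_snap_floor {y y' : Fin n → ℝ} (h : dist y y' < gap n) :
    Adj (snap y) (fun i => ⌊y' i⌋) := by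
  rw [snap_eq h]
  have := adj_shiftFloor y' ⟨shift_nonneg y, shift_lt_one y⟩ ⟨le_rfl, zero_lt_one⟩
  rwa [show (fun i => ⌊y' i⌋) = shiftFloor 0 y' from funext fun i => by simp [shiftFloor]]

/-- The point of `(1 / N) ℤⁿ` with index `k`. -/
noncomputable def pt (N : ℕ) (k : Fin n → ℤ) : Fin n → ℝ := fun i => k i / N

lemma pt_injective {N : ℕ} (hN : 0 < N) : Function.Injective (pt N : (Fin n → ℤ) → _) := by
  intro k k' h
  funext i
  have hN' : (N : ℝ) ≠ 0 := by positivity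
  have := congrFun h i
  simp only [pt] at this
  rw [div_left_inj' hN'] at this
  exact_mod_cast this

lemma Adj.dist_pt_le {N : ℕ} {k k' : Fin n → ℤ} (h : Adj k k') :
    dist (pt N k) (pt N k') ≤ 1 / N := by
  refine (dist_pi_le_iff (by positivity)).2 fun i => ?_
  rw [Real.dist_eq, pt, pt, ← sub_div, abs_div, Nat.abs_cast]
  gcongr
  have : |k i - k' i| ≤ 1 := by
    rw [abs_le]
    rcases h with h | h
    · have h1 : k i ≤ k' i := h.1 i
      have h2 : k' i ≤ k i + 1 := h.2 i
      omega
    · have h1 : k' i ≤ k i := h.1 i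
      have h2 : k i ≤ k' i + 1 := h.2 i
      omega
  exact_mod_cast this

/-- Snapping to the lattice `(1 / N) ℤⁿ`. -/
noncomputable def snapAt (N : ℕ) (y : Fin n → ℝ) : Fin n → ℤ := snap (fun i => N * y i)

lemma dist_pt_of_floor {N : ℕ} (hN : 0 < N) {k : Fin n → ℤ} {y : Fin n → ℝ}
    (h : ∀ i, |k i - N * y i| ≤ 2) : dist (pt N k) y ≤ 2 / N := by
  have hN' : (0 : ℝ) < N := by positivity
  refine (dist_pi_le_iff (by positivity)).2 fun i => ?_
  rw [Real.dist_eq, pt, show (k i : ℝ) / N - y i = (k i - N * y i) / N by field_simp, abs_div,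
    abs_of_pos hN']
  gcongr
  exact h i

lemma dist_pt_snapAt {N : ℕ} (hN : 0 < N) (y : Fin n → ℝ) : dist (pt N (snapAt N y)) y ≤ 2 / N := by
  refine dist_pt_of_floor hN fun i => ?_
  set y' : Fin n → ℝ := fun i => N * y i
  have h1 := Int.floor_le (y' i - shift y')
  have h2 := Int.lt_floor_add_one (y' i - shift y')
  have h3 := shift_nonneg y'
  have h4 := shift_lt_one y'
  rw [abs_le]
  simp only [snapAt, snap, shiftFloor]
  constructor <;> linarith

lemma dist_scale {N : ℕ} (hN : 0 < N) {y y' : Fin n → ℝ} (h : dist y y' < gap n / N) :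
    dist (fun i => (N : ℝ) * y i) (fun i => N * y' i) < gap n := by
  have hN' : (0 : ℝ) < N := by positivity
  refine (dist_pi_lt_iff gap_pos).2 fun i => ?_
  rw [Real.dist_eq, ← mul_sub, abs_mul, abs_of_pos hN', mul_comm, ← lt_div_iff₀ hN']
  exact (dist_le_pi_dist y y' i).trans_lt h

lemma adj_snapAt {N : ℕ} (hN : 0 < N) {y y' : Fin n → ℝ} (h : dist y y' < gap n / N) :
    Adj (snapAt N y) (snapAt N y') := adj_snap (dist_scale hN h)

lemma adj_snapAt_coarsen {N m : ℕ} (hN : 0 < N) {k k' : Fin n → ℤ}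
    (h : dist (pt (N * m) k) (pt (N * m) k') < gap n / N) :
    Adj (snapAt N (pt (N * m) k)) (coarsen m k') := by
  have hN' : (N : ℝ) ≠ 0 := by positivity
  have := adj_snap_floor (dist_scale hN h)
  rw [snapAt, show coarsen (m : ℤ) k' = fun i => ⌊(N : ℝ) * pt (N * m) k' i⌋ from ?_]
  · exact this
  funext i
  have e : (N : ℝ) * pt (N * m) k' i = (k' i : ℝ) / m := by
    simp only [pt]
    push_cast
    field_simp
  rw [e]
  simp only [coarsen]
  have := Int.floor_div_natCast (k' i : ℝ) m
  simp at this
  exact this.symm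

lemma dist_pt_coarsen {N m : ℕ} (hN : 0 < N) (hm : 0 < m) (k : Fin n → ℤ) :
    dist (pt N (coarsen m k)) (pt (N * m) k) ≤ 2 / N := by
  have hN' : (N : ℝ) ≠ 0 := by positivity
  have hm' : (0 : ℝ) < m := by positivity
  refine dist_pt_of_floor hN fun i => ?_
  have e : (N : ℝ) * pt (N * m) k i = (k i : ℝ) / m := by
    simp only [pt]
    push_cast
    field_simp
  rw [e, coarsen]
  have h0 := Int.mul_ediv_add_emod (k i) m
  have h1 := Int.emod_nonneg (k i) (by omega : (m : ℤ) ≠ 0)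
  have h2 := Int.emod_lt_of_pos (k i) (by omega : 0 < (m : ℤ))
  have e2 : ((k i : ℤ) : ℝ) = m * ((k i / m : ℤ) : ℝ) + ((k i % m : ℤ) : ℝ) := by
    exact_mod_cast h0.symm
  have h1' : (0 : ℝ) ≤ ((k i % m : ℤ) : ℝ) := by exact_mod_cast h1
  have h2' : ((k i % m : ℤ) : ℝ) ≤ m := by exact_mod_cast h2.le
  have e3 : ((k i / m : ℤ) : ℝ) - (k i : ℝ) / m = - (((k i % m : ℤ) : ℝ) / m) := by
    rw [e2]
    field_simp
    ring
  rw [e3, abs_neg, abs_of_nonneg (by positivity)]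
  exact ((div_le_one hm').2 h2').trans (by norm_num)

lemma exists_box (N : ℕ) (hN : 0 < N) (y : Fin n → ℝ) {τ : ℝ} (hτ : 0 ≤ τ) :
    ∃ lo hi : Fin n → ℤ, ∀ k, (lo ≤ k ∧ k ≤ hi) ↔ dist (pt N k) y ≤ τ := by
  have hN' : (0 : ℝ) < N := by positivity
  refine ⟨fun i => ⌈N * (y i - τ)⌉, fun i => ⌊N * (y i + τ)⌋, fun k => ?_⟩
  rw [dist_pi_le_iff hτ, Pi.le_def, Pi.le_def, ← forall_and]
  refine forall_congr' fun i => ?_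
  rw [Int.ceil_le, Int.le_floor, Real.dist_eq, abs_le, pt, mul_comm, ← le_div_iff₀ hN', mul_comm,
    ← div_le_iff₀ hN']
  constructor <;> rintro ⟨h1, h2⟩ <;> constructor <;> linarith

end Kuhn

namespace Kuhn

open VietorisChain

variable {n : ℕ} {M : Type*} [DecidableEq M]

lemma eq_of_image_eq {g : (Fin n → ℤ) → M} (hg : Function.Injective g)
    {s t : Finset (Fin n → ℤ)} (h : s.image g = t.image g) : s = t :=
  Finset.image_injective hg h

lemma exists_eq_insert {f κ : Finset (Fin n → ℤ)} (h : f ⊆ κ) (hc : κ.card = f.card + 1) :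
    ∃ w, w ∉ f ∧ κ = insert w f := by
  obtain ⟨w, hw⟩ := Finset.card_eq_one.1 (show (κ \ f).card = 1 by
    rw [Finset.card_sdiff_of_subset h, hc]; omega)
  have : w ∈ κ \ f := by simp [hw]
  refine ⟨w, (Finset.mem_sdiff.1 this).2, ?_⟩
  rw [← Finset.sdiff_union_of_subset h, hw]
  rfl

/-- The boundary coefficient at a facet is the sum of the two adjacent coefficients. -/
lemma bd_apply_image (hn : 0 < n) {g : (Fin n → ℤ) → M} (hg : Function.Injective g) {C : Chain M}
    {f : Finset (Fin n → ℤ)}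
    (hC : ∀ s, C s ≠ 0 → f.image g ⊆ s → s.card = n + 1 → ∃ κ, IsClique κ ∧ s = κ.image g)
    {w₁ w₂ : Fin n → ℤ} (hne : w₁ ≠ w₂) (m₁ : w₁ ∉ f) (m₂ : w₂ ∉ f) (k₁ : IsKuhn (insert w₁ f))
    (k₂ : IsKuhn (insert w₂ f)) :
    bd C (f.image g) = C ((insert w₁ f).image g) + C ((insert w₂ f).image g) := by
  have hf : f.card = n := by
    have := k₁.1
    rw [Finset.card_insert_of_notMem m₁] at this
    omega
  have hcard : ∀ s : Finset (Fin n → ℤ), (s.image g).card = s.card := fun s =>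
    Finset.card_image_of_injective s hg
  rw [bd_apply_eq_sum C (f.image g) {(insert w₁ f).image g, (insert w₂ f).image g},
    Finset.sum_pair]
  · intro h
    have := eq_of_image_eq hg h
    have h1 : w₁ ∈ insert w₂ f := this ▸ Finset.mem_insert_self _ _
    exact (Finset.mem_insert.1 h1).elim hne m₁
  · intro s hs
    have : ∃ w, IsKuhn (insert w f) ∧ s = (insert w f).image g := by
      rcases Finset.mem_insert.1 hs with h | h
      · exact ⟨w₁, k₁, h⟩
      · exact ⟨w₂, k₂, Finset.mem_singleton.1 h⟩
    obtain ⟨w, hw, rfl⟩ := this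
    exact ⟨Finset.image_subset_image (Finset.subset_insert _ _), by rw [hcard, hcard, hf, hw.1]⟩
  · intro s hs hsc hs0
    rw [hcard, hf] at hsc
    obtain ⟨κ, hκ, rfl⟩ := hC s hs0 hs hsc
    rw [hcard] at hsc
    obtain ⟨w, hw, rfl⟩ := exists_eq_insert ((Finset.image_subset_image_iff hg).1 hs)
      (by rw [hsc, hf])
    rcases facet_at_most_two hn hw m₁ m₂ ⟨hsc, hκ⟩ k₁ k₂ with h | h | h
    · rw [h]
      exact Finset.mem_insert_self _ _
    · rw [h]
      exact Finset.mem_insert_of_mem (Finset.mem_singleton_self _)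
    · exact absurd h hne

/-- Away from its boundary, a top-dimensional chain of lattice simplices has locally constant
coefficients. -/
lemma coeff_const (hn : 0 < n) {g : (Fin n → ℤ) → M} (hg : Function.Injective g) {C : Chain M}
    {Q : Set M}
    (hC : ∀ s, C s ≠ 0 → (∃ a ∈ s, a ∈ Q) → ∃ κ, IsClique κ ∧ s = κ.image g)
    {lo hi : Fin n → ℤ} (hQ : ∀ k, lo ≤ k → k ≤ hi → g k ∈ Q)
    (hbd : ∀ (f : Finset (Fin n → ℤ)) (k : Fin n → ℤ), lo ≤ k → k ≤ hi → k ∈ f →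
      bd C (f.image g) = 0) {s t : Finset (Fin n → ℤ)}
    (hs : IsKuhn s) (ht : IsKuhn t) (hsb : ∀ v ∈ s, lo ≤ v ∧ v ≤ hi)
    (htb : ∀ v ∈ t, lo ≤ v ∧ v ≤ hi) : C (s.image g) = C (t.image g) := by
  refine eq_of_mem_box (A := fun t => C (t.image g)) ?_ hs ht hsb htb
  intro f w₁ w₂ m₁ m₂ k₁ k₂ b₁ b₂
  by_cases hne : w₁ = w₂
  · rw [hne]
  have hf : f.Nonempty := by
    have := k₁.1
    rw [Finset.card_insert_of_notMem m₁] at this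
    rw [← Finset.card_pos]
    omega
  obtain ⟨k, hk⟩ := hf
  have hkb := b₁ k (Finset.mem_insert_of_mem hk)
  have h := bd_apply_image hn hg (C := C) (f := f) (fun s h0 hs _ => hC s h0 ⟨g k,
    hs (Finset.mem_image_of_mem g hk), hQ k hkb.1 hkb.2⟩) hne m₁ m₂ k₁ k₂
  rw [hbd f k hkb.1 hkb.2 hk] at h
  rw [eq_neg_of_add_eq_zero_left h.symm, ZModModule.neg_eq_self]

end Kuhn

namespace ManifoldChart

open Kuhn Metric

variable {n : ℕ} {M : Type*} [MetricSpace M]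

/-- The image of the closed cube of radius `t` under a parametrization `φ`. -/
def cube (φ : OpenPartialHomeomorph (Fin n → ℝ) M) (t : ℝ) : Set M := φ '' closedBall 0 t

/-- The image of a lattice point under a parametrization. -/
noncomputable def grid (φ : OpenPartialHomeomorph (Fin n → ℝ) M) (N : ℕ) (k : Fin n → ℤ) : M :=
  φ (pt N k)

open Classical in
/-- Snapping to lattice points inside a cube of a parametrization. -/
noncomputable def snapMap (φ : OpenPartialHomeomorph (Fin n → ℝ) M) (N : ℕ) (x : M) : M :=
  if x ∈ cube φ 3 then grid φ N (snapAt N (φ.symm x)) else x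

variable {φ : OpenPartialHomeomorph (Fin n → ℝ) M}

lemma symm_apply (hφ : φ.source = Set.univ) (y : Fin n → ℝ) : φ.symm (φ y) = y :=
  φ.left_inv (by simp [hφ])

lemma injective (hφ : φ.source = Set.univ) : Function.Injective φ := fun a b h => by
  rw [← symm_apply hφ a, h, symm_apply hφ]

lemma grid_injective (hφ : φ.source = Set.univ) {N : ℕ} (hN : 0 < N) :
    Function.Injective (grid φ N) := (injective hφ).comp (pt_injective hN)

lemma continuous (hφ : φ.source = Set.univ) : Continuous φ := by
  have := φ.continuousOn
  rwa [hφ, continuousOn_univ] at this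

lemma isCompact_cube (hφ : φ.source = Set.univ) (t : ℝ) : IsCompact (cube φ t) :=
  (isCompact_closedBall 0 t).image (continuous hφ)

lemma mem_cube (hφ : φ.source = Set.univ) {y : Fin n → ℝ} {t : ℝ} : φ y ∈ cube φ t ↔ ‖y‖ ≤ t := by
  rw [cube, (injective hφ).mem_set_image, mem_closedBall_zero_iff]

lemma mem_target (hφ : φ.source = Set.univ) (y : Fin n → ℝ) : φ y ∈ φ.target :=
  φ.map_source (by simp [hφ])

lemma exists_symm_close (hφ : φ.source = Set.univ) (t : ℝ) {τ : ℝ} (hτ : 0 < τ) :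
    ∃ R > 0, ∀ y, ‖y‖ ≤ t → ∀ b, dist (φ y) b < R → ∃ y', dist y y' < τ ∧ φ y' = b := by
  have hsub : cube φ t ⊆ φ.target := by
    rintro _ ⟨y, _, rfl⟩
    exact mem_target hφ y
  obtain ⟨R₁, hR₁, h₁⟩ := (isCompact_cube hφ t).exists_thickening_subset_open φ.open_target hsub
  have h₂ := (isCompact_cube hφ t).uniformContinuousAt_of_continuousAt φ.symm
    (fun a ha => φ.continuousAt_symm (hsub ha)) (Metric.dist_mem_uniformity hτ)
  obtain ⟨R₂, hR₂, h₂⟩ := Metric.mem_uniformity_dist.1 h₂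
  refine ⟨min R₁ R₂, lt_min hR₁ hR₂, fun y hy b hb => ?_⟩
  have hyc := (mem_cube hφ).2 hy
  have hbt : b ∈ φ.target := h₁ (mem_thickening_iff.2 ⟨φ y, hyc, by
    rw [dist_comm]; exact hb.trans_le (min_le_left _ _)⟩)
  refine ⟨φ.symm b, ?_, φ.right_inv hbt⟩
  have := h₂ (hb.trans_le (min_le_right _ _)) hyc
  rwa [Set.mem_ofPred_eq, symm_apply hφ] at this

lemma exists_close (hφ : φ.source = Set.univ) (t : ℝ) {ρ : ℝ} (hρ : 0 < ρ) :
    ∃ σ > 0, ∀ y, ‖y‖ ≤ t → ∀ y', dist y y' < σ → dist (φ y) (φ y') < ρ := by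
  have h := (isCompact_closedBall (0 : Fin n → ℝ) t).uniformContinuousAt_of_continuousAt φ
    (fun a _ => (continuous hφ).continuousAt) (Metric.dist_mem_uniformity hρ)
  obtain ⟨σ, hσ, h⟩ := Metric.mem_uniformity_dist.1 h
  exact ⟨σ, hσ, fun y hy y' hd => h hd (mem_closedBall_zero_iff.2 hy)⟩

lemma norm_le_add {y y' : Fin n → ℝ} {t τ : ℝ} (hy : ‖y‖ ≤ t) (h : dist y y' < τ) :
    ‖y'‖ ≤ t + τ := by
  have := norm_le_norm_add_norm_sub' y' y
  rw [dist_eq_norm] at h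
  rw [norm_sub_rev] at this
  linarith

lemma snapMap_apply (hφ : φ.source = Set.univ) {N : ℕ} {y : Fin n → ℝ} (hy : ‖y‖ ≤ 3) :
    snapMap φ N (φ y) = grid φ N (snapAt N y) := by
  rw [snapMap, if_pos ((mem_cube hφ).2 hy), symm_apply hφ]

lemma exists_dist_snapMap_lt (hφ : φ.source = Set.univ) {ρ : ℝ} (hρ : 0 < ρ) :
    ∃ N₀ : ℕ, ∀ N, N₀ < N → ∀ x, dist (snapMap φ N x) x < ρ := by
  obtain ⟨σ, hσ, h⟩ := exists_close hφ 3 hρ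
  obtain ⟨N₀, hN₀⟩ := exists_nat_gt (2 / σ)
  refine ⟨N₀, fun N hN x => ?_⟩
  have hN0 : 0 < N := by omega
  by_cases hx : x ∈ cube φ 3
  · obtain ⟨y, hy, rfl⟩ := hx
    rw [mem_closedBall_zero_iff] at hy
    rw [snapMap_apply hφ hy, dist_comm]
    refine h y hy _ ?_
    rw [dist_comm]
    refine (dist_pt_snapAt hN0 y).trans_lt ?_
    have hN' : (N₀ : ℝ) < N := by exact_mod_cast hN
    rw [div_lt_iff₀ (by positivity)]
    rw [div_lt_iff₀ hσ] at hN₀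
    nlinarith
  · rw [snapMap, if_neg hx, dist_self]
    exact hρ

lemma exists_snap_cliques [DecidableEq M] (hφ : φ.source = Set.univ) :
    ∃ N₀ : ℕ, ∀ N, N₀ < N → ∃ δ > 0, ∀ s : Finset M, (∀ a ∈ s, ∀ b ∈ s, dist a b < δ) →
      (∃ a ∈ s, snapMap φ N a ∈ cube φ (9 / 4)) →
      ∃ κ, IsClique κ ∧ s.image (snapMap φ N) = κ.image (grid φ N) := by
  obtain ⟨ρ, hρ, hρ'⟩ := exists_symm_close hφ (9 / 4) (τ := 1 / 4) (by norm_num)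
  obtain ⟨N₀, hN₀⟩ := exists_dist_snapMap_lt hφ hρ
  refine ⟨N₀, fun N hN => ?_⟩
  have hN0 : 0 < N := by omega
  have hg : 0 < gap n / N := div_pos gap_pos (by positivity)
  obtain ⟨δ, hδ, hδ'⟩ := exists_symm_close hφ 3 (τ := min (1 / 4) (gap n / N))
    (lt_min (by norm_num) hg)
  refine ⟨δ, hδ, fun s hs ⟨a, ha, haQ⟩ => ?_⟩
  obtain ⟨z, hz, hza⟩ := haQ
  rw [mem_closedBall_zero_iff] at hz
  obtain ⟨y, hy, rfl⟩ := hρ' z hz a (by rw [hza]; exact hN₀ N hN a)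
  have hy' := norm_le_add hz hy
  have hall : ∀ b ∈ s, ∃ y', ‖y'‖ ≤ 3 ∧ φ y' = b := fun b hb => by
    obtain ⟨y', h1, h2⟩ := hδ' y (by linarith) b (hs _ ha b hb)
    have := norm_le_add hy' (h1.trans_le (min_le_left _ _))
    exact ⟨y', by linarith, h2⟩
  refine ⟨s.image fun b => snapAt N (φ.symm b), ?_, ?_⟩
  · intro u hu v hv
    obtain ⟨b, hb, rfl⟩ := Finset.mem_image.1 hu
    obtain ⟨b', hb', rfl⟩ := Finset.mem_image.1 hv
    obtain ⟨y₁, h₁, rfl⟩ := hall b hb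
    obtain ⟨y₂, h₂, h₃⟩ := hδ' y₁ h₁ b' (hs _ hb _ hb')
    rw [← h₃, symm_apply hφ, symm_apply hφ]
    exact adj_snapAt hN0 (h₂.trans_le (min_le_right _ _))
  · rw [Finset.image_image]
    refine Finset.image_congr fun b hb => ?_
    obtain ⟨y₁, h₁, rfl⟩ := hall b hb
    rw [snapMap_apply hφ h₁, Function.comp_apply, symm_apply hφ]

end ManifoldChart

namespace VietorisChain

variable {V W : Type*} [DecidableEq V] [DecidableEq W]

omit [DecidableEq V] in
lemma prism_mem {f g : V → W} {P : Chain V →ₗ[ZMod 2] Chain W}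
    (hP : ∀ s, P (simplex s) ∈ chainsOf (IsPrism f g s)) {p : Finset V → Prop}
    {q : Finset W → Prop} {c : Chain V} (hc : c ∈ chainsOf p)
    (h : ∀ s, p s → ∀ t, IsPrism f g s t → q t) : P c ∈ chainsOf q :=
  map_mem hc P _ fun s hs => chainsOf_mono (h s hs) (hP s)

lemma exists_homotopy_id (f : V → V) (c : Chain V) :
    ∃ P : Chain V →ₗ[ZMod 2] Chain V, c = bd (P c) + (push f c + P (bd c)) ∧
      ∀ s, P (simplex s) ∈ chainsOf (IsPrism id f s) := by
  obtain ⟨P, h, hP⟩ := exists_homotopy id f c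
  refine ⟨P, ?_, hP⟩
  rw [push_id] at h
  rw [add_left_comm, h, add_left_comm, ZModModule.add_self, add_zero]

variable {M : Type*} [MetricSpace M]

/-- All distances between vertices are less than `δ`. -/
def IsSmall (δ : ℝ) (s : Finset M) : Prop := ∀ a ∈ s, ∀ b ∈ s, dist a b < δ

/-- No vertex lies in `A`. -/
def IsAway (A : Set M) (s : Finset M) : Prop := ∀ a ∈ s, a ∉ A

/-- A simplex with `m` vertices of size less than `δ`. -/
def IsCell (m : ℕ) (δ : ℝ) (s : Finset M) : Prop := s.card = m ∧ IsSmall δ s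

lemma IsSmall.mono {δ δ' : ℝ} {s : Finset M} (h : IsSmall δ s) (hd : δ ≤ δ') : IsSmall δ' s :=
  fun a ha b hb => (h a ha b hb).trans_le hd

lemma IsCell.mono {m : ℕ} {δ δ' : ℝ} {s : Finset M} (h : IsCell m δ s) (hd : δ ≤ δ') :
    IsCell m δ' s :=
  ⟨h.1, h.2.mono hd⟩

section

variable [DecidableEq M] {S : M → M} {ρ : ℝ}

lemma IsPrism.exists_near (hS : ∀ x, dist (S x) x < ρ) {s t : Finset M} (h : IsPrism id S s t)
    {b : M} (hb : b ∈ t) : ∃ a ∈ s, dist b a < ρ := by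
  rcases Finset.mem_union.1 (h.2 hb) with hb | hb
  · obtain ⟨a, ha, rfl⟩ := Finset.mem_image.1 hb
    exact ⟨a, ha, by simpa using dist_nonneg.trans_lt (hS a)⟩
  · obtain ⟨a, ha, rfl⟩ := Finset.mem_image.1 hb
    exact ⟨a, ha, hS a⟩

omit [DecidableEq M] in
lemma IsSmall.of_near {s t : Finset M} {δ : ℝ} (hs : IsSmall δ s)
    (h : ∀ b ∈ t, ∃ a ∈ s, dist b a < ρ) : IsSmall (δ + 2 * ρ) t := by
  intro b hb b' hb'
  obtain ⟨a, ha, h1⟩ := h b hb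
  obtain ⟨a', ha', h2⟩ := h b' hb'
  have h3 := dist_triangle4 b a a' b'
  have h4 := hs a ha a' ha'
  rw [dist_comm a' b'] at h3
  linarith

lemma IsSmall.prism (hS : ∀ x, dist (S x) x < ρ) {s t : Finset M} {δ : ℝ} (hs : IsSmall δ s)
    (h : IsPrism id S s t) : IsSmall (δ + 2 * ρ) t :=
  hs.of_near fun _ hb => h.exists_near hS hb

lemma IsSmall.image (hS : ∀ x, dist (S x) x < ρ) {s : Finset M} {δ : ℝ} (hs : IsSmall δ s) :
    IsSmall (δ + 2 * ρ) (s.image S) :=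
  hs.of_near fun b hb => by
    obtain ⟨a, ha, rfl⟩ := Finset.mem_image.1 hb
    exact ⟨a, ha, hS a⟩

end

/-- The chain `c` cannot be pushed away from `x` by small simplices. -/
def IsEssential [DecidableEq M] (η R : ℝ) (c : Chain M) (x : M) : Prop :=
  ∀ e c', e ∈ chainsOf (IsSmall η) → c' ∈ chainsOf (fun s => ∀ a ∈ s, R ≤ dist a x) →
    c ≠ bd e + c'

lemma IsEssential.mono [DecidableEq M] {η η' R R' : ℝ} {c : Chain M} {x : M}
    (h : IsEssential η R c x) (hη : η' ≤ η) (hR : R ≤ R') : IsEssential η' R' c x :=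
  fun e c' he hc' => h e c' (chainsOf_mono (fun _ hs => hs.mono hη) he)
    (chainsOf_mono (fun _ hs a ha => hR.trans (hs a ha)) hc')

end VietorisChain

namespace ManifoldChart

open Kuhn Metric VietorisChain

variable {n : ℕ} {M : Type*} [MetricSpace M] [DecidableEq M]
  {φ : OpenPartialHomeomorph (Fin n → ℝ) M}

lemma exists_normal_form (hn : 0 < n) (hφ : φ.source = Set.univ) {L : Set M} (hL : L ⊆ cube φ 2)
    {r : ℝ} (hr : 0 < r) :
    ∃ R₁ > 0, ∀ η > 0, ∀ ρ > 0, ∃ δ > 0, ∃ 𝒦 : Set (Finset M), ∀ K : Set M,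
      (∀ x ∈ L, ball x r ⊆ K) → ∀ c ∈ chainsOf (IsCell (n + 1) δ), bd c ∈ chainsOf (IsAway K) →
      (∀ x ∈ L, IsEssential η R₁ c x) →
      ∃ e ∈ chainsOf (IsSmall ρ), ∃ C ∈ chainsOf (IsCell (n + 1) ρ),
        ∃ p ∈ chainsOf (fun s => IsCell (n + 1) ρ s ∧ IsAway L s), c = bd e + (C + p) ∧
          (∀ s ∈ 𝒦, C s = 1) ∧ ∀ s, C s ≠ 0 → ¬ IsAway L s → s ∈ 𝒦 := by
  obtain ⟨σ, hσ, hσ'⟩ := exists_close hφ 2 (half_pos hr)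
  set τ : ℝ := min (1 / 4) (σ / 2) with hτdef
  have hτ : 0 < τ := lt_min (by norm_num) (half_pos hσ)
  have hτ4 : τ ≤ 1 / 4 := min_le_left _ _
  have hτσ : τ < σ := (min_le_right _ _).trans_lt (half_lt_self hσ)
  obtain ⟨R₀, hR₀, hR₀'⟩ := exists_symm_close hφ 2 (half_pos hτ)
  set R₁ : ℝ := min R₀ (r / 2) with hR₁def
  have hR₁ : 0 < R₁ := lt_min hR₀ (half_pos hr)
  refine ⟨R₁, hR₁, fun η hη ρ hρ => ?_⟩
  obtain ⟨ρ', hρ', hρr, hρρ, hρη⟩ : ∃ ρ' > 0, ρ' ≤ r / 2 ∧ 3 * ρ' ≤ ρ ∧ 3 * ρ' ≤ η :=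
    ⟨min (r / 2) (min (ρ / 3) (η / 3)), by positivity, min_le_left _ _,
      by linarith [(min_le_right (r / 2) _).trans (min_le_left (ρ / 3) (η / 3))],
      by linarith [(min_le_right (r / 2) _).trans (min_le_right (ρ / 3) (η / 3))]⟩
  obtain ⟨N₁, hN₁⟩ := exists_dist_snapMap_lt hφ hρ'
  obtain ⟨N₂, hN₂⟩ := exists_snap_cliques hφ
  obtain ⟨N₃, hN₃⟩ := exists_nat_gt (2 / τ)
  set N := N₁ + N₂ + N₃ + 1 with hN
  have hN0 : 0 < N := by omega
  have hNτ : 1 / (N : ℝ) ≤ τ / 2 := by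
    have : (N₃ : ℝ) ≤ N := by exact_mod_cast (by omega : N₃ ≤ N)
    rw [div_le_iff₀ (by positivity)]
    rw [div_lt_iff₀ hτ] at hN₃
    nlinarith
  have hS := hN₁ N (by omega)
  obtain ⟨δ₁, hδ₁, hcl⟩ := hN₂ N (by omega)
  set S := snapMap φ N
  set g := grid φ N
  have hg : Function.Injective g := grid_injective hφ hN0
  refine ⟨min δ₁ ρ', lt_min hδ₁ hρ', {s | ∃ t y, IsKuhn t ∧ φ y ∈ L ∧
    (∀ v ∈ t, dist (pt N v) y ≤ τ) ∧ s = t.image g}, fun K hK c hc hbc hess => ?_⟩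
  obtain ⟨P, hPc, hP⟩ := exists_homotopy_id S c
  have hsm : min δ₁ ρ' + 2 * ρ' ≤ 3 * ρ' := by linarith [min_le_right δ₁ ρ']
  have hPs : P c ∈ chainsOf (IsSmall (3 * ρ')) := prism_mem hP hc fun s hs t ht =>
    (hs.2.prism hS ht).mono hsm
  have hbd : bd c ∈ chainsOf (fun s => IsCell n (min δ₁ ρ') s ∧ IsAway K s) := by
    have : bd c ∈ chainsOf (IsCell n (min δ₁ ρ')) := bd_mem hc fun s hs a ha =>
      ⟨by rw [Finset.card_erase_of_mem ha, hs.1]; rfl, fun b hb b' hb' =>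
        hs.2 b (Finset.mem_of_mem_erase hb) b' (Finset.mem_of_mem_erase hb')⟩
    rw [mem_chainsOf_iff] at this hbc ⊢
    exact fun s hs => ⟨this s hs, hbc s hs⟩
  have hfar : ∀ x ∈ L, ∀ a, a ∉ K → r ≤ dist a x := fun x hx a ha => by
    by_contra! hc
    exact ha (hK x hx hc)
  have hp : P (bd c) ∈ chainsOf (fun s => IsCell (n + 1) (3 * ρ') s ∧
      ∀ x ∈ L, ∀ a ∈ s, R₁ ≤ dist a x) := prism_mem hP hbd fun s hs t ht => by
    refine ⟨⟨by rw [ht.1, hs.1.1], (hs.1.2.prism hS ht).mono hsm⟩, fun x hx b hb => ?_⟩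
    obtain ⟨a, ha, hab⟩ := ht.exists_near hS hb
    have h1 := hfar x hx a (hs.2 a ha)
    have h2 := dist_triangle_left a x b
    have h3 : R₁ ≤ r / 2 := min_le_right _ _
    linarith
  set C := push S c
  have hC : C ∈ chainsOf (fun s => IsCell (n + 1) (3 * ρ') s ∧
      ((∃ a ∈ s, a ∈ cube φ (9 / 4)) → ∃ κ, IsClique κ ∧ s = κ.image g)) :=
    push_mem S hc fun s hs hcard => by
      refine ⟨⟨by rw [hcard, hs.1], (hs.2.image hS).mono hsm⟩, fun ⟨b, hb, hbQ⟩ => ?_⟩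
      obtain ⟨a, ha, rfl⟩ := Finset.mem_image.1 hb
      exact hcl s (hs.2.mono (min_le_left _ _)) ⟨a, ha, hbQ⟩
  have hC' := mem_chainsOf_iff.1 hC
  have hnorm : ∀ y, φ y ∈ L → ‖y‖ ≤ 2 := fun y hy => (mem_cube hφ).1 (hL hy)
  have hnear : ∀ y, φ y ∈ L → ∀ s, C s ≠ 0 → ∀ a ∈ s, dist a (φ y) < R₁ →
      ∃ t, IsKuhn t ∧ (∀ v ∈ t, dist (pt N v) y ≤ τ) ∧ s = t.image g := by
    intro y hy s hs a ha hd
    obtain ⟨y', hy', rfl⟩ := hR₀' y (hnorm y hy) a (by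
      rw [dist_comm]; exact hd.trans_le (min_le_left _ _))
    have hQ : φ y' ∈ cube φ (9 / 4) :=
      (mem_cube hφ).2 ((norm_le_add (hnorm y hy) hy').trans (by linarith))
    obtain ⟨κ, hκ, rfl⟩ := (hC' s hs).2 ⟨_, ha, hQ⟩
    have hcard := (hC' _ hs).1.1
    rw [Finset.card_image_of_injective _ hg] at hcard
    refine ⟨κ, ⟨hcard, hκ⟩, fun v hv => ?_, rfl⟩
    obtain ⟨k, hk, hkg⟩ := Finset.mem_image.1 ha
    have : pt N k = y' := injective hφ hkg
    have h1 := (hκ v hv k hk).dist_pt_le (N := N)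
    have h2 := dist_triangle (pt N v) y' y
    rw [this] at h1
    rw [dist_comm y' y] at h2
    linarith
  have hconst : ∀ y, φ y ∈ L → ∀ t t', IsKuhn t → IsKuhn t' → (∀ v ∈ t, dist (pt N v) y ≤ τ) →
      (∀ v ∈ t', dist (pt N v) y ≤ τ) → C (t.image g) = C (t'.image g) := by
    intro y hy t t' ht ht' hty hty'
    obtain ⟨lo, hi, hbox⟩ := exists_box N hN0 y hτ.le
    refine coeff_const hn hg (fun s hs => (hC' s hs).2) (lo := lo) (hi := hi) (fun k h1 h2 => ?_)
      (fun f k h1 h2 hk => ?_) ht ht' (fun v hv => (hbox v).2 (hty v hv))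
      (fun v hv => (hbox v).2 (hty' v hv))
    · have h3 := (hbox k).1 ⟨h1, h2⟩
      have h4 := norm_le_norm_add_norm_sub' (pt N k) y
      rw [← dist_eq_norm] at h4
      exact (mem_cube hφ).2 (by linarith [hnorm y hy])
    · have h3 := (hbox k).1 ⟨h1, h2⟩
      have hSb : bd C ∈ chainsOf (fun s => g k ∉ s) := by
        rw [bd_push]
        refine push_mem S hbd fun s hs _ hks => ?_
        obtain ⟨a, ha, hak⟩ := Finset.mem_image.1 hks
        have h4 := hfar _ hy a (hs.2 a ha)
        have h5 : dist (φ y) (g k) < r / 2 := hσ' y (hnorm y hy) _ (by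
          rw [dist_comm]; exact h3.trans_lt hτσ)
        have h6 := hS a
        rw [hak] at h6
        have h7 := dist_triangle_left a (φ y) (g k)
        rw [dist_comm (g k) (φ y)] at h7
        linarith
      exact apply_eq_zero hSb (by simpa using ⟨k, hk, rfl⟩)
  have hone : ∀ y, φ y ∈ L → ∀ t, IsKuhn t → (∀ v ∈ t, dist (pt N v) y ≤ τ) →
      C (t.image g) = 1 := by
    intro y hy t ht hty
    by_contra h1
    have h0 : C (t.image g) = 0 := by
      revert h1
      generalize C (t.image g) = z
      revert z
      decide
    refine hess _ hy (P c) (C + P (bd c)) (chainsOf_mono (fun s hs => hs.mono hρη) hPs) ?_ hPc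
    refine Submodule.add_mem _ (mem_chainsOf_iff.2 fun s hs a ha => ?_)
      (chainsOf_mono (fun s hs => hs.2 _ hy) hp)
    by_contra! hd
    obtain ⟨t', ht', hty', rfl⟩ := hnear y hy s hs a ha hd
    exact hs ((hconst y hy t' t ht' ht hty' hty).trans h0)
  refine ⟨P c, chainsOf_mono (fun s hs => hs.mono hρρ) hPs, C,
    chainsOf_mono (fun s hs => hs.1.mono hρρ) hC, P (bd c),
    chainsOf_mono (fun s hs => ⟨hs.1.mono hρρ, fun a ha haL => hR₁.not_ge
      (by simpa using hs.2 a haL a ha)⟩) hp, hPc, ?_, ?_⟩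
  · rintro _ ⟨t, y, ht, hy, hty, rfl⟩
    exact hone y hy t ht hty
  · intro s hs hsL
    simp only [IsAway, not_forall, not_not] at hsL
    obtain ⟨a, ha, haL⟩ := hsL
    obtain ⟨y, hy, rfl⟩ := hL haL
    obtain ⟨t, ht, hty, rfl⟩ := hnear y haL s hs _ ha (by rwa [dist_self])
    exact ⟨t, y, ht, haL, hty, rfl⟩

/-- Two chains that are essential along `L` can be made to agree near `L`. -/
theorem exists_glue (hn : 0 < n) (hφ : φ.source = Set.univ) {L : Set M} (hL : L ⊆ cube φ 2)
    {r : ℝ} (hr : 0 < r) :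
    ∃ R₁ > 0, ∀ η > 0, ∀ ρ > 0, ∃ δ > 0, ∀ K K' : Set M, (∀ x ∈ L, ball x r ⊆ K) →
      (∀ x ∈ L, ball x r ⊆ K') → ∀ c ∈ chainsOf (IsCell (n + 1) δ),
      ∀ b ∈ chainsOf (IsCell (n + 1) δ), bd c ∈ chainsOf (IsAway K) →
      bd b ∈ chainsOf (IsAway K') → (∀ x ∈ L, IsEssential η R₁ c x) →
      (∀ x ∈ L, IsEssential η R₁ b x) →
      ∃ e ∈ chainsOf (IsSmall ρ), ∃ d ∈ chainsOf (fun s => IsCell (n + 1) ρ s ∧ IsAway L s),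
        c + b = bd e + d := by
  obtain ⟨R₁, hR₁, h⟩ := exists_normal_form hn hφ hL hr
  refine ⟨R₁, hR₁, fun η hη ρ hρ => ?_⟩
  obtain ⟨δ, hδ, 𝒦, h⟩ := h η hη ρ hρ
  refine ⟨δ, hδ, fun K K' hK hK' c hc b hb hbc hbb hec heb => ?_⟩
  obtain ⟨e₁, he₁, C₁, hC₁, p₁, hp₁, rfl, h1₁, hk₁⟩ := h K hK c hc hbc hec
  obtain ⟨e₂, he₂, C₂, hC₂, p₂, hp₂, rfl, h1₂, hk₂⟩ := h K' hK' b hb hbb heb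
  refine ⟨e₁ + e₂, Submodule.add_mem _ he₁ he₂, (C₁ + C₂) + (p₁ + p₂),
    Submodule.add_mem _ ?_ (Submodule.add_mem _ hp₁ hp₂), by rw [map_add]; abel⟩
  have hcell := mem_chainsOf_iff.1 (Submodule.add_mem _ hC₁ hC₂)
  refine mem_chainsOf_iff.2 fun s hs => ⟨hcell s hs, ?_⟩
  by_contra hsL
  have hsK : s ∈ 𝒦 := by
    by_cases h0 : C₁ s = 0
    · refine hk₂ s (fun h0' => hs ?_) hsL
      rw [Finsupp.add_apply, h0, h0', add_zero]
    · exact hk₁ s h0 hsL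
  refine hs ?_
  rw [Finsupp.add_apply, h1₁ s hsK, h1₂ s hsK]
  rfl

end ManifoldChart

namespace VietorisChain

variable {U V W : Type*} [DecidableEq V] [DecidableEq W]

lemma push_push (f : V → W) (g : U → V) (c : Chain U) : push f (push g c) = push (f ∘ g) c := by
  refine hom_ext (f := push f ∘ₗ push g) (g := push (f ∘ g)) (fun s => ?_) c
  rw [LinearMap.comp_apply, push_simplex, push_simplex, ← Finset.image_image]
  by_cases h : (s.image g).card = s.card
  · rw [if_pos h, push_simplex, h]
  · have h1 : (s.image g).card < s.card := lt_of_le_of_ne Finset.card_image_le h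
    rw [if_neg h, map_zero, if_neg]
    exact ((Finset.card_image_le (f := f)).trans_lt h1).ne

omit [DecidableEq V] in
lemma push_apply_image {f : V → W} (hf : Function.Injective f) (c : Chain V) (s : Finset V) :
    push f c (s.image f) = c s := by
  refine hom_ext (f := Finsupp.lapply (s.image f) ∘ₗ push f) (g := Finsupp.lapply s)
    (fun t => ?_) c
  rw [LinearMap.comp_apply, push_simplex, if_pos (Finset.card_image_of_injective t hf)]
  by_cases h : t = s
  · simp [h]
  · have : t.image f ≠ s.image f := fun h' => h (Finset.image_injective hf h')
    simp [h, this]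

end VietorisChain

namespace Kuhn

open VietorisChain

variable {n : ℕ}

lemma bd_apply_eq_zero_of_isClique {D : Chain (Fin n → ℤ)} {κ : Finset (Fin n → ℤ)}
    (hκ : IsKuhn κ) (hD : D ∈ chainsOf IsClique) : bd D κ = 0 := by
  rw [bd_apply_eq_sum D κ ∅ (by simp), Finset.sum_empty]
  intro s _ hs h0
  have := (mem_chainsOf_iff.1 hD s h0).card_le
  rw [hs, hκ.1] at this
  omega

open Classical in
/-- The sum of all Kuhn simplices in a cubical block. -/
noncomputable def block (B : ℤ) : Chain (Fin n → ℤ) :=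
  ∑ t ∈ (Finset.Icc (fun _ => -B) (fun _ => B)).powerset with IsKuhn t, simplex t

lemma block_mem (B : ℤ) : (block B : Chain (Fin n → ℤ)) ∈
    chainsOf (fun t => IsKuhn t ∧ ∀ k ∈ t, ∀ i, |k i| ≤ B) := by
  classical
  refine Submodule.sum_mem _ fun t ht => simplex_mem_chainsOf ?_
  rw [Finset.mem_filter, Finset.mem_powerset] at ht
  refine ⟨ht.2, fun k hk i => ?_⟩
  have := Finset.mem_Icc.1 (ht.1 hk)
  exact abs_le.2 ⟨this.1 i, this.2 i⟩

lemma block_apply {B : ℤ} {t : Finset (Fin n → ℤ)} (ht : IsKuhn t) (h : ∀ k ∈ t, ∀ i, |k i| ≤ B) :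
    block B t = 1 := by
  have hm : ∀ k ∈ t, k ∈ Finset.Icc (fun _ => -B) (fun _ => B) := fun k hk =>
    Finset.mem_Icc.2 ⟨fun i => (abs_le.1 (h k hk i)).1, fun i => (abs_le.1 (h k hk i)).2⟩
  rw [block, Finsupp.finsetSum_apply, Finset.sum_eq_single t]
  · simp
  · intro s _ hs
    simp [hs]
  · intro h'
    simp only [Finset.mem_filter, Finset.mem_powerset, not_and] at h'
    exact absurd ht (h' hm)

lemma Adj.abs_sub_le {u v : Fin n → ℤ} (h : Adj u v) (i : Fin n) : |u i - v i| ≤ 1 := by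
  rcases h with h | h
  · have h1 := h.1 i
    have h2 := h.2 i
    simp only [Pi.add_apply, Pi.one_apply] at h2
    rw [abs_le]; constructor <;> linarith
  · have h1 := h.1 i
    have h2 := h.2 i
    simp only [Pi.add_apply, Pi.one_apply] at h2
    rw [abs_le]; constructor <;> linarith

lemma bd_block_mem (hn : 0 < n) (B : ℤ) : bd (block B : Chain (Fin n → ℤ)) ∈
    chainsOf (fun f => f.card = n ∧ IsClique f ∧ (∀ k ∈ f, ∀ i, |k i| ≤ B) ∧
      ∀ k ∈ f, ∃ i, B ≤ |k i|) := by
  have h1 : bd (block B : Chain (Fin n → ℤ)) ∈ chainsOf (fun f => f.card = n ∧ IsClique f ∧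
      (∀ k ∈ f, ∀ i, |k i| ≤ B) ∧ ∃ w, w ∉ f ∧ IsKuhn (insert w f) ∧
      ∀ k ∈ insert w f, ∀ i, |k i| ≤ B) :=
    bd_mem (block_mem B) fun s hs a ha => ⟨by rw [Finset.card_erase_of_mem ha, hs.1.1]; rfl,
      hs.1.2.mono (Finset.erase_subset _ _), fun k hk => hs.2 k (Finset.mem_of_mem_erase hk),
      a, Finset.notMem_erase a s, by rw [Finset.insert_erase ha]; exact hs.1, by
        rw [Finset.insert_erase ha]; exact hs.2⟩
  refine mem_chainsOf_iff.2 fun f hf => ?_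
  obtain ⟨hc, hcl, hB, w, hw, hk, hwB⟩ := mem_chainsOf_iff.1 h1 f hf
  refine ⟨hc, hcl, hB, fun k hkf => ?_⟩
  by_contra! hlt
  obtain ⟨w', hw', hne, hk'⟩ := hk.exists_other hn hw
  have hwB' : ∀ v ∈ insert w' f, ∀ i, |v i| ≤ B := fun v hv i => by
    have h2 := (hk'.2 v hv k (Finset.mem_insert_of_mem hkf)).abs_sub_le i
    have h3 := hlt i
    have h4 := abs_sub_abs_le_abs_sub (v i) (k i)
    omega
  have := bd_apply_image hn Function.injective_id (C := block B) (f := f)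
    (fun s hs _ _ => ⟨s, (mem_chainsOf_iff.1 (block_mem B) s hs).1.2, by simp⟩) hne.symm hw hw' hk hk'
  rw [Finset.image_id, Finset.image_id, Finset.image_id, block_apply hk hwB,
    block_apply hk' hwB'] at this
  exact hf (this.trans (by decide))

lemma push_coarsen_block {m : ℕ} (hm : 0 < m) {B : ℤ} {κ : Finset (Fin n → ℤ)} (hκ : IsKuhn κ)
    (hB : ∀ k, coarsen m k ∈ κ → ∀ i, |k i| ≤ B) :
    push (coarsen (m : ℤ)) (block B) κ = 1 := by
  classical
  have hm' : (0 : ℤ) < m := by exact_mod_cast hm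
  obtain ⟨k₀, hk₀, hmin⟩ := hκ.2.exists_min hκ.nonempty
  set t₀ := κ.image (refineAt m k₀)
  have ht₀ : IsKuhn t₀ := isKuhn_image_refineAt hκ k₀
  have hi : t₀.image (coarsen m) = κ := image_coarsen_refineAt hm' hmin
  rw [block, map_sum, Finsupp.finsetSum_apply, Finset.sum_eq_single t₀]
  · rw [push_simplex, hi, if_pos (by rw [hκ.1, ht₀.1])]
    simp
  · intro t ht hne
    rw [push_simplex]
    split_ifs
    · rw [Finsupp.single_eq_of_ne]
      intro h
      exact hne (eq_image_refineAt hm' hκ (Finset.mem_filter.1 ht).2 hk₀ hmin h.symm)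
    · rfl
  · intro h'
    refine absurd ?_ h'
    rw [Finset.mem_filter, Finset.mem_powerset]
    refine ⟨fun k hk => ?_, ht₀⟩
    have := hB k (hi ▸ Finset.mem_image_of_mem _ hk)
    exact Finset.mem_Icc.2 ⟨fun i => (abs_le.1 (this i)).1, fun i => (abs_le.1 (this i)).2⟩

lemma norm_pt_le {N : ℕ} (hN : 0 < N) {k : Fin n → ℤ} {a : ℕ} :
    ‖pt N k‖ ≤ a ↔ ∀ i, |k i| ≤ a * N := by
  have hN' : (0 : ℝ) < N := by positivity
  rw [pi_norm_le_iff_of_nonneg (by positivity)]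
  refine forall_congr' fun i => ?_
  rw [pt, Real.norm_eq_abs, abs_div, Nat.abs_cast, div_le_iff₀ hN']
  exact_mod_cast Iff.rfl

/-- Snapping a fine block to a coarse lattice covers the inner coarse simplices exactly once. -/
lemma push_snapAt_block (hn : 0 < n) {N m : ℕ} (hN : 20 ≤ N) (hm : 0 < m)
    (h : 1 / ((N * m : ℕ) : ℝ) < gap n / N) {κ : Finset (Fin n → ℤ)} (hκ : IsKuhn κ)
    (hκn : ∀ v ∈ κ, ‖pt N v‖ ≤ 9 / 4) :
    push (fun k => snapAt N (pt (N * m) k)) (block (3 * (N * m : ℕ))) κ = 1 := by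
  have hN0 : 0 < N := by omega
  have hm' : (0 : ℤ) < m := by exact_mod_cast hm
  have hNm : 0 < N * m := Nat.mul_pos hN0 hm
  have hNr : 2 / (N : ℝ) ≤ 1 / 10 := by
    have : (20 : ℝ) ≤ N := by exact_mod_cast hN
    rw [div_le_iff₀ (by positivity)]
    linarith
  set f : (Fin n → ℤ) → (Fin n → ℤ) := fun k => snapAt N (pt (N * m) k)
  set B : ℤ := 3 * (N * m : ℕ)
  obtain ⟨P, hP, hPs⟩ := exists_homotopy f (coarsen m) (block B)
  have hdist : ∀ {u v : Fin n → ℤ}, Adj u v → dist (pt (N * m) u) (pt (N * m) v) < gap n / N :=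
    fun huv => huv.dist_pt_le.trans_lt h
  have h1 : P (block B) ∈ chainsOf IsClique := prism_mem hPs (block_mem B) fun s hs t ht => by
    have key : ∀ u ∈ s, ∀ v ∈ s, Adj (f u) (f v) ∧ Adj (coarsen m u) (coarsen m v) ∧
        Adj (f u) (coarsen m v) := fun u hu v hv =>
      have huv := hs.1.2 u hu v hv
      ⟨adj_snapAt hN0 (hdist huv), huv.coarsen hm', adj_snapAt_coarsen hN0 (hdist huv)⟩
    intro a ha b hb
    rcases Finset.mem_union.1 (ht.2 ha) with ha | ha <;>
      rcases Finset.mem_union.1 (ht.2 hb) with hb | hb <;>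
      obtain ⟨u, hu, rfl⟩ := Finset.mem_image.1 ha <;> obtain ⟨v, hv, rfl⟩ := Finset.mem_image.1 hb
    · exact (key u hu v hv).1
    · exact (key u hu v hv).2.2
    · exact (key v hv u hu).2.2.symm
    · exact (key u hu v hv).2.1
  have h2 : P (bd (block B)) ∈ chainsOf (fun t => ∀ v ∈ t, 9 / 4 < ‖pt N v‖) :=
    prism_mem hPs (bd_block_mem hn B) fun s hs t ht v hv => by
      have : ∃ u ∈ s, dist (pt N v) (pt (N * m) u) ≤ 2 / N := by
        rcases Finset.mem_union.1 (ht.2 hv) with hv | hv <;>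
          obtain ⟨u, hu, rfl⟩ := Finset.mem_image.1 hv
        · exact ⟨u, hu, dist_pt_snapAt hN0 _⟩
        · exact ⟨u, hu, dist_pt_coarsen hN0 hm _⟩
      obtain ⟨u, hu, hd⟩ := this
      obtain ⟨i, hi⟩ := hs.2.2.2 u hu
      have h3 : 3 ≤ ‖pt (N * m) u‖ := by
        refine le_trans ?_ (norm_le_pi_norm _ i)
        rw [pt, Real.norm_eq_abs, abs_div, Nat.abs_cast, le_div_iff₀ (by positivity)]
        exact_mod_cast hi
      have h4 := norm_le_norm_add_norm_sub' (pt (N * m) u) (pt N v)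
      rw [norm_sub_rev, ← dist_eq_norm] at h4
      linarith
  have h3 : push (coarsen (m : ℤ)) (block B) κ = 1 := push_coarsen_block hm hκ fun k hk => by
    refine (norm_pt_le (a := 3) hNm).1 ?_
    have h4 := norm_le_norm_add_norm_sub' (pt (N * m) k) (pt N (coarsen m k))
    rw [norm_sub_rev, ← dist_eq_norm] at h4
    have h5 := dist_pt_coarsen (n := n) hN0 hm k
    have h6 := hκn _ hk
    push_cast
    linarith
  have h4 := DFunLike.congr_fun hP κ
  obtain ⟨v, hv⟩ := hκ.nonempty
  rw [Finsupp.add_apply, Finsupp.add_apply, bd_apply_eq_zero_of_isClique hκ h1, h3,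
    apply_eq_zero h2 (fun h' => (h' v hv).not_ge (hκn v hv)), add_zero] at h4
  rw [eq_neg_of_add_eq_zero_left h4.symm, ZModModule.neg_eq_self]

end Kuhn

namespace ManifoldChart

open Kuhn Metric VietorisChain

variable {n : ℕ} {M : Type*} [MetricSpace M] [DecidableEq M]
  {φ : OpenPartialHomeomorph (Fin n → ℝ) M}

/-- There are arbitrarily fine chains that are essential along a cube, with boundary far away. -/
theorem exists_generator (hn : 0 < n) (hφ : φ.source = Set.univ) {R : ℝ} (hR : 0 < R) :
    ∃ η > 0, ∀ δ > 0, ∃ b ∈ chainsOf (IsCell (n + 1) δ),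
      bd b ∈ chainsOf (IsAway (cube φ (5 / 2))) ∧ ∀ x ∈ cube φ 2, IsEssential η R b x := by
  obtain ⟨N₁, hN₁⟩ := exists_dist_snapMap_lt hφ (half_pos hR)
  obtain ⟨N₂, hN₂⟩ := exists_snap_cliques hφ
  obtain ⟨σ, hσ, hσ'⟩ := exists_close hφ 2 (half_pos hR)
  obtain ⟨N₃, hN₃⟩ := exists_nat_gt (2 / σ)
  set N := N₁ + N₂ + N₃ + 20 with hN
  have hN0 : 0 < N := by omega
  have hN20 : 20 ≤ N := by omega
  have hNr : 2 / (N : ℝ) ≤ 1 / 10 := by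
    have : (20 : ℝ) ≤ N := by exact_mod_cast hN20
    rw [div_le_iff₀ (by positivity)]
    linarith
  have hNσ : 2 / (N : ℝ) < σ := by
    have : (N₃ : ℝ) ≤ N := by exact_mod_cast (by omega : N₃ ≤ N)
    rw [div_lt_iff₀ (by positivity)]
    rw [div_lt_iff₀ hσ] at hN₃
    nlinarith
  have hS := hN₁ N (by omega)
  obtain ⟨η, hη, hcl⟩ := hN₂ N (by omega)
  set S := snapMap φ N
  set g := grid φ N
  have hg : Function.Injective g := grid_injective hφ hN0
  refine ⟨η, hη, fun δ hδ => ?_⟩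
  obtain ⟨ε, hε, hε'⟩ := exists_close hφ 3 hδ
  have hgN : 0 < gap n / N := div_pos gap_pos (by positivity)
  obtain ⟨m₁, hm₁⟩ := exists_nat_gt (1 / min ε (gap n / N))
  set m := m₁ + 1 with hm
  have hm0 : 0 < m := by omega
  have hNm : 0 < N * m := Nat.mul_pos hN0 hm0
  have hmesh : 1 / ((N * m : ℕ) : ℝ) < min ε (gap n / N) := by
    have h0 : 0 < min ε (gap n / N) := lt_min hε hgN
    have h1 : (m₁ : ℝ) ≤ (N * m : ℕ) := by
      exact_mod_cast (by nlinarith : m₁ ≤ N * m)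
    rw [div_lt_iff₀ (by positivity)]
    rw [div_lt_iff₀ h0] at hm₁
    nlinarith
  set B : ℤ := 3 * (N * m : ℕ) with hB
  have hnorm : ∀ k : Fin n → ℤ, (∀ i, |k i| ≤ B) → ‖pt (N * m) k‖ ≤ 3 := fun k hk => by
    have := (norm_pt_le (a := 3) hNm).2 hk
    exact_mod_cast this
  have hgm : Function.Injective (grid φ (N * m)) := grid_injective hφ hNm
  refine ⟨push (grid φ (N * m)) (block B), push_mem _ (block_mem B) fun s hs hc => ?_, ?_,
    fun x hx e c' he hc' heq => ?_⟩
  · refine ⟨by rw [hc, hs.1.1], fun a ha b hb => ?_⟩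
    obtain ⟨u, hu, rfl⟩ := Finset.mem_image.1 ha
    obtain ⟨v, hv, rfl⟩ := Finset.mem_image.1 hb
    exact hε' _ (hnorm u (hs.2 u hu)) _ ((hs.1.2 u hu v hv).dist_pt_le.trans_lt
      (hmesh.trans_le (min_le_left _ _)))
  · rw [bd_push]
    refine push_mem _ (bd_block_mem hn B) fun s hs _ a ha haQ => ?_
    obtain ⟨u, hu, rfl⟩ := Finset.mem_image.1 ha
    obtain ⟨i, hi⟩ := hs.2.2.2 u hu
    have h3 : 3 ≤ ‖pt (N * m) u‖ := by
      refine le_trans ?_ (norm_le_pi_norm _ i)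
      rw [pt, Real.norm_eq_abs, abs_div, Nat.abs_cast, le_div_iff₀ (by positivity)]
      exact_mod_cast hi
    have h4 := (mem_cube hφ).1 haQ
    linarith
  · obtain ⟨y, hy, rfl⟩ := hx
    rw [mem_closedBall_zero_iff] at hy
    set κ := path (fun i => ⌊N * y i⌋) (List.finRange n)
    have hκ : IsKuhn κ := isKuhn_path (List.Perm.refl _)
    have hκy : ∀ v ∈ κ, dist (pt N v) y ≤ 2 / N := fun v hv => dist_pt_of_floor hN0 fun i => by
      have h1 := (bounds_of_mem_path hv).1 i
      have h2 := (bounds_of_mem_path hv).2 i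
      rw [disp_of_perm (List.Perm.refl _)] at h2
      simp only [Pi.add_apply, Pi.one_apply] at h1 h2
      have h3 := Int.floor_le (N * y i)
      have h4 := Int.lt_floor_add_one (N * y i)
      have h5 : (⌊N * y i⌋ : ℝ) ≤ v i := by exact_mod_cast h1
      have h6 : (v i : ℝ) ≤ ⌊N * y i⌋ + 1 := by exact_mod_cast h2
      rw [abs_le]
      constructor <;> linarith
    have hκn : ∀ v ∈ κ, ‖pt N v‖ ≤ 9 / 4 := fun v hv => by
      have h4 := norm_le_norm_add_norm_sub' (pt N v) y
      rw [← dist_eq_norm] at h4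
      linarith [hκy v hv]
    have hκx : ∀ v ∈ κ, dist (φ y) (g v) < R / 2 := fun v hv => hσ' y hy _ (by
      rw [dist_comm]
      exact (hκy v hv).trans_lt hNσ)
    obtain ⟨v₀, hv₀⟩ := hκ.nonempty
    have h1 : push S (push (grid φ (N * m)) (block B)) (κ.image g) = 1 := by
      have : push S (push (grid φ (N * m)) (block B)) =
          push g (push (fun k => snapAt N (pt (N * m) k)) (block B)) := by
        rw [push_push, push_push]
        exact push_congr (block_mem B) fun s hs k hk =>
          snapMap_apply hφ (hnorm k (hs.2 k hk))
      rw [this, push_apply_image hg]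
      exact push_snapAt_block hn hN20 hm0 (hmesh.trans_le (min_le_right _ _)) hκ hκn
    have h2 : push S c' (κ.image g) = 0 := by
      refine apply_eq_zero (p := fun s => ∀ a ∈ s, R / 2 < dist a (φ y))
        (push_mem S hc' fun s hs _ b hb => ?_) fun h => ?_
      · obtain ⟨a, ha, rfl⟩ := Finset.mem_image.1 hb
        have h3 := hs a ha
        have h4 := dist_triangle_left a (φ y) (S a)
        linarith [hS a]
      · have := h _ (Finset.mem_image_of_mem g hv₀)
        rw [dist_comm] at this
        exact this.not_gt (hκx v₀ hv₀)
    have h3 : bd (push S e) (κ.image g) = 0 := by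
      have hD : push S e ∈ chainsOf (fun s => (∃ a ∈ s, a ∈ cube φ (9 / 4)) →
          ∃ κ, IsClique κ ∧ s = κ.image g) := push_mem S he fun s hs _ ⟨b, hb, hbQ⟩ => by
        obtain ⟨a, ha, rfl⟩ := Finset.mem_image.1 hb
        exact hcl s hs ⟨a, ha, hbQ⟩
      rw [bd_apply_eq_sum _ _ ∅ (by simp), Finset.sum_empty]
      intro s hs hcard h0
      obtain ⟨κ', hκ', rfl⟩ := mem_chainsOf_iff.1 hD s h0 ⟨g v₀,
        hs (Finset.mem_image_of_mem g hv₀), (mem_cube hφ).2 (hκn v₀ hv₀)⟩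
      rw [Finset.card_image_of_injective _ hg, Finset.card_image_of_injective _ hg, hκ.1] at hcard
      have := hκ'.card_le
      omega
    rw [heq, map_add, ← bd_push, Finsupp.add_apply, h2, h3] at h1
    exact absurd h1 (by decide)

end ManifoldChart

namespace VietorisChain

section

variable {V : Type*} {p : Finset V → Prop} {c : Chain V}

lemma exists_add_of_mem (hc : c ∈ chainsOf p) (q : Finset V → Prop) :
    ∃ c₁ ∈ chainsOf (fun s => p s ∧ q s), ∃ c₂ ∈ chainsOf (fun s => p s ∧ ¬ q s), c = c₁ + c₂ := by
  classical
  rw [mem_chainsOf_iff] at hc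
  refine ⟨c.filter q, mem_chainsOf_iff.2 fun s hs => ?_, c.filter (fun s => ¬ q s),
    mem_chainsOf_iff.2 fun s hs => ?_, (Finsupp.filter_add_filter_not c q).symm⟩ <;>
  · rw [← Finsupp.mem_support_iff, Finsupp.support_filter, Finset.mem_filter,
      Finsupp.mem_support_iff] at hs
    exact ⟨hc s hs.1, hs.2⟩

lemma IsAway.mono {A A' : Set V} {s : Finset V} (h : IsAway A s) (hA : A' ⊆ A) : IsAway A' s :=
  fun a ha haA => h a ha (hA haA)

lemma bd_isAway [DecidableEq V] {A : Set V} (hc : c ∈ chainsOf (IsAway A)) :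
    bd c ∈ chainsOf (IsAway A) :=
  bd_mem hc fun _ hs _ _ b hb => hs b (Finset.mem_of_mem_erase hb)

end

variable {M : Type*} [MetricSpace M] [DecidableEq M]

lemma IsEssential.add {η R : ℝ} {c e d : Chain M} {x : M} (h : IsEssential η R c x)
    (he : e ∈ chainsOf (IsSmall η)) (hd : d ∈ chainsOf (IsAway (Metric.ball x R))) :
    IsEssential η R (c + bd e + d) x := by
  intro e' c' he' hc' heq
  refine h (e' + e) (c' + d) (Submodule.add_mem _ he' he) (Submodule.add_mem _ hc'
    (chainsOf_mono (fun s hs a ha => not_lt.1 (hs a ha)) hd)) ?_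
  rw [map_add, add_add_add_comm, ← heq, add_assoc c, add_assoc c, ZModModule.add_self, add_zero]

end VietorisChain

namespace ManifoldChart

open Kuhn Metric VietorisChain

variable {n : ℕ} {M : Type*} [MetricSpace M]

lemma cube_mono (φ : OpenPartialHomeomorph (Fin n → ℝ) M) {t t' : ℝ} (h : t ≤ t') :
    cube φ t ⊆ cube φ t' := Set.image_mono (closedBall_subset_closedBall h)

lemma exists_ball_subset_cube {φ : OpenPartialHomeomorph (Fin n → ℝ) M}
    (hφ : φ.source = Set.univ) {t t' : ℝ} (h : t < t') :
    ∃ r > 0, ∀ x ∈ cube φ t, ball x r ⊆ cube φ t' := by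
  obtain ⟨r, hr, hr'⟩ := exists_symm_close hφ t (sub_pos.2 h)
  refine ⟨r, hr, ?_⟩
  rintro _ ⟨y, hy, rfl⟩ b hb
  rw [mem_closedBall_zero_iff] at hy
  obtain ⟨y', hy', rfl⟩ := hr' y hy b (by rwa [dist_comm])
  exact (mem_cube hφ).2 ((norm_le_add hy hy').trans (by linarith))

lemma exists_ball_subset_cubes {ι : Type*} {φ : ι → OpenPartialHomeomorph (Fin n → ℝ) M}
    (hφ : ∀ i, (φ i).source = Set.univ) (I : Finset ι) {t t' : ℝ} (h : t < t') :
    ∃ r > 0, ∀ i ∈ I, ∀ x ∈ cube (φ i) t, ball x r ⊆ cube (φ i) t' := by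
  choose r hr hr' using fun i => exists_ball_subset_cube (hφ i) h
  rcases I.eq_empty_or_nonempty with rfl | hI
  · exact ⟨1, one_pos, by simp⟩
  · refine ⟨I.inf' hI r, (Finset.lt_inf'_iff hI).2 fun i _ => hr i, fun i hi x hx => ?_⟩
    exact (ball_subset_ball (Finset.inf'_le r hi)).trans (hr' i x hx)

variable [DecidableEq M]

/-- Arbitrarily fine relative fundamental chains on a finite union of cubes. -/
theorem exists_fundamental {ι : Type*} {φ : ι → OpenPartialHomeomorph (Fin n → ℝ) M}
    (hn : 0 < n) (hφ : ∀ i, (φ i).source = Set.univ) (I : Finset ι) :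
    ∀ t < 2, ∀ R > 0, ∃ η > 0, ∀ δ > 0, ∃ c ∈ chainsOf (IsCell (n + 1) δ),
      bd c ∈ chainsOf (IsAway (⋃ i ∈ I, cube (φ i) t)) ∧
      ∀ i ∈ I, ∀ x, ball x R ⊆ cube (φ i) t → IsEssential η R c x := by
  classical
  induction I using Finset.induction_on with
  | empty => exact fun t _ R _ => ⟨1, one_pos, fun δ _ => ⟨0, Submodule.zero_mem _, by simp⟩⟩
  | insert j I _ ih =>
    intro t' ht' R hR
    set t : ℝ := (t' + 2) / 2 with ht
    have htt : t' < t := by linarith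
    have ht2 : t < 2 := by linarith
    obtain ⟨ra, hra, hra'⟩ := exists_ball_subset_cubes hφ I htt
    obtain ⟨rb, hrb, hrb'⟩ := exists_ball_subset_cube (hφ j) (show (2 : ℝ) < 5 / 2 by norm_num)
    obtain ⟨r, hr, hr1, hr2⟩ : ∃ r > 0, r ≤ ra / 2 ∧ r ≤ rb :=
      ⟨min (ra / 2) rb, by positivity, min_le_left _ _, min_le_right _ _⟩
    set K := ⋃ i ∈ I, cube (φ i) t with hK
    set K' := ⋃ i ∈ I, cube (φ i) t' with hK'
    have hKK : K' ⊆ K := Set.iUnion₂_mono fun i _ => cube_mono _ htt.le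
    set L : Set M := {z | z ∈ cube (φ j) t' ∧ ∃ x ∈ K', dist z x < r} with hLdef
    have hL : L ⊆ cube (φ j) 2 := fun z hz => cube_mono _ ht'.le hz.1
    have hLI : ∀ z ∈ L, ∃ i ∈ I, ball z r ⊆ cube (φ i) t := by
      rintro z ⟨-, x, hx, hzx⟩
      obtain ⟨i, hi, hxi⟩ := Set.mem_iUnion₂.1 hx
      exact ⟨i, hi, (ball_subset_ball' (by linarith)).trans (hra' i hi x hxi)⟩
    have hLK : ∀ z ∈ L, ball z r ⊆ K := fun z hz => by
      obtain ⟨i, hi, h⟩ := hLI z hz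
      exact h.trans (Set.subset_iUnion₂_of_subset i hi subset_rfl)
    have hLj : ∀ z ∈ L, ball z r ⊆ cube (φ j) (5 / 2) := fun z hz =>
      (ball_subset_ball hr2).trans (hrb' z (hL hz))
    obtain ⟨R₁, hR₁, hglue⟩ := exists_glue hn (hφ j) hL hr
    obtain ⟨R₂, hR₂, h21, h2R, h2r⟩ : ∃ R₂ > 0, R₂ ≤ R₁ ∧ R₂ ≤ R ∧ R₂ ≤ r :=
      ⟨min R₁ (min R r), lt_min hR₁ (lt_min hR hr), min_le_left _ _,
        (min_le_right _ _).trans (min_le_left _ _), (min_le_right _ _).trans (min_le_right _ _)⟩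
    obtain ⟨ηc, hηc, hc⟩ := ih t ht2 R₂ hR₂
    obtain ⟨ηb, hηb, hb⟩ := exists_generator hn (hφ j) hR₂
    obtain ⟨η, hη, h1, h2⟩ : ∃ η > 0, η ≤ ηc ∧ η ≤ ηb :=
      ⟨min ηc ηb, lt_min hηc hηb, min_le_left _ _, min_le_right _ _⟩
    refine ⟨η, hη, fun δ hδ => ?_⟩
    obtain ⟨ρ, hρ, hρδ, hρr, hρη⟩ : ∃ ρ > 0, ρ ≤ δ ∧ ρ ≤ r ∧ ρ ≤ η :=
      ⟨min δ (min r η), lt_min hδ (lt_min hr hη), min_le_left _ _,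
        (min_le_right _ _).trans (min_le_left _ _), (min_le_right _ _).trans (min_le_right _ _)⟩
    obtain ⟨δg, hδg, hglue⟩ := hglue η hη ρ hρ
    obtain ⟨c, hcc, hcb, hce⟩ := hc (min δg δ) (lt_min hδg hδ)
    obtain ⟨b, hbc, hbb, hbe⟩ := hb δg hδg
    obtain ⟨e, he, d, hd, hcd⟩ := hglue K (cube (φ j) (5 / 2)) hLK hLj c
      (chainsOf_mono (fun s hs => hs.mono (min_le_left _ _)) hcc) b hbc hcb hbb
      (fun x hx => by
        obtain ⟨i, hi, h⟩ := hLI x hx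
        exact (hce i hi x ((ball_subset_ball h2r).trans h)).mono h1 h21)
      (fun x hx => (hbe x (hL hx)).mono h2 h21)
    obtain ⟨d₁, hd₁, d₂, hd₂, rfl⟩ := exists_add_of_mem hd (IsAway K')
    have hd₂' : d₂ ∈ chainsOf (IsAway (cube (φ j) t')) := chainsOf_mono (fun s hs a ha haj => by
      obtain ⟨⟨hs1, hs2⟩, hs3⟩ := hs
      simp only [IsAway, not_forall, not_not] at hs3
      obtain ⟨x, hx, hxK⟩ := hs3
      exact hs2 a ha ⟨haj, x, hxK, (hs1.2 a ha x hx).trans_le hρr⟩) hd₂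
    have hd₁' : d₁ ∈ chainsOf (IsAway K') := chainsOf_mono (fun s hs => hs.2) hd₁
    have hnew : c + d₁ = b + bd e + d₂ := by
      have h3 : c = (bd e + (d₁ + d₂)) + b := by
        rw [← hcd, add_assoc, ZModModule.add_self, add_zero]
      have h4 : c + d₁ = (b + bd e + d₂) + (d₁ + d₁) := by
        nth_rewrite 1 [h3]
        abel
      rw [h4, ZModModule.add_self, add_zero]
    refine ⟨c + d₁, Submodule.add_mem _ (chainsOf_mono (fun s hs => hs.mono (min_le_right _ _)) hcc)
      (chainsOf_mono (fun s hs => hs.1.1.mono hρδ) hd₁), ?_, fun i hi x hx => ?_⟩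
    · have h5 : bd (c + d₁) ∈ chainsOf (IsAway K') := by
        rw [map_add]
        exact Submodule.add_mem _ (chainsOf_mono (fun s hs => hs.mono hKK) hcb) (bd_isAway hd₁')
      have h6 : bd (c + d₁) ∈ chainsOf (IsAway (cube (φ j) t')) := by
        rw [hnew, map_add, map_add, bd_bd, add_zero]
        exact Submodule.add_mem _ (chainsOf_mono (fun s hs => hs.mono
          (cube_mono _ (by linarith))) hbb) (bd_isAway hd₂')
      rw [mem_chainsOf_iff] at h5 h6 ⊢
      intro s hs a ha haU
      rw [Finset.set_biUnion_insert] at haU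
      exact haU.elim (h6 s hs a ha) (h5 s hs a ha)
    · refine IsEssential.mono (η := η) (R := R₂) ?_ le_rfl h2R
      have hxR : ball x R₂ ⊆ cube (φ i) t' := (ball_subset_ball h2R).trans hx
      rcases Finset.mem_insert.1 hi with rfl | hi
      · rw [hnew]
        refine ((hbe x (cube_mono _ ht'.le (hxR (mem_ball_self hR₂)))).mono h2 le_rfl).add
          (chainsOf_mono (fun s hs => hs.mono hρη) he) (chainsOf_mono (fun s hs => hs.mono hxR) hd₂')
      · have := ((hce i hi x (hxR.trans (cube_mono _ htt.le))).mono h1 le_rfl).add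
          (Submodule.zero_mem _) (chainsOf_mono (fun s hs => hs.mono
            (hxR.trans (Set.subset_iUnion₂_of_subset i hi subset_rfl))) hd₁')
        rwa [map_zero, add_zero] at this

end ManifoldChart

namespace VietorisChain

open scoped unitInterval

variable {M : Type*} [MetricSpace M] [CompactSpace M] [ContractibleSpace M] [DecidableEq M]

/-- In a compact contractible space, sufficiently fine cycles bound fine chains. -/
theorem exists_eq_bd {n : ℕ} (hn : 0 < n) {η : ℝ} (hη : 0 < η) :
    ∃ δ > 0, ∀ c ∈ chainsOf (IsCell (n + 1) δ : Finset M → Prop), bd c = 0 →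
      ∃ e ∈ chainsOf (IsSmall η), c = bd e := by
  obtain ⟨p, ⟨H⟩⟩ := id_nullhomotopic M
  obtain ⟨δ, hδ, hH⟩ := Metric.uniformContinuous_iff.1
    (CompactSpace.uniformContinuous_of_continuous H.continuous) η hη
  obtain ⟨J, hJ⟩ := exists_nat_gt (1 / δ)
  have hJ0 : (0 : ℝ) < J := (one_div_pos.2 hδ).trans hJ
  have hJ0' : J ≠ 0 := by exact_mod_cast hJ0.ne'
  have hJδ : 1 / (J : ℝ) < δ := by
    rw [div_lt_iff₀ hJ0]
    rwa [div_lt_iff₀ hδ, mul_comm] at hJ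
  let τ : ℕ → I := fun k => Set.projIcc 0 1 zero_le_one (k / J : ℝ)
  have hτ : ∀ k, dist (τ k) (τ (k + 1)) < δ := fun k => by
    refine lt_of_le_of_lt ?_ hJδ
    have := (LipschitzWith.projIcc (zero_le_one (α := ℝ))).dist_le_mul (k / J) ((k + 1 : ℕ) / J)
    refine this.trans ?_
    rw [NNReal.coe_one, one_mul, Real.dist_eq, ← sub_div, abs_div, Nat.abs_cast]
    simp
  refine ⟨δ, hδ, fun c hc hbd => ?_⟩
  have key : ∀ k, ∃ e ∈ chainsOf (IsSmall η), c = bd e + push (fun x => H (τ k, x)) c := by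
    intro k
    induction k with
    | zero =>
      refine ⟨0, Submodule.zero_mem _, ?_⟩
      have : (fun x => H (τ 0, x)) = id := by
        funext x
        simp [τ]
      rw [this, push_id, map_zero, zero_add]
    | succ k ih =>
      obtain ⟨e, he, hce⟩ := ih
      obtain ⟨P, hP, hPs⟩ := exists_homotopy (fun x => H (τ k, x)) (fun x => H (τ (k + 1), x)) c
      refine ⟨e + P c, Submodule.add_mem _ he (prism_mem hPs hc fun s hs t ht a ha b hb => ?_), ?_⟩
      · have : ∀ a ∈ t, ∃ k', (k' = k ∨ k' = k + 1) ∧ ∃ u ∈ s, H (τ k', u) = a := fun a ha => by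
          rcases Finset.mem_union.1 (ht.2 ha) with h | h <;>
            obtain ⟨u, hu, rfl⟩ := Finset.mem_image.1 h
          · exact ⟨k, Or.inl rfl, u, hu, rfl⟩
          · exact ⟨k + 1, Or.inr rfl, u, hu, rfl⟩
        obtain ⟨k₁, hk₁, u, hu, rfl⟩ := this a ha
        obtain ⟨k₂, hk₂, v, hv, rfl⟩ := this b hb
        refine hH (max_lt ?_ (hs.2 u hu v hv))
        rcases hk₁ with rfl | rfl <;> rcases hk₂ with rfl | rfl
        · simpa using hδ
        · exact hτ _
        · rw [dist_comm]
          exact hτ _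
        · simpa using hδ
      · rw [hbd, map_zero, add_zero] at hP
        rw [map_add, hP, add_assoc, add_assoc, ZModModule.add_self, add_zero]
        exact hce
  obtain ⟨e, he, hce⟩ := key J
  refine ⟨e, he, ?_⟩
  rwa [push_of_collapse hc fun s hs h => ?_, add_zero] at hce
  have h1 : τ J = 1 := by
    simp only [τ]
    rw [div_self hJ0.ne', Set.projIcc_right]
    rfl
  have h2 : s.image (fun x => H (τ J, x)) ⊆ {p} := fun a ha => by
    obtain ⟨u, _, rfl⟩ := Finset.mem_image.1 ha
    simp [h1]
  have h3 := Finset.card_le_card h2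
  rw [h, hs.1, Finset.card_singleton] at h3
  omega

end VietorisChain

namespace ManifoldChart

open Metric VietorisChain

variable {n : ℕ} {M : Type*}

lemma exists_parametrization [TopologicalSpace M] [ChartedSpace (EuclideanSpace ℝ (Fin n)) M]
    (x : M) : ∃ φ : OpenPartialHomeomorph (Fin n → ℝ) M, φ.source = Set.univ ∧ φ 0 = x := by
  set e := chartAt (EuclideanSpace ℝ (Fin n)) x
  obtain ⟨r, hr, hr'⟩ := Metric.isOpen_iff.1 e.open_target (e x) (mem_chart_target _ x)
  let h : (Fin n → ℝ) ≃ₜ EuclideanSpace ℝ (Fin n) :=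
    (EuclideanSpace.equiv (Fin n) ℝ).symm.toHomeomorph
  have hb : ∀ y, OpenPartialHomeomorph.univBall (e x) r y ∈ ball (e x) r := fun y => by
    rw [← OpenPartialHomeomorph.univBall_target (e x) hr]
    exact OpenPartialHomeomorph.map_source _ (by simp)
  refine ⟨h.toOpenPartialHomeomorph.trans
    ((OpenPartialHomeomorph.univBall (e x) r).trans e.symm), ?_, ?_⟩
  · refine Set.eq_univ_of_forall fun y => ?_
    simp only [OpenPartialHomeomorph.trans_source]
    simpa using hr' (hb _)
  · have : h 0 = 0 := map_zero (EuclideanSpace.equiv (Fin n) ℝ).symm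
    simp [this, e]

theorem dim_eq_zero [MetricSpace M] [CompactSpace M] [Nonempty M] [ContractibleSpace M]
    [ChartedSpace (EuclideanSpace ℝ (Fin n)) M] : n = 0 := by
  classical
  by_contra h0
  have hn : 0 < n := Nat.pos_of_ne_zero h0
  choose φ hφ hφ0 using exists_parametrization (n := n) (M := M)
  have hnhds : ∀ x, cube (φ x) 1 ∈ nhds x := fun x => by
    have := (φ x).image_mem_nhds (x := 0) (by simp [hφ]) (closedBall_mem_nhds _ one_pos)
    rwa [hφ0] at this
  obtain ⟨I, hI⟩ := finite_cover_nhds hnhds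
  obtain ⟨x₀⟩ := ‹Nonempty M›
  obtain ⟨i, hi, hx⟩ := Set.mem_iUnion₂.1 (hI ▸ Set.mem_univ x₀ : x₀ ∈ ⋃ x ∈ I, cube (φ x) 1)
  obtain ⟨R, hR, hR'⟩ := Metric.mem_nhds_iff.1 (hnhds i)
  obtain ⟨η, hη, h⟩ := exists_fundamental hn hφ I 1 (by norm_num) R hR
  obtain ⟨δ, hδ, hδ'⟩ := exists_eq_bd (M := M) hn hη
  obtain ⟨c, hc, hbd, hess⟩ := h δ hδ
  have hbd0 : bd c = 0 := by
    have h1 : bd c ∈ chainsOf (fun s : Finset M => s.card = n) := bd_mem hc fun s hs a ha => by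
      rw [Finset.card_erase_of_mem ha, hs.1]
      rfl
    ext s
    by_contra hs
    obtain ⟨a, ha⟩ := Finset.card_pos.1 (hn.trans_eq (mem_chainsOf_iff.1 h1 s hs).symm)
    exact mem_chainsOf_iff.1 hbd s hs a ha (hI ▸ Set.mem_univ a)
  obtain ⟨e, he, hce⟩ := hδ' c hc hbd0
  exact hess i hi i hR' e 0 he (Submodule.zero_mem _) (by rw [hce, add_zero])

end ManifoldChart

/-- A nonempty compact contractible topological `n`-manifold
(Hausdorff, second countable, locally Euclidean of dimension `n`, modeled by
charts on `ℝⁿ`) consists of a single point; in particular `n = 0`. -/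
theorem compact_contractible_manifold_subsingleton {n : ℕ} {M : Type*}
    [TopologicalSpace M] [T2Space M] [SecondCountableTopology M]
    [ChartedSpace (EuclideanSpace ℝ (Fin n)) M]
    [CompactSpace M] [Nonempty M] [ContractibleSpace M] :
    Subsingleton M ∧ n = 0 := by
  let _ : MetricSpace M := TopologicalSpace.metrizableSpaceMetric M
  obtain rfl : n = 0 := ManifoldChart.dim_eq_zero (M := M)
  have := ChartedSpace.discreteTopology (EuclideanSpace ℝ (Fin 0)) M
  exact ⟨subsingleton_of_preconnected_totallyDisconnected, rfl⟩
end

section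
/- Let (V,⟨·,·⟩) be a 2-dimensional real vector space equipped with a nondegenerate symmetric bilinear form, and let A : V → V be a nonzero traceless self-adjoint linear endomorphism. Then the set of linear isometries of (V,⟨·,·⟩) commuting with A is finite, of cardinality at most four; in particular, A is generic. -/
/-- A traceless nonzero endomorphism of a plane has a cyclic vector. -/
theorem exists_linearIndependent_apply_of_trace_eq_zero {K V : Type*} [Field K] [CharZero K]
    [AddCommGroup V] [Module K V] [FiniteDimensional K V] (hdim : Module.finrank K V = 2)
    {A : V →ₗ[K] V} (hA0 : A ≠ 0) (htr : LinearMap.trace K V A = 0) :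
    ∃ v, LinearIndependent K ![v, A v] := by
  by_contra! h
  obtain ⟨c, hc⟩ := LinearMap.exists_eq_smul_id_of_forall_notLinearIndependent h
  rw [hc, map_smul, LinearMap.trace_one, hdim] at htr
  have : c = 0 := by simpa using htr
  exact hA0 (by rw [hc, this, zero_smul])

/-- A traceless nonzero endomorphism of a plane squares to a scalar, and its commutant consists
of the affine polynomials in it. -/
theorem sq_eq_smul_and_commutant_of_trace_eq_zero {K V : Type*} [Field K] [CharZero K]
    [AddCommGroup V] [Module K V] [FiniteDimensional K V] (hdim : Module.finrank K V = 2)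
    {A : V →ₗ[K] V} (hA0 : A ≠ 0) (htr : LinearMap.trace K V A = 0) :
    (∃ d : K, ∀ u, A (A u) = d • u) ∧
      ∀ C : V →ₗ[K] V, C ∘ₗ A = A ∘ₗ C → ∃ x y : K, C = x • LinearMap.id + y • A := by
  obtain ⟨v, hv⟩ := exists_linearIndependent_apply_of_trace_eq_zero hdim hA0 htr
  let b := basisOfLinearIndependentOfCardEqFinrank hv (by simp [hdim])
  have hb0 : b 0 = v := by simp [b]
  have hb1 : b 1 = A v := by simp [b]
  have expand (w : V) : w = b.repr w 0 • v + b.repr w 1 • A v := by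
    have h := b.sum_repr w
    rw [Fin.sum_univ_two, hb0, hb1] at h
    exact h.symm
  have hr : b.repr (A v) 0 = 0 := by
    rw [← hb1, b.repr_self, Finsupp.single_eq_of_ne (by decide)]
  have ht : b.repr (A (A v)) 1 = 0 := by
    rw [LinearMap.trace_eq_matrix_trace K b, Matrix.trace_fin_two, LinearMap.toMatrix_apply,
      LinearMap.toMatrix_apply, hb0, hb1, hr, zero_add] at htr
    exact htr
  have hsq := expand (A (A v))
  rw [ht, zero_smul, add_zero] at hsq
  refine ⟨⟨b.repr (A (A v)) 0, fun u => ?_⟩, fun C hC => ?_⟩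
  · generalize b.repr (A (A v)) 0 = d at hsq
    rw [expand u]
    simp only [map_add, map_smul, hsq]
    module
  · refine ⟨b.repr (C v) 0, b.repr (C v) 1, b.ext fun i => ?_⟩
    have hv := expand (C v)
    generalize b.repr (C v) 0 = x at hv
    generalize b.repr (C v) 1 = y at hv
    have hCA : C (A v) = A (C v) := LinearMap.congr_fun hC v
    fin_cases i
    · simpa [hb0] using hv
    · simp [hb1, hCA, hv]

/-- A self-adjoint linear isometry of a nondegenerate bilinear form is an involution. -/
theorem apply_apply_eq_self_of_isometry_of_selfAdjoint {K V : Type*} [Field K]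
    [AddCommGroup V] [Module K V] {B : V →ₗ[K] V →ₗ[K] K}
    (hnd : ∀ u : V, (∀ v : V, B u v = 0) → u = 0) {C : V →ₗ[K] V}
    (hC : ∀ u v : V, B (C u) (C v) = B u v) (hsa : ∀ u v : V, B (C u) v = B u (C v)) (u : V) :
    C (C u) = u := by
  refine sub_eq_zero.1 (hnd _ fun v => ?_)
  rw [map_sub, LinearMap.sub_apply, hsa, hC, sub_self]


/-- On a 2-dimensional pseudo-Euclidean vector space `(V,⟨·,·⟩)`,
every nonzero traceless self-adjoint endomorphism `A` admits only finitely many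
commuting linear isometries — at most four of them. In particular `A` is
generic. -/
theorem generic_dim_two {V : Type*} [AddCommGroup V] [Module ℝ V]
    [FiniteDimensional ℝ V] (hdim : Module.finrank ℝ V = 2)
    (B : V →ₗ[ℝ] V →ₗ[ℝ] ℝ)
    (hsymm : ∀ u v : V, B u v = B v u)
    (hnd : ∀ u : V, (∀ v : V, B u v = 0) → u = 0)
    (A : V →ₗ[ℝ] V) (hA0 : A ≠ 0)
    (htr : LinearMap.trace ℝ V A = 0)
    (hsa : ∀ u v : V, B (A u) v = B u (A v)) :
    {C : V →ₗ[ℝ] V | Function.Bijective C ∧ (∀ u v : V, B (C u) (C v) = B u v) ∧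
      C ∘ₗ A = A ∘ₗ C}.Finite ∧
    {C : V →ₗ[ℝ] V | Function.Bijective C ∧ (∀ u v : V, B (C u) (C v) = B u v) ∧
      C ∘ₗ A = A ∘ₗ C}.ncard ≤ 4 := by
  obtain ⟨⟨d, hd⟩, hcomm⟩ := sq_eq_smul_and_commutant_of_trace_eq_zero hdim hA0 htr
  obtain ⟨w, hw⟩ := exists_linearIndependent_apply_of_trace_eq_zero hdim hA0 htr
  have hsub : {C : V →ₗ[ℝ] V | Function.Bijective C ∧ (∀ u v : V, B (C u) (C v) = B u v) ∧
      C ∘ₗ A = A ∘ₗ C} ⊆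
      {LinearMap.id, -LinearMap.id, (√d)⁻¹ • A, -((√d)⁻¹ • A)} := by
    rintro C ⟨-, hiso, hCA⟩
    obtain ⟨x, y, rfl⟩ := hcomm C hCA
    have hinv := apply_apply_eq_self_of_isometry_of_selfAdjoint hnd hiso
      (fun u v => by simp [hsa]) w
    have hrel : (x ^ 2 + d * y ^ 2 - 1) • w + (2 * x * y) • A w = 0 := by
      rw [← sub_eq_zero] at hinv
      rw [← hinv]
      simp only [LinearMap.add_apply, LinearMap.smul_apply, LinearMap.id_apply, map_add, map_smul,
        hd]
      module
    obtain ⟨h1, h2⟩ := LinearIndependent.pair_iff.1 hw _ _ hrel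
    simp only [Set.mem_insert_iff, Set.mem_singleton_iff]
    rcases eq_or_ne y 0 with rfl | hy
    · have hx : x ^ 2 = 1 := by linarith
      rcases sq_eq_sq_iff_eq_or_eq_neg.1 (hx.trans (one_pow 2).symm) with rfl | rfl <;> simp
    · obtain rfl : x = 0 := by simpa [hy] using h2
      have hdy : d * y ^ 2 = 1 := by linarith
      have hd0 : 0 < d := by
        by_contra! hneg
        nlinarith [sq_nonneg y]
      have hy2 : y ^ 2 = (√d)⁻¹ ^ 2 := by
        rw [inv_pow, Real.sq_sqrt hd0.le]
        exact eq_inv_of_mul_eq_one_right hdy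
      rcases sq_eq_sq_iff_eq_or_eq_neg.1 hy2 with rfl | rfl <;> simp
  have hfin : ({LinearMap.id, -LinearMap.id, (√d)⁻¹ • A, -((√d)⁻¹ • A)} :
      Set (V →ₗ[ℝ] V)).Finite := Set.toFinite _
  refine ⟨hfin.subset hsub, (Set.ncard_le_ncard hsub hfin).trans ?_⟩
  refine (Set.ncard_insert_le _ _).trans (Nat.succ_le_succ ?_)
  refine (Set.ncard_insert_le _ _).trans (Nat.succ_le_succ ?_)
  exact (Set.ncard_insert_le _ _).trans_eq (by rw [Set.ncard_singleton])
end

section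
/- Let (V,⟨·,·⟩) be a finite-dimensional real vector space equipped with a nondegenerate symmetric bilinear form, and let A : V → V be a traceless self-adjoint linear endomorphism. If the group G_A of all linear isometries of (V,⟨·,·⟩) commuting with A is countable, then G_A is finite. -/
/-- A commutative Artinian ring has only finitely many idempotents. -/
theorem finite_setOf_isIdempotentElem (R : Type*) [CommRing R] [IsArtinianRing R] :
    {e : R | IsIdempotentElem e}.Finite :=
  have : Finite (TopologicalSpace.Clopens (PrimeSpectrum R)) :=
    Finite.of_injective (fun U ↦ (U : Set (PrimeSpectrum R))) SetLike.coe_injective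
  Finite.of_equiv _ PrimeSpectrum.isIdempotentElemEquivClopens.toEquiv.symm

/-- A commutative subalgebra of a finite-dimensional algebra contains only finitely many
elements squaring to one, in characteristic different from two. -/
theorem Subalgebra.finite_setOf_mul_self_eq_one {K E : Type*} [Field K] [NeZero (2 : K)]
    [Ring E] [Algebra K E] [FiniteDimensional K E] (S : Subalgebra K E)
    (hS : ∀ x ∈ S, ∀ y ∈ S, x * y = y * x) :
    {x : E | x ∈ S ∧ x * x = 1}.Finite := by
  let : CommRing S :=
    { (inferInstance : Ring S) with mul_comm := fun x y ↦ Subtype.ext (hS x x.2 y y.2) }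
  have : IsArtinianRing S := IsArtinianRing.of_finite K S
  have h2 : (2 : K) ≠ 0 := two_ne_zero
  refine ((finite_setOf_isIdempotentElem S).image
    fun e : S ↦ (2 : K) • (e : E) - 1).subset ?_
  rintro x ⟨hxS, hx⟩
  refine ⟨⟨(2 : K)⁻¹ • (x + 1), S.smul_mem (S.add_mem hxS S.one_mem) _⟩, ?_, ?_⟩
  · refine Subtype.ext ?_
    change ((2 : K)⁻¹ • (x + 1)) * ((2 : K)⁻¹ • (x + 1)) = (2 : K)⁻¹ • (x + 1)
    have : (x + 1) * (x + 1) = (2 : K) • (x + 1) := by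
      rw [two_smul, add_mul, mul_add, hx]
      noncomm_ring
    rw [smul_mul_smul_comm, this, smul_smul]
    congr 1
    field_simp
  · simp [smul_smul, h2]

section Isometry

variable {V : Type*} [AddCommGroup V] [Module ℝ V] [FiniteDimensional ℝ V]

/-- If only countably many isometries of a bilinear form commute with `A`, then every
skew-adjoint endomorphism commuting with `A` vanishes: otherwise its Cayley transforms would be
uncountably many such isometries. -/
theorem eq_zero_of_skewAdjoint_of_countable_isometries (B : V →ₗ[ℝ] V →ₗ[ℝ] ℝ)
    (A : V →ₗ[ℝ] V)
    (hcount : {C : V →ₗ[ℝ] V | Function.Bijective C ∧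
      (∀ u v : V, B (C u) (C v) = B u v) ∧ C ∘ₗ A = A ∘ₗ C}.Countable)
    (X : Module.End ℝ V) (hX : ∀ u v, B (X u) v = -B u (X v)) (hXA : Commute X A) : X = 0 := by
  by_contra hX0
  let a : ℝ → Module.End ℝ V := algebraMap ℝ (Module.End ℝ V)
  let T : Set ℝ := {s | IsUnit (a s - X) ∧ IsUnit (a s + X)}
  have hT : Tᶜ.Finite := by
    refine ((Module.End.finite_spectrum X).union (Module.End.finite_spectrum (-X))).subset ?_
    intro s hs
    by_contra h
    rw [Set.mem_union, not_or, spectrum.notMem_iff, spectrum.notMem_iff, sub_neg_eq_add] at h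
    exact hs h
  let c : ℝ → Module.End ℝ V := fun s ↦ (a s + X) * Ring.inverse (a s - X)
  have hc : ∀ s ∈ T, c s * (a s - X) = a s + X := fun s hs ↦ by
    rw [mul_assoc, Ring.inverse_mul_cancel _ hs.1, mul_one]
  have hTc : T.Countable := by
    refine Set.MapsTo.countable_of_injOn (f := c) (t := _) ?_ ?_ hcount
    · intro s hs
      have haA : Commute (a s) A := Algebra.commutes s A
      refine ⟨(Module.End.isUnit_iff _).1 (hs.2.mul hs.1.ringInverse), fun u v ↦ ?_, ?_⟩
      · obtain ⟨w, rfl⟩ := ((Module.End.isUnit_iff _).1 hs.1).2 u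
        obtain ⟨z, rfl⟩ := ((Module.End.isUnit_iff _).1 hs.1).2 v
        rw [← Module.End.mul_apply, ← Module.End.mul_apply (c s), hc s hs]
        simp [a, Module.algebraMap_end_apply, hX]
        ring
      · refine (haA.add_left hXA).mul_left (?_ : Commute (Ring.inverse (a s - X)) A)
        have hu := haA.sub_left hXA
        obtain ⟨u, h⟩ := hs.1
        rw [← h] at hu ⊢
        rw [Ring.inverse_unit]
        exact hu.units_inv_left
    · intro s hs t ht hst
      by_contra hne
      have h1 := hc s hs
      have h2 := hc t ht
      rw [← hst] at h2
      have h3 : (s - t) • (c s - 1) = 0 := by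
        have : c s * (a s - a t) = a s - a t := by
          calc c s * (a s - a t) = c s * (a s - X) - c s * (a t - X) := by noncomm_ring
            _ = a s - a t := by rw [h1, h2]; abel
        have h4 : a s - a t = (s - t) • (1 : Module.End ℝ V) := by
          simp [a, Algebra.algebraMap_eq_smul_one, sub_smul]
        rw [h4, mul_smul_comm, mul_one] at this
        rw [smul_sub, this, sub_self]
      have h5 : c s = 1 := sub_eq_zero.1 ((smul_eq_zero.1 h3).resolve_left (sub_ne_zero.2 hne))
      rw [h5, one_mul, sub_eq_add_neg, add_right_inj] at h1
      have h6 : (2 : ℝ) • X = 0 := by rw [two_smul, ← neg_eq_iff_add_eq_zero, h1]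
      exact hX0 ((smul_eq_zero.1 h6).resolve_left two_ne_zero)
  refine Set.not_countable_univ (α := ℝ) ?_
  rw [← Set.union_compl_self T]
  exact hTc.union hT.countable

end Isometry

/-- On a pseudo-Euclidean vector space `(V,⟨·,·⟩)`, if the group
`G_A` of linear isometries commuting with a traceless self-adjoint endomorphism
`A` is countable, then it is finite. -/
theorem countable_isometry_group_finite {V : Type*} [AddCommGroup V] [Module ℝ V]
    [FiniteDimensional ℝ V]
    (B : V →ₗ[ℝ] V →ₗ[ℝ] ℝ)
    (hsymm : ∀ u v : V, B u v = B v u)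
    (hnd : ∀ u : V, (∀ v : V, B u v = 0) → u = 0)
    (A : V →ₗ[ℝ] V)
    (htr : LinearMap.trace ℝ V A = 0)
    (hsa : ∀ u v : V, B (A u) v = B u (A v))
    (hcount : {C : V →ₗ[ℝ] V | Function.Bijective C ∧
      (∀ u v : V, B (C u) (C v) = B u v) ∧ C ∘ₗ A = A ∘ₗ C}.Countable) :
    {C : V →ₗ[ℝ] V | Function.Bijective C ∧
      (∀ u v : V, B (C u) (C v) = B u v) ∧ C ∘ₗ A = A ∘ₗ C}.Finite := by
  have hB : LinearMap.BilinForm.Nondegenerate B := by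
    refine ⟨hnd, fun u hu ↦ hnd u fun v ↦ ?_⟩
    rw [hsymm]
    exact hu v
  have hinj : ∀ u v, (∀ w, B u w = B v w) → u = v := fun u v h ↦
    sub_eq_zero.1 (hnd _ fun w ↦ by rw [map_sub, LinearMap.sub_apply, h, sub_self])
  have hskew := eq_zero_of_skewAdjoint_of_countable_isometries B A hcount
  have hself : ∀ X : Module.End ℝ V, Commute X A → ∀ u v, B (X u) v = B u (X v) := by
    intro X hXA
    obtain ⟨Y, hY⟩ : ∃ Y : Module.End ℝ V, ∀ u v, B (Y u) v = B u (X v) :=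
      ⟨LinearMap.BilinForm.leftAdjointOfNondegenerate B hB X,
        LinearMap.BilinForm.isAdjointPairLeftAdjointOfNondegenerate B hB X⟩
    have hYA : Commute Y A := LinearMap.ext fun u ↦ hinj _ _ fun v ↦ by
      have := congrArg (B u) (LinearMap.congr_fun hXA v)
      simp only [Module.End.mul_apply] at this ⊢
      rw [hY, hsa, hsa, hY, this]
    have hXY : X - Y = 0 := by
      refine hskew _ (fun u v ↦ ?_) (hXA.sub_left hYA)
      have h1 := hY u v
      have h2 := hY v u
      rw [hsymm, hsymm v] at h2
      simp only [LinearMap.sub_apply, map_sub]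
      linarith
    intro u v
    rw [← hY, sub_eq_zero.1 hXY]
  have hcomm : ∀ X ∈ Subalgebra.centralizer ℝ {A}, ∀ Y ∈ Subalgebra.centralizer ℝ {A},
      X * Y = Y * X := by
    intro X hX Y hY
    have hXA : Commute X A := (Subalgebra.mem_centralizer_iff ℝ |>.1 hX A rfl).symm
    have hYA : Commute Y A := (Subalgebra.mem_centralizer_iff ℝ |>.1 hY A rfl).symm
    refine LinearMap.ext fun u ↦ hinj _ _ fun v ↦ ?_
    rw [hself _ (hXA.mul_left hYA), Module.End.mul_apply, Module.End.mul_apply, hself Y hYA,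
      hself X hXA]
  refine (Subalgebra.finite_setOf_mul_self_eq_one _ hcomm).subset ?_
  rintro C ⟨-, hC, hCA⟩
  refine ⟨(Subalgebra.mem_centralizer_iff ℝ).2 ?_, ?_⟩
  · rintro _ rfl
    exact hCA.symm
  · refine LinearMap.ext fun u ↦ hinj _ _ fun v ↦ ?_
    rw [Module.End.mul_apply, hself C hCA, hC, Module.End.one_apply]
end

section
/- Let (V,⟨·,·⟩) be a finite-dimensional real vector space equipped with a nondegenerate symmetric bilinear form, and let 𝒜 denote the real vector space of all traceless self-adjoint linear endomorphisms of V, endowed with its natural topology as a finite-dimensional real vector space. Then the set of generic endomorphisms, i.e., of those A ∈ 𝒜 such that only finitely many linear isometries of (V,⟨·,·⟩) commute with A, is an open and dense subset of 𝒜. -/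
open Module

/-- The space `𝒜` of traceless endomorphisms of `V` which are self-adjoint
relative to the nondegenerate symmetric bilinear form `B`, realized inside the
(finite-dimensional, hence topologically natural) space of continuous linear
endomorphisms of `V`. -/
def TracelessSelfAdjoint {V : Type*} [NormedAddCommGroup V] [NormedSpace ℝ V]
    (B : V →ₗ[ℝ] V →ₗ[ℝ] ℝ) : Set (V →L[ℝ] V) :=
  {A : V →L[ℝ] V | LinearMap.trace ℝ V (A : V →ₗ[ℝ] V) = 0 ∧
    ∀ u v : V, B (A u) v = B u (A v)}

/-- `A` is *generic* when only finitely many linear isometries of `(V, B)`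
commute with it. -/
def IsGenericEndo {V : Type*} [NormedAddCommGroup V] [NormedSpace ℝ V]
    (B : V →ₗ[ℝ] V →ₗ[ℝ] ℝ) (A : V →L[ℝ] V) : Prop :=
  {C : V →ₗ[ℝ] V | Function.Bijective C ∧ (∀ u v : V, B (C u) (C v) = B u v) ∧
    C ∘ₗ (A : V →ₗ[ℝ] V) = (A : V →ₗ[ℝ] V) ∘ₗ C}.Finite

section Genericity

variable {V : Type*} [AddCommGroup V] [Module ℝ V]

/-- No nonzero skew-adjoint endomorphism commutes with `A`: there are no infinitesimal isometries
commuting with `A`. -/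
def IsInfinitesimallyRigid (B : V →ₗ[ℝ] V →ₗ[ℝ] ℝ) (A : Module.End ℝ V) : Prop :=
  ∀ S : Module.End ℝ V, (∀ u v, B (S u) v = -B u (S v)) → S * A = A * S → S = 0

/-- A finite-dimensional commutative real algebra contains only
finitely many square roots of one. -/
theorem finite_setOf_mul_self_eq_one (R : Type*) [CommRing R] [Algebra ℝ R]
    [FiniteDimensional ℝ R] : {c : R | c * c = 1}.Finite := by
  have : IsArtinianRing R := IsArtinianRing.of_finite ℝ R
  have hfin : Finite (TopologicalSpace.Clopens (PrimeSpectrum R)) :=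
    Finite.of_injective (fun s => (s : Set (PrimeSpectrum R))) SetLike.coe_injective
  have hidem : {e : R | IsIdempotentElem e}.Finite :=
    Set.finite_coe_iff.mp
      (Finite.of_equiv _ (PrimeSpectrum.isIdempotentElemEquivClopens (R := R)).symm.toEquiv)
  refine (hidem.image fun e => (2 : ℝ) • e - 1).subset ?_
  intro c hc
  refine ⟨(1 / 2 : ℝ) • (1 + c), ?_, ?_⟩
  · have hc' : c * c = 1 := hc
    have h : (1 + c) * (1 + c) = (2 : ℝ) • (1 + c) := by
      rw [two_smul]
      linear_combination hc'
    change _ * _ = _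
    rw [smul_mul_smul_comm, h, smul_smul]
    norm_num
  · simp [smul_smul]

/-- If `A` commutes with no nonzero infinitesimal isometry, the centralizer of `A` consists
of self-adjoint endomorphisms. -/
theorem IsInfinitesimallyRigid.selfAdjoint_of_commute [FiniteDimensional ℝ V]
    {B : V →ₗ[ℝ] V →ₗ[ℝ] ℝ} (hsymm : ∀ u v, B u v = B v u)
    (hnd : ∀ u, (∀ v, B u v = 0) → u = 0) {A : Module.End ℝ V}
    (hA : ∀ u v, B (A u) v = B u (A v)) (hrigid : IsInfinitesimallyRigid B A)
    {X : Module.End ℝ V} (hX : X * A = A * X) (u v : V) : B (X u) v = B u (X v) := by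
  have hB : LinearMap.BilinForm.Nondegenerate B :=
    ⟨hnd, fun v hv => hnd v fun u => (hsymm v u).trans (hv u)⟩
  set Y : Module.End ℝ V := LinearMap.BilinForm.leftAdjointOfNondegenerate B hB X
  have hY : ∀ u v, B (Y u) v = B u (X v) :=
    LinearMap.BilinForm.isAdjointPairLeftAdjointOfNondegenerate B hB X
  have hY' : ∀ u v, B u (Y v) = B (X u) v := fun u v => by
    rw [hsymm, hY, hsymm]
  have hX' : ∀ w, X (A w) = A (X w) := fun w => LinearMap.congr_fun hX w
  have h := hrigid (X - Y) (fun u v => by simp [hY, hY']) (by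
    ext w
    refine sub_eq_zero.mp (hnd _ fun z => ?_)
    simp [hY, hA, hX'])
  rw [← hY, sub_eq_zero.mp h]

/-- The isometries commuting with an infinitesimally rigid self-adjoint endomorphism are finite in
number. -/
theorem IsInfinitesimallyRigid.finite_isometries [FiniteDimensional ℝ V]
    {B : V →ₗ[ℝ] V →ₗ[ℝ] ℝ} (hsymm : ∀ u v, B u v = B v u)
    (hnd : ∀ u, (∀ v, B u v = 0) → u = 0) {A : Module.End ℝ V}
    (hA : ∀ u v, B (A u) v = B u (A v)) (hrigid : IsInfinitesimallyRigid B A) :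
    {C : Module.End ℝ V | (∀ u v, B (C u) (C v) = B u v) ∧ C * A = A * C}.Finite := by
  let Z : Subalgebra ℝ (Module.End ℝ V) := Subalgebra.centralizer ℝ {A}
  have hZ : ∀ X : Module.End ℝ V, X ∈ Z ↔ X * A = A * X := fun X => by
    simp [Z, Subalgebra.mem_centralizer_iff, eq_comm]
  have hself : ∀ X ∈ Z, ∀ u v, B (X u) v = B u (X v) := fun X hX =>
    hrigid.selfAdjoint_of_commute hsymm hnd hA ((hZ X).mp hX)
  have hcomm : ∀ X Y : Z, X * Y = Y * X := by
    rintro ⟨X, hX⟩ ⟨Y, hY⟩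
    ext w
    refine sub_eq_zero.mp (hnd _ fun z => ?_)
    have h₁ := hself _ (Z.mul_mem hX hY) w z
    simp only [Module.End.mul_apply] at h₁
    simp [h₁, hself X hX, hself Y hY]
  let : CommRing Z := { (inferInstance : Ring Z) with mul_comm := hcomm }
  refine ((finite_setOf_mul_self_eq_one Z).image Subtype.val).subset ?_
  rintro C ⟨hC, hCA⟩
  have hCZ := (hZ C).mpr hCA
  refine ⟨⟨C, hCZ⟩, ?_, rfl⟩
  refine Subtype.ext (LinearMap.ext fun w => sub_eq_zero.mp (hnd _ fun z => ?_))
  have h := hself C hCZ (C w) z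
  simp [h, hC]

/-- The Cayley transform of a nonzero skew-adjoint endomorphism commuting with `A` produces
infinitely many isometries commuting with `A`. -/
theorem isInfinitesimallyRigid_of_finite_isometries [FiniteDimensional ℝ V]
    {B : V →ₗ[ℝ] V →ₗ[ℝ] ℝ} {A : Module.End ℝ V}
    (hfin : {C : Module.End ℝ V | (∀ u v, B (C u) (C v) = B u v) ∧ C * A = A * C}.Finite) :
    IsInfinitesimallyRigid B A := by
  intro S hS hSA
  by_contra hS0
  let good : Set ℝ := {μ | ¬S.HasEigenvalue μ} ∩ {0}ᶜ
  have hgood : good.Infinite := by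
    have : goodᶜ.Finite := by
      refine (S.finite_hasEigenvalue.union (Set.finite_singleton (0 : ℝ))).subset ?_
      intro μ hμ
      exact or_iff_not_imp_left.mpr fun h => not_not.mp fun h0 => hμ ⟨h, h0⟩
    exact this.infinite_compl.mono (by simp)
  have hinv : ∀ μ ∈ good, ∃ T : Module.End ℝ V,
      T * (algebraMap ℝ _ μ - S) = 1 ∧ (algebraMap ℝ _ μ - S) * T = 1 := by
    rintro μ ⟨hμ, -⟩
    have hμ' : μ ∉ spectrum ℝ S := fun h => hμ (Module.End.hasEigenvalue_iff_mem_spectrum.mpr h)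
    obtain ⟨U, hU⟩ := spectrum.notMem_iff.mp hμ'
    exact ⟨↑U⁻¹, by rw [← hU, Units.inv_mul], by rw [← hU, Units.mul_inv]⟩
  choose! T hTl hTr using hinv
  let cayley : ℝ → Module.End ℝ V := fun μ => (algebraMap ℝ _ μ + S) * T μ
  refine hgood.not_finite (Set.Finite.of_finite_image (f := cayley) (hfin.subset ?_) ?_)
  · rintro _ ⟨μ, hμ, rfl⟩
    have hTA : T μ * A = A * T μ := by
      have hcomm : Commute (algebraMap ℝ (Module.End ℝ V) μ - S) A :=
        (Algebra.commute_algebraMap_left μ A).sub_left hSA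
      calc T μ * A = T μ * (A * ((algebraMap ℝ _ μ - S) * T μ)) := by rw [hTr μ hμ, mul_one]
        _ = T μ * ((algebraMap ℝ _ μ - S) * A) * T μ := by rw [hcomm.eq]; noncomm_ring
        _ = A * T μ := by rw [← mul_assoc, hTl μ hμ, one_mul]
    refine ⟨fun u v => ?_, ?_⟩
    · have hTw : ∀ w, μ • T μ w - S (T μ w) = w := fun w => by
        simpa [Module.algebraMap_end_apply] using LinearMap.congr_fun (hTr μ hμ) w
      conv_rhs => rw [← hTw u, ← hTw v]
      simp [cayley, Module.algebraMap_end_apply, hS]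
      ring
    · have hcomm : Commute (algebraMap ℝ (Module.End ℝ V) μ + S) A :=
        (Algebra.commute_algebraMap_left μ A).add_left hSA
      exact hcomm.mul_left hTA
  · intro μ hμ ν hν h
    have hfactor : ∀ μ ∈ good, cayley μ = (2 * μ) • T μ - 1 := fun μ hμ => by
      rw [← hTr μ hμ]
      simp only [cayley, Algebra.algebraMap_eq_smul_one, add_mul, sub_mul, smul_mul_assoc,
        one_mul, two_mul, add_smul]
      abel
    have hμ0 : μ ≠ 0 := hμ.2
    have hν0 : ν ≠ 0 := hν.2
    have hT : μ • T μ = ν • T ν := by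
      have h' : cayley μ = cayley ν := h
      rw [hfactor μ hμ, hfactor ν hν, sub_left_inj, mul_smul, mul_smul] at h'
      exact smul_right_injective _ two_ne_zero h'
    have hmul : μ • (algebraMap ℝ (Module.End ℝ V) ν - S) =
        ν • (algebraMap ℝ (Module.End ℝ V) μ - S) := by
      calc μ • (algebraMap ℝ (Module.End ℝ V) ν - S)
          = (algebraMap ℝ _ μ - S) * (μ • T μ) * (algebraMap ℝ _ ν - S) := by
            rw [mul_smul_comm, hTr μ hμ, smul_mul_assoc, one_mul]
        _ = ν • (algebraMap ℝ (Module.End ℝ V) μ - S) := by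
            rw [hT, mul_assoc, smul_mul_assoc, hTl ν hν, mul_smul_comm, mul_one]
    have hdiff : (μ - ν) • S = 0 := by
      simp only [Algebra.algebraMap_eq_smul_one, smul_sub, smul_smul, mul_comm ν μ] at hmul
      rw [sub_smul, sub_right_inj.mp hmul, sub_self]
    exact sub_eq_zero.mp ((smul_eq_zero.mp hdiff).resolve_right hS0)

/-- There is an infinitesimally rigid traceless self-adjoint endomorphism: a diagonal one with distinct
entries in an orthogonal basis. -/
theorem exists_traceless_selfAdjoint_isInfinitesimallyRigid [FiniteDimensional ℝ V]
    {B : V →ₗ[ℝ] V →ₗ[ℝ] ℝ} (hsymm : ∀ u v, B u v = B v u)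
    (hnd : ∀ u, (∀ v, B u v = 0) → u = 0) :
    ∃ A : Module.End ℝ V, LinearMap.trace ℝ V A = 0 ∧ (∀ u v, B (A u) v = B u (A v)) ∧
      IsInfinitesimallyRigid B A := by
  obtain ⟨b, hb⟩ := LinearMap.BilinForm.exists_orthogonal_basis (B := B) ⟨hsymm⟩
  have hb0 := hb.not_isOrtho_basis_self_of_separatingLeft hnd
  have horth : ∀ i j, i ≠ j → B (b i) (b j) = 0 := fun i j hij => hb hij
  let d : Fin (finrank ℝ V) → ℝ := fun i =>
    (i : ℝ) - (∑ j : Fin (finrank ℝ V), (j : ℝ)) / finrank ℝ V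
  have hd : Function.Injective d := fun i j h => by
    simpa [d, Fin.ext_iff] using h
  have hdsum : ∑ i, d i = 0 := by
    rcases Nat.eq_zero_or_pos (finrank ℝ V) with h | h
    · have : IsEmpty (Fin (finrank ℝ V)) := by rw [h]; infer_instance
      simp
    · have : (finrank ℝ V : ℝ) ≠ 0 := by positivity
      simp only [d, Finset.sum_sub_distrib, Finset.sum_const, Finset.card_univ, Fintype.card_fin,
        nsmul_eq_mul]
      field_simp
      ring
  let A : Module.End ℝ V := Matrix.toLin b b (Matrix.diagonal d)
  have hAb : ∀ i, A (b i) = d i • b i := fun i => by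
    simp [A, Matrix.toLin_self, Matrix.diagonal_apply, ite_smul]
  refine ⟨A, ?_, ?_, ?_⟩
  · rw [LinearMap.trace_eq_matrix_trace ℝ b, LinearMap.toMatrix_toLin, Matrix.trace_diagonal, hdsum]
  · have h : B ∘ₗ A = B.compl₂ A := by
      refine b.ext fun i => b.ext fun j => ?_
      rcases eq_or_ne i j with rfl | hij
      · simp [hAb]
      · simp [hAb, horth i j hij]
    exact fun u v => LinearMap.congr_fun₂ h u v
  · intro S hS hSA
    have hcoord : ∀ i j, j ≠ i → b.repr (S (b i)) j = 0 := fun i j hij => by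
      have hrepr : ∀ w, b.repr (A w) j = d j * b.repr w j := by
        have h : b.coord j ∘ₗ A = d j • b.coord j := b.ext fun k => by
          rcases eq_or_ne k j with rfl | hkj <;> simp_all
        exact fun w => LinearMap.congr_fun h w
      have h := congrArg (fun w => b.repr w j) (LinearMap.congr_fun hSA (b i))
      simp only [Module.End.mul_apply, hAb, map_smul, hrepr, Finsupp.smul_apply,
        smul_eq_mul] at h
      have h' : (d i - d j) * b.repr (S (b i)) j = 0 := by linear_combination h
      exact (mul_eq_zero.mp h').resolve_left (sub_ne_zero.mpr fun e => hij (hd e).symm)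
    refine b.ext fun i => ?_
    have hSb : S (b i) = b.repr (S (b i)) i • b i := by
      conv_lhs => rw [← b.sum_repr (S (b i))]
      exact Finset.sum_eq_single i (fun j _ hj => by rw [hcoord i j hj, zero_smul]) (by simp)
    have h := hS (b i) (b i)
    rw [hSb] at h
    simp only [map_smul, LinearMap.smul_apply, smul_eq_mul] at h
    have h' : b.repr (S (b i)) i * B (b i) (b i) = 0 := by linarith
    rw [hSb, (mul_eq_zero.mp h').resolve_right (hb0 i), zero_smul, LinearMap.zero_apply]

end Genericity

section Topology

variable {V : Type*} [NormedAddCommGroup V] [NormedSpace ℝ V]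

/-- The continuous endomorphisms which are skew-adjoint relative to `B`. -/
def skewAdjointCLM (B : V →ₗ[ℝ] V →ₗ[ℝ] ℝ) : Submodule ℝ (V →L[ℝ] V) where
  carrier := {S | ∀ u v, B (S u) v = -B u (S v)}
  add_mem' hS hT u v := by simp [hS u v, hT u v, add_comm]
  zero_mem' u v := by simp
  smul_mem' c S hS u v := by simp [hS u v]

/-- The commutator `S ↦ S * A - A * S` on skew-adjoint endomorphisms, as a continuous linear map
depending linearly and continuously on `A`. -/
noncomputable def skewCommutator (B : V →ₗ[ℝ] V →ₗ[ℝ] ℝ) :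
    (V →L[ℝ] V) →L[ℝ] skewAdjointCLM B →L[ℝ] V →L[ℝ] V :=
  (ContinuousLinearMap.precomp (V →L[ℝ] V) (skewAdjointCLM B).subtypeL).comp
    ((ContinuousLinearMap.mul ℝ (V →L[ℝ] V)).flip - ContinuousLinearMap.mul ℝ (V →L[ℝ] V))

theorem skewCommutator_apply (B : V →ₗ[ℝ] V →ₗ[ℝ] ℝ) (A : V →L[ℝ] V) (S : skewAdjointCLM B) :
    skewCommutator B A S = (S : V →L[ℝ] V) * A - A * S := rfl

variable [FiniteDimensional ℝ V]

theorem isInfinitesimallyRigid_iff_injective (B : V →ₗ[ℝ] V →ₗ[ℝ] ℝ) (A : V →L[ℝ] V) :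
    IsInfinitesimallyRigid B (A : V →ₗ[ℝ] V) ↔ Function.Injective (skewCommutator B A) := by
  rw [injective_iff_map_eq_zero]
  constructor
  · rintro h ⟨S, hS⟩ hSA
    rw [skewCommutator_apply, sub_eq_zero] at hSA
    have hS0 := h S hS (LinearMap.ext fun w => DFunLike.congr_fun hSA w)
    exact Subtype.ext (ContinuousLinearMap.coe_injective hS0)
  · intro h S hS hSA
    have hS0 := h ⟨LinearMap.toContinuousLinearMap S, hS⟩ (by
      rw [skewCommutator_apply, sub_eq_zero]
      exact ContinuousLinearMap.ext fun w => LinearMap.congr_fun hSA w)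
    simpa using congrArg Subtype.val hS0

theorem isGenericEndo_iff_injective {B : V →ₗ[ℝ] V →ₗ[ℝ] ℝ} (hsymm : ∀ u v, B u v = B v u)
    (hnd : ∀ u, (∀ v, B u v = 0) → u = 0) {A : V →L[ℝ] V}
    (hA : ∀ u v, B (A u) v = B u (A v)) :
    IsGenericEndo B A ↔ Function.Injective (skewCommutator B A) := by
  rw [← isInfinitesimallyRigid_iff_injective]
  have hset : {C : V →ₗ[ℝ] V | Function.Bijective C ∧ (∀ u v : V, B (C u) (C v) = B u v) ∧
      C ∘ₗ (A : V →ₗ[ℝ] V) = (A : V →ₗ[ℝ] V) ∘ₗ C} =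
      {C : Module.End ℝ V | (∀ u v, B (C u) (C v) = B u v) ∧
        C * (A : V →ₗ[ℝ] V) = (A : V →ₗ[ℝ] V) * C} := by
    refine Set.ext fun C => ⟨And.right, fun hC => ⟨?_, hC⟩⟩
    have hinj : Function.Injective C := (injective_iff_map_eq_zero C).mpr fun u hu =>
      hnd u fun v => by rw [← hC.1, hu, map_zero, LinearMap.zero_apply]
    exact ⟨hinj, LinearMap.injective_iff_surjective.mp hinj⟩
  rw [IsGenericEndo, hset]
  exact ⟨isInfinitesimallyRigid_of_finite_isometries,
    fun h => h.finite_isometries hsymm hnd hA⟩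

end Topology

/-- The affine pencil `f + s • g` of linear maps, with `g` injective, is injective for all but
finitely many `s`. -/
theorem LinearMap.finite_setOf_not_injective_add_smul {K E F : Type*} [Field K]
    [AddCommGroup E] [Module K E] [FiniteDimensional K E] [AddCommGroup F] [Module K F]
    (f g : E →ₗ[K] F) (hg : Function.Injective g) :
    {s : K | ¬Function.Injective (f + s • g)}.Finite := by
  obtain ⟨p, hp⟩ := g.exists_leftInverse_of_injective (LinearMap.ker_eq_bot.mpr hg)
  refine ((Module.End.finite_hasEigenvalue (p ∘ₗ f)).image Neg.neg).subset ?_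
  intro s hs
  have hs' : ∃ w, (f + s • g) w = 0 ∧ w ≠ 0 := by
    by_contra! h
    exact hs ((injective_iff_map_eq_zero (f + s • g)).mpr h)
  obtain ⟨w, hw, hw0⟩ := hs'
  refine ⟨-s, Module.End.hasEigenvalue_of_hasEigenvector (x := w)
    ⟨Module.End.mem_eigenspace_iff.mpr ?_, hw0⟩, neg_neg s⟩
  have h := congrArg p hw
  have hpg : p (g w) = w := LinearMap.congr_fun hp w
  simp only [LinearMap.add_apply, LinearMap.smul_apply, map_add, map_smul, hpg, map_zero] at h
  rw [LinearMap.comp_apply, neg_smul]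
  exact eq_neg_of_add_eq_zero_left h

/-- The set of generic endomorphisms is an open and dense subset
of the space `𝒜` of traceless self-adjoint endomorphisms of a pseudo-Euclidean
vector space `(V, B)`, with its natural topology. -/
theorem generic_open_dense {V : Type*} [NormedAddCommGroup V] [NormedSpace ℝ V]
    [FiniteDimensional ℝ V]
    (B : V →ₗ[ℝ] V →ₗ[ℝ] ℝ)
    (hsymm : ∀ u v : V, B u v = B v u)
    (hnd : ∀ u : V, (∀ v : V, B u v = 0) → u = 0) :
    IsOpen {A : TracelessSelfAdjoint B | IsGenericEndo B (A : V →L[ℝ] V)} ∧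
    Dense {A : TracelessSelfAdjoint B | IsGenericEndo B (A : V →L[ℝ] V)} := by
  have hiff : ∀ A : TracelessSelfAdjoint B, IsGenericEndo B (A : V →L[ℝ] V) ↔
      Function.Injective (skewCommutator B A) := fun A =>
    isGenericEndo_iff_injective hsymm hnd A.2.2
  simp only [hiff]
  constructor
  · have hopen : IsOpen {L : skewAdjointCLM B →L[ℝ] V →L[ℝ] V | Function.Injective L} :=
      ContinuousLinearMap.isOpen_injective (𝕜 := ℝ) (E := skewAdjointCLM B) (F := V →L[ℝ] V)
    exact hopen.preimage ((skewCommutator B).continuous.comp continuous_subtype_val)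
  · obtain ⟨A₀, htr, hself, hrigid⟩ :=
      exists_traceless_selfAdjoint_isInfinitesimallyRigid hsymm hnd
    let A₁ : V →L[ℝ] V := LinearMap.toContinuousLinearMap A₀
    have hA₁ : Function.Injective (skewCommutator B A₁) :=
      (isInfinitesimallyRigid_iff_injective B A₁).mp hrigid
    intro A
    let pencil : ℝ → TracelessSelfAdjoint B := fun s => ⟨A + s • A₁, by
      simp [A₁, A.2.1, htr], fun u v => by simp [A₁, A.2.2 u v, hself u v]⟩
    have hcont : Continuous pencil := by
      refine Continuous.subtype_mk ?_ _
      fun_prop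
    have hzero : pencil 0 = A := Subtype.ext (by simp [pencil])
    have hfin := LinearMap.finite_setOf_not_injective_add_smul
      (skewCommutator B A : skewAdjointCLM B →ₗ[ℝ] V →L[ℝ] V) (skewCommutator B A₁) hA₁
    rw [← hzero]
    refine map_mem_closure hcont (hfin.countable.dense_compl ℝ 0) fun s hs => ?_
    have hs' := not_not.mp hs
    change Function.Injective (skewCommutator B (A + s • A₁))
    rw [map_add, map_smul]
    exact hs'
end

section
/- Let E be a real vector space, Ω an alternating bilinear form on E, and σ : (0,∞) → GL(E) a group homomorphism from the multiplicative group (0,∞) to the group of linear automorphisms of E, written q ↦ σ_q, satisfying Ω(σ_q u, σ_q v) = q⁻¹·Ω(u,v) for all q ∈ (0,∞) and u,v ∈ E. Then the set G₀ = (0,∞) × ℝ × E with the operation (q,r,u)(q̂,r̂,û) = (qq̂, r + q⁻¹r̂ − Ω(u, σ_q û), u + σ_q û) is a group with identity (1,0,0) and inverse (q,r,u)⁻¹ = (q⁻¹, −qr, −σ_q⁻¹u), and two elements (q,r,u), (q̂,r̂,û) ∈ G₀ commute if and only if both r + q⁻¹r̂ − Ω(u, σ_q û) = r̂ + q̂⁻¹r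 − Ω(û, σ_{q̂} u) and (σ_q − 1)û = (σ_{q̂} − 1)u hold, where 1 denotes the identity operator of E. -/
/-- STATEMENT 18: Given an alternating bilinear form `Ω` on a real vector space
`E` and a homomorphism `q ↦ σ_q` from `(0,∞)` to `GL(E)` with
`Ω(σ_q u, σ_q v) = q⁻¹ Ω(u,v)`, the set `G₀ = (0,∞) × ℝ × E` with the operation
`(q,r,u)(q̂,r̂,û) = (qq̂, r + q⁻¹r̂ − Ω(u,σ_q û), u + σ_q û)` is a group with
identity `(1,0,0)` and inverse `(q,r,u)⁻¹ = (q⁻¹, −qr, −σ_q⁻¹ u)`, and two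
elements commute iff `r + q⁻¹r̂ − Ω(u,σ_q û) = r̂ + q̂⁻¹r − Ω(û,σ_q̂ u)` and
`(σ_q − 1)û = (σ_q̂ − 1)u`. -/
theorem G0_group_axioms {E : Type*} [AddCommGroup E] [Module ℝ E]
    (Ω : E →ₗ[ℝ] E →ₗ[ℝ] ℝ) (halt : ∀ u : E, Ω u u = 0)
    (σ : ℝ → E →ₗ[ℝ] E)
    (hσ1 : σ 1 = LinearMap.id)
    (hσmul : ∀ q q' : ℝ, 0 < q → 0 < q' → σ (q * q') = (σ q) ∘ₗ (σ q'))
    (hσbij : ∀ q : ℝ, 0 < q → Function.Bijective (σ q))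
    (hσΩ : ∀ q : ℝ, 0 < q → ∀ u v : E, Ω (σ q u) (σ q v) = q⁻¹ * Ω u v)
    (mul : (ℝ × ℝ × E) → (ℝ × ℝ × E) → (ℝ × ℝ × E))
    (hmul : ∀ a b : ℝ × ℝ × E, mul a b =
      (a.1 * b.1, a.2.1 + a.1⁻¹ * b.2.1 - Ω a.2.2 (σ a.1 b.2.2),
        a.2.2 + σ a.1 b.2.2)) :
    (∀ a b : ℝ × ℝ × E, 0 < a.1 → 0 < b.1 → 0 < (mul a b).1) ∧
    (∀ a b c : ℝ × ℝ × E, 0 < a.1 → 0 < b.1 → 0 < c.1 →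
      mul (mul a b) c = mul a (mul b c)) ∧
    (∀ a : ℝ × ℝ × E, 0 < a.1 →
      mul ((1 : ℝ), (0 : ℝ), (0 : E)) a = a ∧ mul a ((1 : ℝ), (0 : ℝ), (0 : E)) = a) ∧
    (∀ a : ℝ × ℝ × E, 0 < a.1 →
      mul a (a.1⁻¹, -(a.1 * a.2.1), -(σ a.1⁻¹ a.2.2)) = ((1 : ℝ), (0 : ℝ), (0 : E)) ∧
      mul (a.1⁻¹, -(a.1 * a.2.1), -(σ a.1⁻¹ a.2.2)) a = ((1 : ℝ), (0 : ℝ), (0 : E))) ∧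
    (∀ a b : ℝ × ℝ × E, 0 < a.1 → 0 < b.1 →
      (mul a b = mul b a ↔
        (a.2.1 + a.1⁻¹ * b.2.1 - Ω a.2.2 (σ a.1 b.2.2)
            = b.2.1 + b.1⁻¹ * a.2.1 - Ω b.2.2 (σ b.1 a.2.2) ∧
          σ a.1 b.2.2 - b.2.2 = σ b.1 a.2.2 - a.2.2))) := by
  have hσcomp : ∀ q q' : ℝ, 0 < q → 0 < q' → ∀ u, σ (q * q') u = σ q (σ q' u) := by
    intro q q' hq hq' u
    rw [hσmul q q' hq hq', LinearMap.comp_apply]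
  have hσinv : ∀ q : ℝ, 0 < q → ∀ u, σ q (σ q⁻¹ u) = u := by
    intro q hq u
    rw [← hσcomp q q⁻¹ hq (inv_pos.2 hq), mul_inv_cancel₀ hq.ne', hσ1, LinearMap.id_apply]
  refine ⟨?_, ?_, ?_, ?_, ?_⟩
  · intro a b ha hb
    rw [hmul]
    exact mul_pos ha hb
  · rintro ⟨q, r, u⟩ ⟨q', r', u'⟩ ⟨q'', r'', u''⟩ hq hq' -
    simp only [hmul, Prod.mk.injEq]
    refine ⟨mul_assoc _ _ _, ?_, ?_⟩
    · simp only [hσcomp q q' hq hq', map_add, LinearMap.add_apply, hσΩ q hq, mul_inv]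
      ring
    · simp only [hσcomp q q' hq hq', map_add, add_assoc]
  · rintro ⟨q, r, u⟩ -
    simp [hmul, hσ1]
  · rintro ⟨q, r, u⟩ hq
    have hq0 : q ≠ 0 := ne_of_gt hq
    simp [hmul, hσinv q hq, halt, hq0]
  · rintro ⟨q, r, u⟩ ⟨q', r', u'⟩ - -
    simp only [hmul, Prod.mk.injEq, mul_comm q q', true_and]
    refine and_congr_right fun _ => ?_
    rw [sub_eq_sub_iff_add_eq_add, add_comm u, add_comm u']
end
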